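/- arXiv:2206.14898 — 2 statements merged into one kernel-verified Lean document; each statement's English description precedes it below -/
import Mathlib

section
/- A graph G admits a map if and only if each of its biconnected components admits a map. Moreover, if G admits a hole-free map, then G is biconnected. -/
open Set

noncomputable section



/-- The unit sphere in `ℝ³`. -/
abbrev Sphere2 : Set (EuclideanSpace ℝ (Fin 3)) := Metric.sphere 0 1

/-- The closed unit disk in `ℝ²`. -/
abbrev Disk2 : Set (EuclideanSpace ℝ (Fin 2)) := Metric.closedBall 0 1

/-- `M` is a map of the graph `G` on the sphere: every vertex gets a nation homeomorphic to a
closed disk, nations have pairwise disjoint interiors, and two distinct vertices are adjacent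
iff the boundaries of their nations share a point. -/
structure IsMapOf {V : Type*} (G : SimpleGraph V) (M : V → Set ↥Sphere2) : Prop where
  nation_disk : ∀ v, Nonempty (↥(M v) ≃ₜ ↥Disk2)
  interiors_disjoint : ∀ ⦃v w : V⦄, v ≠ w → interior (M v) ∩ interior (M w) = ∅
  adj_iff : ∀ ⦃v w : V⦄, v ≠ w →
    (G.Adj v w ↔ (frontier (M v) ∩ frontier (M w)).Nonempty)

/-- A map is hole-free if the nations cover the whole sphere. -/
def IsHoleFreeMap {V : Type*} (M : V → Set ↥Sphere2) : Prop := (⋃ v, M v) = Set.univ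

/-- A `k`-map: at most `k` nations meet at any common point. -/
def IsKMapOf {V : Type*} (G : SimpleGraph V) (k : ℕ) (M : V → Set ↥Sphere2) : Prop :=
  IsMapOf G M ∧ ∀ p : ↥Sphere2, {v : V | p ∈ M v}.ncard ≤ k

def IsMapGraph {V : Type*} (G : SimpleGraph V) : Prop := ∃ M, IsMapOf G M

def IsKMapGraph {V : Type*} (G : SimpleGraph V) (k : ℕ) : Prop := ∃ M, IsKMapOf G k M

def IsHoleFreeMapGraph {V : Type*} (G : SimpleGraph V) : Prop :=
  ∃ M, IsMapOf G M ∧ IsHoleFreeMap M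

def IsHoleFreeKMapGraph {V : Type*} (G : SimpleGraph V) (k : ℕ) : Prop :=
  ∃ M, IsKMapOf G k M ∧ IsHoleFreeMap M

/-- A plane embedding of a graph: vertices are distinct points of the plane, each edge is a
simple arc between its endpoints, arcs meet other vertices only at their endpoints and meet
each other only at common endpoints. -/
structure IsPlaneEmbedding {α : Type*} (G : SimpleGraph α)
    (vtx : α → EuclideanSpace ℝ (Fin 2))
    (arc : α → α → Set (EuclideanSpace ℝ (Fin 2))) : Prop where
  vtx_inj : Function.Injective vtx
  arc_symm : ∀ u v, arc u v = arc v u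
  arc_path : ∀ ⦃u v⦄, G.Adj u v → ∃ p : Path (vtx u) (vtx v),
      Function.Injective ⇑p ∧ Set.range ⇑p = arc u v
  arc_vtx : ∀ ⦃u v⦄, G.Adj u v → ∀ w, vtx w ∈ arc u v → w = u ∨ w = v
  arc_meet : ∀ ⦃u v u' v'⦄, G.Adj u v → G.Adj u' v' → s(u, v) ≠ s(u', v') →
      arc u v ∩ arc u' v' ⊆ ({vtx u, vtx v} ∩ {vtx u', vtx v'})

/-- A graph is planar if it admits a plane embedding. -/
def GraphPlanar {α : Type*} (G : SimpleGraph α) : Prop :=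
  ∃ vtx arc, IsPlaneEmbedding G vtx arc

/-- `W` is a witness of `G`: a planar bipartite graph on the real vertices `V` and the
intersection vertices `I`, with all edges between `V` and `I`, whose half square on `V` is `G`. -/
structure IsWitness {V I : Type*} (G : SimpleGraph V) (W : SimpleGraph (V ⊕ I)) : Prop where
  planar : GraphPlanar W
  bipartite : ∀ ⦃a b : V ⊕ I⦄, W.Adj a b →
      (a.isLeft = true ∧ b.isRight = true) ∨ (a.isRight = true ∧ b.isLeft = true)
  halfSquare : ∀ v w : V, G.Adj v w ↔
      (v ≠ w ∧ ∃ i : I, W.Adj (Sum.inl v) (Sum.inr i) ∧ W.Adj (Sum.inl w) (Sum.inr i))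

/-- The degree of the intersection vertex `i` in the witness `W`. -/
def interDeg {V I : Type*} (W : SimpleGraph (V ⊕ I)) (i : I) : ℕ :=
  (W.neighborSet (Sum.inr i)).ncard




/-- An (abstract) combinatorial embedding of a graph: a collection of faces, each with a
boundary consisting of a set of closed walks; every edge lies on the boundary of some face. -/
structure CombEmbedding {α : Type*} (G : SimpleGraph α) where
  Face : Type
  boundary : Face → Set ((u : α) × G.Walk u u)
  edge_cover : ∀ e ∈ G.edgeSet, ∃ f : Face, ∃ cw ∈ boundary f, e ∈ cw.2.edges

/-- An intersection vertex is inessential if it has degree 2 and its neighbourhood is strictly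
contained in the neighbourhood of another intersection vertex. -/
def Inessential {V I : Type*} (W : SimpleGraph (V ⊕ I)) (i : I) : Prop :=
  (W.neighborSet (Sum.inr i)).ncard = 2 ∧
    ∃ i' : I, W.neighborSet (Sum.inr i) ⊂ W.neighborSet (Sum.inr i')

/-- The embedding has a face whose boundary is a single closed walk with exactly four edges
with end-vertices `v, i1, w, i2`. -/
def FourFace {V I : Type*} {W : SimpleGraph (V ⊕ I)} (emb : CombEmbedding W)
    (v w : V) (i1 i2 : I) : Prop :=
  ∃ f : emb.Face, ∃ cw : (u : V ⊕ I) × W.Walk u u, emb.boundary f = {cw} ∧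
    cw.2.length = 4 ∧
    {e | e ∈ cw.2.edges} =
      ({s(Sum.inl v, Sum.inr i1), s(Sum.inr i1, Sum.inl w),
        s(Sum.inl w, Sum.inr i2), s(Sum.inr i2, Sum.inl v)} : Set (Sym2 (V ⊕ I)))

/-- Two intersection vertices form a twin-pair. -/
def TwinPair {V I : Type*} (W : SimpleGraph (V ⊕ I)) (emb : CombEmbedding W)
    (i1 i2 : I) : Prop :=
  i1 ≠ i2 ∧ ∃ v w : V, v ≠ w ∧
    W.neighborSet (Sum.inr i1) = {Sum.inl v, Sum.inl w} ∧
    W.neighborSet (Sum.inr i2) = {Sum.inl v, Sum.inl w} ∧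
    FourFace emb v w i1 i2

/-- A compact embedded witness of `G`: a witness together with a combinatorial embedding,
containing neither inessential intersection vertices nor twin-pairs. -/
structure IsCompactWitness {V I : Type*} (G : SimpleGraph V) (W : SimpleGraph (V ⊕ I))
    (emb : CombEmbedding W) : Prop where
  witness : IsWitness G W
  no_inessential : ∀ i : I, ¬ Inessential W i
  no_twin : ∀ i1 i2 : I, ¬ TwinPair W emb i1 i2

/-- A graph is biconnected if it is connected and has no cut-vertex. -/
def IsBiconnectedG {α : Type*} (G : SimpleGraph α) : Prop :=
  G.Connected ∧ ∀ v : α, (G.induce {w | w ≠ v}).Preconnected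

/-- A connected embedded graph is a quadrangulation if each face boundary consists of a single
closed walk with 4 edges. -/
def IsQuadrangulation {α : Type*} (G : SimpleGraph α) (emb : CombEmbedding G) : Prop :=
  G.Connected ∧ ∀ f : emb.Face, ∃ cw : (u : α) × G.Walk u u,
    emb.boundary f = {cw} ∧ cw.2.length = 4

/-- A biconnected component (block) of `G`: a maximal biconnected subgraph. -/
def IsBlock {V : Type*} (G : SimpleGraph V) (B : G.Subgraph) : Prop :=
  IsBiconnectedG B.coe ∧ ∀ B' : G.Subgraph, B ≤ B' → IsBiconnectedG B'.coe → B' = B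

/-- A tree-decomposition of `G` with bags indexed by `ι`. -/
structure TreeDecomp {V : Type*} (G : SimpleGraph V) (ι : Type*) where
  tree : SimpleGraph ι
  isTree : tree.IsTree
  bag : ι → Finset V
  edge_mem : ∀ ⦃u v : V⦄, G.Adj u v → ∃ i, u ∈ bag i ∧ v ∈ bag i
  bags_connected : ∀ v : V, (tree.induce {i | v ∈ bag i}).Connected

/-- The vertices of `G` appearing in bags of the subtree rooted at `X` (w.r.t. root `ρ`):
those lying in a bag `i` such that every walk from `ρ` to `i` passes through `X`. -/
def TreeDecomp.descVerts {V ι : Type*} {G : SimpleGraph V} (td : TreeDecomp G ι)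
    (ρ X : ι) : Set V :=
  {v | ∃ i : ι, v ∈ td.bag i ∧ ∀ p : td.tree.Walk ρ i, X ∈ p.support}

/-- `X'` is a child of `X` in the tree-decomposition rooted at `ρ`. -/
def TreeDecomp.IsChild {V ι : Type*} {G : SimpleGraph V} (td : TreeDecomp G ι)
    (ρ X X' : ι) : Prop :=
  td.tree.Adj X X' ∧ ∀ p : td.tree.Walk ρ X', X ∈ p.support

/-- The treewidth of a graph. -/
def treewidth {V : Type} (G : SimpleGraph V) : ℕ :=
  sInf {t | ∃ (ι : Type) (td : TreeDecomp G ι), ∀ i, (td.bag i).card ≤ t + 1}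


section aux
open Metric Filter Topology

/-- radial retraction onto the closed unit disk -/
def rt (x : ℂ) : ℂ := (max 1 ‖x‖)⁻¹ • x

lemma rt_cont : Continuous rt := by
  unfold rt
  have h : Continuous fun x : ℂ => max 1 ‖x‖ := by fun_prop
  refine Continuous.smul (h.inv₀ ?_) continuous_id
  intro x
  positivity

lemma rt_mem (x : ℂ) : rt x ∈ closedBall (0 : ℂ) 1 := by
  have h : 0 < max 1 ‖x‖ := by positivity
  rw [mem_closedBall_zero_iff, rt, norm_smul, norm_inv, Real.norm_of_nonneg h.le,
    inv_mul_le_iff₀ h]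
  simp

lemma rt_id {x : ℂ} (hx : x ∈ closedBall (0 : ℂ) 1) : rt x = x := by
  rw [mem_closedBall_zero_iff] at hx
  simp [rt, max_eq_left hx]

lemma log_plane {f : ℂ → ℂ} (hf : Continuous f) (h0 : ∀ x, f x ≠ 0) :
    ∃ g : ℂ → ℂ, Continuous g ∧ ∀ x, Complex.exp (g x) = f x := by
  have := SimplyConnectedSpace.ofContractible ℂ
  rcases Complex.isCoveringMapOn_exp.existsUnique_continuousMap_lifts
    ⟨f, hf⟩ (Complex.exp_log (h0 0)) (fun x ↦ h0 x) with ⟨g, ⟨-, hg⟩, -⟩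
  exact ⟨g, g.continuous, fun x => congrFun hg x⟩

lemma log_disk {f : ℂ → ℂ} (hf : ContinuousOn f (closedBall 0 1))
    (h0 : ∀ x ∈ closedBall (0 : ℂ) 1, f x ≠ 0) :
    ∃ g : ℂ → ℂ, Continuous g ∧ ∀ x ∈ closedBall (0 : ℂ) 1, Complex.exp (g x) = f x := by
  obtain ⟨g, hg, he⟩ := log_plane (f := fun x => f (rt x))
    (hf.comp_continuous rt_cont rt_mem) (fun x => h0 _ (rt_mem x))
  exact ⟨g, hg, fun x hx => by rw [he, rt_id hx]⟩

lemma no_log_circle {g : ℂ → ℂ} (hg : ContinuousOn g (sphere 0 1))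
    (he : ∀ z ∈ sphere (0 : ℂ) 1, Complex.exp (g z) = z) : False := by
  have hm : ∀ t : ℝ, Complex.exp (t * Complex.I) ∈ sphere (0 : ℂ) 1 := by
    intro t; simp [Complex.norm_exp_ofReal_mul_I]
  let k : ℝ → ℂ := fun t => (g (Complex.exp (t * Complex.I)) - t * Complex.I) / (2 * Real.pi * Complex.I)
  have hk : Continuous k := by
    have h1 : Continuous fun t : ℝ => g (Complex.exp (t * Complex.I)) :=
      hg.comp_continuous (by fun_prop) hm
    exact (h1.sub (by fun_prop)).div_const _
  have h_meet : ∀ t, ∃ n : ℤ, k t = n := by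
    intro t
    have h1 := he _ (hm t)
    obtain ⟨n, hn⟩ := Complex.exp_eq_exp_iff_exists_int.1 h1
    refine ⟨n, ?_⟩
    simp only [k]
    rw [hn]
    have : (2 * Real.pi * Complex.I : ℂ) ≠ 0 := Complex.two_pi_I_ne_zero
    field_simp
    ring
  -- integer-valued continuous function is constant
  choose n hn using h_meet
  have hnc : Continuous fun t => (n t : ℝ) := by
    have : (fun t => (n t : ℝ)) = fun t => (k t).re := by
      ext t; rw [hn]; simp
    rw [this]; fun_prop
  have hnc' : Continuous n := by
    exact Int.isClosedEmbedding_coe_real.isEmbedding.continuous_iff.2 hnc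
  have heq : n 0 = n (2 * Real.pi) :=
    PreconnectedSpace.constant inferInstance hnc'
  have hkk : k 0 = k (2 * Real.pi) := by rw [hn, hn, heq]
  simp only [k] at hkk
  have hp : (2 * Real.pi * Complex.I : ℂ) ≠ 0 := Complex.two_pi_I_ne_zero
  rw [div_left_inj' hp] at hkk
  push_cast at hkk
  rw [Complex.exp_two_pi_mul_I] at hkk
  simp at hkk
  apply hp
  linear_combination hkk

lemma stable_zero {H : ℂ → ℂ} (hH : ContinuousOn H (closedBall 0 1))
    (h0 : ∀ x ∈ closedBall (0 : ℂ) 1, H x ≠ 0)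
    (h1 : ∀ x ∈ sphere (0 : ℂ) 1, ‖H x - x‖ < 1) : False := by
  obtain ⟨g, hg, he⟩ := log_disk hH h0
  have hs : ∀ x ∈ sphere (0 : ℂ) 1, H x / x ∈ Complex.slitPlane := by
    intro x hx
    have hx1 : ‖x‖ = 1 := by simpa using hx
    have hx0 : x ≠ 0 := by intro h; simp [h] at hx1
    apply Complex.ball_one_subset_slitPlane
    rw [mem_ball_iff_norm]
    have : H x / x - 1 = (H x - x) / x := by field_simp
    rw [this, norm_div, hx1, div_one]
    exact h1 x hx
  refine no_log_circle (g := fun x => g x - Complex.log (H x / x)) ?_ ?_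
  · refine hg.continuousOn.sub (ContinuousOn.clog ?_ hs)
    refine (hH.mono sphere_subset_closedBall).div continuousOn_id ?_
    rintro x hx rfl
    simp at hx
  · intro x hx
    have hx1 : ‖x‖ = 1 := by simpa using hx
    have hx0 : x ≠ 0 := by intro h; simp [h] at hx1
    have hx' := sphere_subset_closedBall hx
    rw [Complex.exp_sub, he x hx', Complex.exp_log (Complex.slitPlane_ne_zero (hs x hx))]
    have := h0 x hx'
    field_simp

/-- continuous left inverse of an embedded disk -/
lemma disk_inverse {X : Type*} [TopologicalSpace X] [T2Space X] [NormalSpace X] {φ : ℂ → X}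
    (hc : ContinuousOn φ (closedBall 0 1)) (hi : InjOn φ (closedBall 0 1)) :
    ∃ G : X → ℂ, Continuous G ∧ ∀ x ∈ closedBall (0 : ℂ) 1, G (φ x) = x := by
  have hcpt : CompactSpace (closedBall (0 : ℂ) 1) := isCompact_iff_compactSpace.1 (isCompact_closedBall 0 1)
  have hemb : IsClosedEmbedding (fun x : closedBall (0 : ℂ) 1 => φ x) := by
    apply Continuous.isClosedEmbedding
    · exact continuousOn_iff_continuous_domRestrict.1 hc
    · exact injOn_iff_injective.1 hi
  obtain ⟨G, hG⟩ := ContinuousMap.exists_extension' (Y := ℂ) hemb ⟨fun x => (x : ℂ), by fun_prop⟩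
  refine ⟨G, G.continuous, fun x hx => ?_⟩
  exact congrFun hG ⟨x, hx⟩

/-- Invariance of domain in the plane. -/
lemma iod_plane {φ : ℂ → ℂ} (hc : ContinuousOn φ (closedBall 0 1))
    (hi : InjOn φ (closedBall 0 1)) : φ 0 ∈ interior (φ '' closedBall 0 1) := by
  by_contra hni
  obtain ⟨G, hG, hGφ⟩ := disk_inverse hc hi
  have h00 : (0 : ℂ) ∈ closedBall (0 : ℂ) 1 := by simp
  set K := φ '' closedBall 0 1 with hK
  have hKc : IsCompact K := (isCompact_closedBall 0 1).image_of_continuousOn hc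
  obtain ⟨ε, hε, hεG⟩ : ∃ ε > 0, ∀ y, dist y (φ 0) < 2 * ε → ‖G y‖ < 1 / 10 := by
    have := Metric.continuousAt_iff.1 (hG.continuousAt (x := φ 0)) (1/10) (by norm_num)
    obtain ⟨δ, hδ, h⟩ := this
    refine ⟨δ / 2, by positivity, fun y hy => ?_⟩
    have := h (x := y) (by linarith)
    rwa [hGφ 0 h00, dist_zero_right] at this
  obtain ⟨c, hcK, hcε⟩ : ∃ c ∈ Kᶜ, dist (φ 0) c < ε := by
    have : φ 0 ∈ closure Kᶜ := by rw [closure_compl]; exact hni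
    exact Metric.mem_closure_iff.1 this ε hε
  have hS1c : IsCompact (K \ ball c ε) := hKc.diff isOpen_ball
  have hGS1 : ∀ y ∈ K \ ball c ε, G y ≠ 0 := by
    rintro y ⟨⟨x, hx, rfl⟩, hy⟩ h0
    rw [hGφ x hx] at h0
    subst h0
    exact hy hcε
  obtain ⟨m, hm, hmG⟩ : ∃ m > 0, ∀ y ∈ K \ ball c ε, m ≤ ‖G y‖ := by
    rcases (K \ ball c ε).eq_empty_or_nonempty with he | hne
    · exact ⟨1, one_pos, by simp [he]⟩
    · obtain ⟨y, hy, hmin⟩ := hS1c.exists_isMinOn hne hG.norm.continuousOn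
      exact ⟨‖G y‖, norm_pos_iff.2 (hGS1 y hy), fun z hz => hmin hz⟩
  set δ := min m (1 / 10) with hδ
  have hδ0 : 0 < δ := by positivity
  obtain ⟨P, hP, hPG, -⟩ := hG.exists_contDiff_approx 1 (ε := fun _ => δ / 2) continuous_const
    (fun _ => by positivity)
  have hcirc : ContDiff ℝ 1 (fun t : ℝ => P (c + ε * Complex.exp (t * Complex.I))) := by
    refine hP.comp ?_
    refine contDiff_const.add (contDiff_const.mul ?_)
    exact (Complex.ofRealCLM.contDiff.mul contDiff_const).cexp
  have hdense := hcirc.dense_compl_range_of_finrank_lt_finrank (by simp)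
  obtain ⟨a, ha, haδ⟩ := Metric.mem_closure_iff.1 (hdense (0 : ℂ)) (δ / 2) (by positivity)
  rw [dist_zero_left] at haδ
  have hPa : ∀ y, ‖(P y - a) - G y‖ < δ := by
    intro y
    have h1 := hPG y
    rw [dist_eq_norm] at h1
    calc ‖(P y - a) - G y‖ = ‖(P y - G y) - a‖ := by ring_nf
      _ ≤ _ := norm_sub_le _ _
      _ < δ := by linarith
  have hPsph : ∀ y ∈ sphere c ε, P y - a ≠ 0 := by
    intro y hy h0
    apply ha
    refine ⟨Complex.arg (y - c), ?_⟩
    have hy' : ‖y - c‖ = ε := by simpa [dist_eq_norm] using hy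
    have : (ε : ℂ) * Complex.exp (Complex.arg (y - c) * Complex.I) = y - c := by
      rw [← hy']; exact Complex.norm_mul_exp_arg_mul_I _
    simp only [this]
    rw [add_sub_cancel]
    linear_combination h0
  have hPS1 : ∀ y ∈ K \ ball c ε, P y - a ≠ 0 := by
    intro y hy h0
    have h1 := hPa y
    rw [h0, zero_sub, norm_neg] at h1
    have h2 := hmG y hy
    have h3 : δ ≤ m := min_le_left _ _
    linarith
  let Φ : ℂ → ℂ := fun y => c + (max ε ‖y - c‖ / ‖y - c‖) • (y - c)
  have hΦid : ∀ y, y ∉ ball c ε → Φ y = y := by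
    intro y hy
    have hy' : ε ≤ ‖y - c‖ := by simpa [dist_eq_norm] using hy
    have : ‖y - c‖ ≠ 0 := by linarith
    simp only [Φ, max_eq_right hy', div_self this, one_smul, add_sub_cancel]
  have hΦs : ∀ y ∈ ball c ε, y ≠ c → Φ y ∈ sphere c ε := by
    intro y hy hyc
    have hy' : ‖y - c‖ < ε := by simpa [dist_eq_norm] using hy
    have : ‖y - c‖ ≠ 0 := by simpa [sub_eq_zero] using hyc
    simp only [Φ, max_eq_left hy'.le, mem_sphere_iff_norm, add_sub_cancel_left, norm_smul, norm_div,
      norm_norm]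
    rw [Real.norm_of_nonneg hε.le]
    field_simp
  have hKne : ∀ y ∈ K, y ≠ c := fun y hy h => hcK (h ▸ hy)
  have hΦc : ContinuousOn Φ K := by
    have h1 : ContinuousOn (fun y => max ε ‖y - c‖ / ‖y - c‖) K := by
      refine ContinuousOn.div (by fun_prop) (by fun_prop) ?_
      intro y hy
      simpa [sub_eq_zero] using hKne y hy
    have h2 : ContinuousOn (fun y => (max ε ‖y - c‖ / ‖y - c‖) • (y - c)) K :=
      h1.smul (by fun_prop)
    exact continuousOn_const.add h2
  have hΦne : ∀ y ∈ K, P (Φ y) - a ≠ 0 := by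
    intro y hy
    by_cases hb : y ∈ ball c ε
    · exact hPsph _ (hΦs y hb (hKne y hy))
    · rw [hΦid y hb]; exact hPS1 y ⟨hy, hb⟩
  refine stable_zero (H := fun x => P (Φ (φ x)) - a) ?_ ?_ ?_
  · refine ContinuousOn.sub ?_ continuousOn_const
    exact hP.continuous.comp_continuousOn (hΦc.comp hc (mapsTo_image _ _))
  · intro x hx
    exact hΦne _ (mem_image_of_mem _ hx)
  · intro x hx
    have hx' := sphere_subset_closedBall hx
    have hx1 : ‖x‖ = 1 := by simpa using hx
    have hb : φ x ∉ ball c ε := by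
      intro hb
      have := hεG (φ x) (by
        have := dist_triangle_right (φ x) (φ 0) c
        rw [mem_ball] at hb
        linarith)
      rw [hGφ x hx', hx1] at this
      norm_num at this
    have h1 := hPa (φ x)
    simp only [hΦid _ hb]
    rw [hGφ x hx'] at h1
    have h3 : δ ≤ 1 / 10 := min_le_right _ _
    linarith

/-- planar lemma: an embedded disk has no bounded complementary component. -/
lemma nonsep_plane {φ : ℂ → ℂ} (hc : ContinuousOn φ (closedBall 0 1))
    (hi : InjOn φ (closedBall 0 1)) {U : Set ℂ} (hU : IsOpen U)
    (hUK : Disjoint U (φ '' closedBall 0 1)) (hcl : IsClosed (U ∪ φ '' closedBall 0 1))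
    (hb : Bornology.IsBounded U) : U = ∅ := by
  classical
  by_contra hne
  obtain ⟨p, hp⟩ := nonempty_iff_ne_empty.2 hne
  obtain ⟨G, hG, hGφ⟩ := disk_inverse hc hi
  set K := φ '' closedBall 0 1 with hK
  have hpK : ∀ y ∈ K, y - p ≠ 0 := by
    intro y hy h
    rw [sub_eq_zero] at h
    exact disjoint_left.1 hUK hp (h ▸ hy)
  obtain ⟨g, hg, hge⟩ := log_disk (f := fun x => φ x - p) (hc.sub continuousOn_const)
    (fun x hx => hpK _ (mem_image_of_mem _ hx))
  have hgG : ∀ y ∈ K, Complex.exp (g (G y)) = y - p := by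
    rintro y ⟨x, hx, rfl⟩
    rw [hGφ x hx, hge x hx]
  let F : ℂ → ℂ := fun z => if z ∈ U then Complex.exp (g (G z)) else z - p
  have hF : Continuous F := by
    rw [← continuousOn_univ]
    have : (univ : Set ℂ) = (U ∪ K) ∪ Uᶜ := by
      ext z; by_cases h : z ∈ U <;> simp [h]
    rw [this]
    refine ContinuousOn.union_of_isClosed ?_ ?_ hcl hU.isClosed_compl
    · refine ContinuousOn.congr (f := fun z => Complex.exp (g (G z))) (by fun_prop) ?_
      rintro z (hz | hz)
      · simp [F, hz]
      · by_cases h : z ∈ U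
        · simp [F, h]
        · simp [F, h, hgG z hz]
    · refine ContinuousOn.congr (f := fun z => z - p) (by fun_prop) ?_
      intro z hz
      simp only [F]
      rw [if_neg hz]
  have hF0 : ∀ z, F z ≠ 0 := by
    intro z
    simp only [F]
    split_ifs with h
    · exact Complex.exp_ne_zero _
    · intro h0
      rw [sub_eq_zero] at h0
      exact h (h0 ▸ hp)
  obtain ⟨l, hl, hle⟩ := log_plane hF hF0
  obtain ⟨R, hR⟩ := hb.subset_ball p
  have hR0 : 0 < R := pos_of_mem_ball (hR hp)
  refine no_log_circle (g := fun z => l (p + R * z) - Complex.log R) (by fun_prop) ?_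
  intro z hz
  have hz1 : ‖z‖ = 1 := by simpa using hz
  have hnot : p + R * z ∉ U := by
    intro h
    have := hR h
    rw [mem_ball_iff_norm] at this
    simp [hz1, abs_of_pos hR0] at this
  have hRc : (R : ℂ) ≠ 0 := by exact_mod_cast hR0.ne'
  rw [Complex.exp_sub, hle, Complex.exp_log hRc]
  simp only [F, if_neg hnot]
  field_simp
  ring

lemma chart (p : ↥Sphere2) : ∃ s : ℂ → ↥Sphere2, IsOpenEmbedding s ∧ range s = {p}ᶜ := by
  have : Fact (Module.finrank ℝ (EuclideanSpace ℝ (Fin 3)) = 2 + 1) := ⟨by simp⟩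
  let e := (stereographic' 2 p).symm
  have he : e.source = univ := by simp [e]
  have h1 : IsOpenEmbedding e := e.isOpenEmbedding he
  let L := Complex.orthonormalBasisOneI.repr.toHomeomorph
  refine ⟨e ∘ L, h1.comp L.isOpenEmbedding, ?_⟩
  rw [range_comp, L.surjective.range_eq, ← he, e.image_source_eq_target]
  simp [e]

/-- lift through an open embedding -/
lemma lift_chart {X : Type*} [TopologicalSpace X] {s : ℂ → X} (hs : IsOpenEmbedding s)
    {φ : ℂ → X} {D : Set ℂ}
    (hc : ContinuousOn φ D) (hi : InjOn φ D) (hr : ∀ x ∈ D, φ x ∈ range s) :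
    ∃ f : ℂ → ℂ, ContinuousOn f D ∧ InjOn f D ∧ ∀ x ∈ D, s (f x) = φ x := by
  have : ∀ x : ℂ, ∃ y : ℂ, x ∈ D → s y = φ x := by
    intro x
    by_cases hx : x ∈ D
    · obtain ⟨y, hy⟩ := hr x hx
      exact ⟨y, fun _ => hy⟩
    · exact ⟨0, fun h => absurd h hx⟩
  choose f hf using this
  refine ⟨f, ?_, ?_, hf⟩
  · rw [hs.isEmbedding.isInducing.continuousOn_iff]
    exact hc.congr (fun x hx => hf x hx)
  · intro x hx y hy hxy
    apply hi hx hy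
    rw [← hf x hx, ← hf y hy, hxy]

lemma exists_ne_sphere (q : ↥Sphere2) : ∃ p : ↥Sphere2, p ≠ q := by
  refine ⟨-q, ?_⟩
  exact (ne_neg_of_mem_unit_sphere ℝ q).symm

lemma iod_sphere {φ : ℂ → ↥Sphere2} (hc : ContinuousOn φ (closedBall 0 1))
    (hi : InjOn φ (closedBall 0 1)) : IsOpen (φ '' ball 0 1) := by
  rw [isOpen_iff_mem_nhds]
  rintro _ ⟨x₀, hx₀, rfl⟩
  obtain ⟨p, hp⟩ := exists_ne_sphere (φ x₀)
  obtain ⟨s, hs, hsr⟩ := chart p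
  have hca : ContinuousAt φ x₀ := hc.continuousAt (mem_of_superset (isOpen_ball.mem_nhds hx₀) ball_subset_closedBall)
  have h1 : ∀ᶠ x in 𝓝 x₀, φ x ≠ p := hca.eventually_ne hp.symm
  obtain ⟨r, hr, hrs⟩ := nhds_basis_closedBall.mem_iff.1 (h1.and (isOpen_ball.mem_nhds hx₀))
  let a : ℂ → ℂ := fun x => x₀ + r * x
  have hrc : (r : ℂ) ≠ 0 := by exact_mod_cast hr.ne'
  have ham : ∀ x ∈ closedBall (0 : ℂ) 1, a x ∈ closedBall x₀ r := by
    intro x hx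
    rw [mem_closedBall_zero_iff] at hx
    rw [mem_closedBall_iff_norm]
    simp only [a, add_sub_cancel_left, norm_mul, Complex.norm_real, Real.norm_of_nonneg hr.le]
    nlinarith
  have hamb : ∀ x ∈ closedBall (0 : ℂ) 1, a x ∈ ball (0 : ℂ) 1 := fun x hx => (hrs (ham x hx)).2
  obtain ⟨f, hfc, hfi, hf⟩ := lift_chart hs (φ := φ ∘ a) (D := closedBall 0 1)
    (hc.comp (by fun_prop) (fun x hx => ball_subset_closedBall (hamb x hx)))
    (by
      intro x hx y hy hxy
      have := hi (ball_subset_closedBall (hamb x hx)) (ball_subset_closedBall (hamb y hy)) hxy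
      simpa [a, hrc] using this)
    (by
      intro x hx
      rw [hsr]
      exact (hrs (ham x hx)).1)
  have h_meet := iod_plane hfc hfi
  have h0 : s (f 0) = φ x₀ := by
    rw [hf 0 (by simp)]; simp [a]
  rw [← h0]
  refine mem_of_superset (hs.isOpenMap.image_mem_nhds (mem_interior_iff_mem_nhds.1 h_meet)) ?_
  rintro _ ⟨_, ⟨x, hx, rfl⟩, rfl⟩
  rw [hf x hx]
  exact mem_image_of_mem _ (hamb x hx)

lemma nonsep_sphere {φ : ℂ → ↥Sphere2} (hc : ContinuousOn φ (closedBall 0 1))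
    (hi : InjOn φ (closedBall 0 1)) : IsPreconnected (φ '' closedBall 0 1)ᶜ := by
  set K := φ '' closedBall 0 1 with hK
  have hKc : IsCompact K := (isCompact_closedBall 0 1).image_of_continuousOn hc
  have hKo : IsOpen Kᶜ := hKc.isClosed.isOpen_compl
  intro u v hu hv huv hku hkv
  by_contra hemp
  rw [not_nonempty_iff_eq_empty] at hemp
  obtain ⟨q, hqK, hqv⟩ := hkv
  obtain ⟨p, hpK, hpu⟩ := hku
  obtain ⟨s, hs, hsr⟩ := chart q
  have hdis : ∀ z, z ∈ Kᶜ → z ∈ u → z ∈ v → False := fun z h1 h2 h3 => by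
    have : z ∈ Kᶜ ∩ (u ∩ v) := ⟨h1, h2, h3⟩
    simp [hemp] at this
  have hrK : ∀ x ∈ closedBall (0 : ℂ) 1, φ x ∈ range s := by
    intro x hx
    rw [hsr]
    intro h
    rw [mem_singleton_iff] at h
    exact hqK (h ▸ mem_image_of_mem _ hx)
  obtain ⟨f, hfc, hfi, hf⟩ := lift_chart hs hc hi hrK
  have hfK : f '' closedBall 0 1 = s ⁻¹' K := by
    ext y
    constructor
    · rintro ⟨x, hx, rfl⟩
      rw [mem_preimage, hf x hx]
      exact mem_image_of_mem _ hx
    · rintro ⟨x, hx, hxy⟩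
      refine ⟨x, hx, hs.injective ?_⟩
      rw [hf x hx, hxy]
  -- U is the part u
  have hU : IsOpen (s ⁻¹' (Kᶜ ∩ u)) := (hKo.inter hu).preimage hs.continuous
  have hpr : p ∈ range s := by
    rw [hsr]
    rintro rfl
    exact hdis p hpK hpu hqv
  obtain ⟨p', rfl⟩ := hpr
  have key : s ⁻¹' (Kᶜ ∩ u) = ∅ := by
    refine nonsep_plane hfc hfi hU ?_ ?_ ?_
    · rw [hfK, disjoint_left]
      exact fun z hz hz' => hz.1 hz'
    · rw [hfK]
      have : s ⁻¹' (Kᶜ ∩ u) ∪ s ⁻¹' K = (s ⁻¹' (Kᶜ ∩ v))ᶜ := by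
        ext z
        simp only [mem_union, mem_preimage, mem_inter_iff, mem_compl_iff]
        constructor
        · rintro (h | h) ⟨h1, h2⟩
          · exact hdis _ h1 h.2 h2
          · exact h1 h
        · intro h
          by_cases hz : s z ∈ K
          · exact Or.inr hz
          · rcases huv hz with h1 | h1
            · exact Or.inl ⟨hz, h1⟩
            · exact absurd ⟨hz, h1⟩ h
      rw [this]
      exact ((hKo.inter hv).preimage hs.continuous).isClosed_compl
    · -- contained in the preimage of compact set avoiding q
      have hC : IsCompact (Kᶜ ∩ v)ᶜ := (hKo.inter hv).isClosed_compl.isCompact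
      have hC' : IsCompact (s ⁻¹' (Kᶜ ∩ v)ᶜ) := by
        rw [hs.isEmbedding.isInducing.isCompact_iff, image_preimage_eq_inter_range, inter_eq_left.2]
        · exact hC
        · rw [hsr]
          rintro z hz rfl
          exact hz ⟨hqK, hqv⟩
      refine hC'.isBounded.subset ?_
      intro z hz hz'
      exact hdis _ hz.1 hz.2 hz'.2
  have : p' ∈ s ⁻¹' (Kᶜ ∩ u) := ⟨hpK, hpu⟩
  simp [key] at this

def radFun (R p : ℝ) (x : ℂ) : ℂ := if ‖x‖ ≤ R then (‖x‖ / R) ^ (p - 1) • x else x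

lemma radFun_norm {R p : ℝ} (hR : 0 < R) (hp : 0 < p) (x : ℂ) :
    ‖(‖x‖ / R) ^ (p - 1) • x‖ = R * (‖x‖ / R) ^ p := by
  rcases eq_or_ne x 0 with rfl | hx
  · simp [Real.zero_rpow hp.ne']
  · have hx' : 0 < ‖x‖ := norm_pos_iff.2 hx
    have h : 0 < ‖x‖ / R := by positivity
    rw [norm_smul, Real.norm_of_nonneg (by positivity), Real.rpow_sub_one h.ne']
    field_simp

lemma radFun_cont {R p : ℝ} (hR : 0 < R) (hp : 0 < p) : Continuous (radFun R p) := by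
  unfold radFun
  refine Continuous.if_le ?_ continuous_id continuous_norm continuous_const ?_
  · rw [continuous_iff_continuousAt]
    intro x
    rcases eq_or_ne x 0 with rfl | hx
    · unfold ContinuousAt
      simp only [smul_zero]
      rw [tendsto_zero_iff_norm_tendsto_zero]
      simp only [radFun_norm hR hp]
      have : Continuous fun x : ℂ => R * (‖x‖ / R) ^ p := by
        refine continuous_const.mul (Continuous.rpow_const (by fun_prop) (fun x => Or.inr hp.le))
      have h := this.tendsto 0
      simpa [Real.zero_rpow hp.ne'] using h
    · have h1 : ContinuousAt (fun x : ℂ => (‖x‖ / R) ^ (p - 1)) x := by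
        refine ContinuousAt.rpow_const (by fun_prop) (Or.inl ?_)
        have := norm_pos_iff.2 hx
        positivity
      exact h1.smul continuousAt_id
  · intro x hx
    rw [hx, div_self hR.ne', Real.one_rpow, one_smul]

lemma radFun_inv {R p : ℝ} (hR : 0 < R) (hp : 0 < p) (x : ℂ) :
    radFun R p⁻¹ (radFun R p x) = x := by
  by_cases hx : ‖x‖ ≤ R
  · have h1 : radFun R p x = (‖x‖ / R) ^ (p - 1) • x := by simp [radFun, hx]
    have hn : ‖radFun R p x‖ = R * (‖x‖ / R) ^ p := by rw [h1, radFun_norm hR hp]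
    have hle : ‖radFun R p x‖ ≤ R := by
      rw [hn]
      have : (‖x‖ / R) ^ p ≤ 1 := Real.rpow_le_one (by positivity) ((div_le_one hR).2 hx) hp.le
      nlinarith
    rw [radFun, if_pos hle, hn, h1, smul_smul, mul_div_cancel_left₀ _ hR.ne']
    rcases eq_or_ne x 0 with rfl | hx0
    · simp
    have hx' : 0 < ‖x‖ := norm_pos_iff.2 hx0
    have h : 0 < ‖x‖ / R := by positivity
    rw [← Real.rpow_mul h.le, ← Real.rpow_add h]
    have : p * (p⁻¹ - 1) + (p - 1) = 0 := by field_simp; ring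
    rw [this, Real.rpow_zero, one_smul]
  · simp [radFun, hx]

lemma radial {R p : ℝ} (hR : 0 < R) (hp : 0 < p) : ∃ h : ℂ ≃ₜ ℂ,
    (∀ x, R ≤ ‖x‖ → h x = x) ∧ (∀ x, ‖x‖ ≤ R → ‖h x‖ = R * (‖x‖ / R) ^ p) := by
  refine ⟨⟨⟨radFun R p, radFun R p⁻¹, radFun_inv hR hp, ?_⟩, radFun_cont hR hp,
    radFun_cont hR (inv_pos.2 hp)⟩, ?_, ?_⟩
  · intro x
    have := radFun_inv hR (inv_pos.2 hp) x
    rwa [inv_inv] at this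
  · intro x hx
    show radFun R p x = x
    unfold radFun
    split_ifs with h
    · rw [le_antisymm h hx, div_self hR.ne', Real.one_rpow, one_smul]
    · rfl
  · intro x hx
    show ‖radFun R p x‖ = _
    rw [radFun, if_pos hx, radFun_norm hR hp]

lemma ext_fun {X : Type*} [TopologicalSpace X] [T2Space X] {s : ℂ → X} (hs : IsOpenEmbedding s)
    {h : ℂ → ℂ} (hc : Continuous h) {R : ℝ} (hid : ∀ x, R ≤ ‖x‖ → h x = x) :
    ∃ H : X → X, Continuous H ∧ (∀ x, H (s x) = s (h x)) ∧ ∀ y ∉ range s, H y = y := by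
  classical
  let H : X → X := fun y => if hy : y ∈ range s then s (h hy.choose) else y
  have h1 : ∀ x, H (s x) = s (h x) := by
    intro x
    have hy : s x ∈ range s := mem_range_self x
    simp only [H, dif_pos hy]
    rw [hs.injective hy.choose_spec]
  have h2 : ∀ y ∉ range s, H y = y := by
    intro y hy
    simp only [H, dif_neg hy]
  refine ⟨H, ?_, h1, h2⟩
  rw [continuous_iff_continuousAt]
  intro y
  by_cases hy : y ∈ range s
  · obtain ⟨x, rfl⟩ := hy
    rw [hs.continuousAt_iff.symm]
    have : H ∘ s = s ∘ h := funext h1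
    rw [this]
    exact (hs.continuous.comp hc).continuousAt
  · have hcl : IsClosed (s '' closedBall 0 R) :=
      ((isCompact_closedBall 0 R).image hs.continuous).isClosed
    have hmem : (s '' closedBall 0 R)ᶜ ∈ 𝓝 y := hcl.isOpen_compl.mem_nhds (fun h => hy (image_subset_range _ _ h))
    refine continuousAt_id.congr ?_
    filter_upwards [hmem] with z hz
    by_cases hzr : z ∈ range s
    · obtain ⟨x, rfl⟩ := hzr
      have : x ∉ closedBall (0 : ℂ) R := fun h => hz (mem_image_of_mem _ h)
      rw [mem_closedBall_zero_iff, not_le] at this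
      rw [h1, hid x this.le]; rfl
    · rw [h2 z hzr]; rfl

lemma ext_homeo {X : Type*} [TopologicalSpace X] [T2Space X] {s : ℂ → X} (hs : IsOpenEmbedding s)
    (h : ℂ ≃ₜ ℂ) {R : ℝ} (hid : ∀ x, R ≤ ‖x‖ → h x = x) :
    ∃ H : X ≃ₜ X, (∀ x, H (s x) = s (h x)) ∧ (∀ y ∉ range s, H y = y) ∧
      ∀ y ∉ s '' closedBall 0 R, H y = y := by
  obtain ⟨H, hH, h1, h2⟩ := ext_fun hs h.continuous hid
  obtain ⟨H', hH', h1', h2'⟩ := ext_fun hs h.symm.continuous (R := R) (by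
    intro x hx
    rw [h.symm_apply_eq, hid x hx])
  refine ⟨⟨⟨H, H', ?_, ?_⟩, hH, hH'⟩, h1, h2, ?_⟩
  · intro y
    by_cases hy : y ∈ range s
    · obtain ⟨x, rfl⟩ := hy
      rw [h1, h1', h.symm_apply_apply]
    · rw [h2 y hy, h2' y hy]
  · intro y
    by_cases hy : y ∈ range s
    · obtain ⟨x, rfl⟩ := hy
      rw [h1', h1, h.apply_symm_apply]
    · rw [h2' y hy, h2 y hy]
  · intro y hy
    show H y = y
    by_cases hyr : y ∈ range s
    · obtain ⟨x, rfl⟩ := hyr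
      have : x ∉ closedBall (0 : ℂ) R := fun h => hy (mem_image_of_mem _ h)
      rw [mem_closedBall_zero_iff, not_le] at this
      rw [h1, hid x this.le]
    · exact h2 y hyr

section Brown
variable {X : Type*} [MetricSpace X] [CompactSpace X]

lemma compact_preim {s : ℂ → X} (hs : IsOpenEmbedding s) {C : Set X} (hC : IsClosed C)
    (hr : C ⊆ range s) : IsCompact (s ⁻¹' C) := by
  rw [hs.isEmbedding.isInducing.isCompact_iff, image_preimage_eq_inter_range, inter_eq_left.2 hr]
  exact hC.isCompact

lemma shrink {φ s : ℂ → X} (hφ : IsOpenEmbedding φ) (hs : IsOpenEmbedding s)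
    (hsr : range s = {φ 0}ᶜ) (r : ℝ) {δ : ℝ} (hδ : 0 < δ) :
    ∃ θ : X ≃ₜ X, (∀ x, ‖x‖ ≤ r → θ (φ x) = φ x) ∧ ∃ a, ∀ y ∉ range φ, dist (θ y) a < δ := by
  have hA : IsCompact (s ⁻¹' (range φ)ᶜ) := by
    refine compact_preim hs hφ.isOpen_range.isClosed_compl ?_
    rw [hsr]
    exact compl_subset_compl.2 (by rintro _ rfl; exact mem_range_self _)
  obtain ⟨R', hR', hAR⟩ : ∃ R' > 0, s ⁻¹' (range φ)ᶜ ⊆ closedBall 0 R' := by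
    obtain ⟨R', h⟩ := hA.isBounded.subset_closedBall 0
    exact ⟨max R' 1, by positivity, h.trans (closedBall_subset_closedBall (le_max_left _ _))⟩
  set R := R' + 1 with hRdef
  have hR : 0 < R := by positivity
  have hO : (s '' closedBall 0 R)ᶜ ∈ 𝓝 (φ 0) := by
    refine ((isCompact_closedBall 0 R).image hs.continuous).isClosed.isOpen_compl.mem_nhds ?_
    intro h
    have := image_subset_range _ _ h
    rw [hsr] at this
    exact this rfl
  obtain ⟨t, ht, hts⟩ := Metric.mem_nhds_iff.1 (hφ.continuous.continuousAt.preimage_mem_nhds hO)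
  set Q := max r t + 1 with hQdef
  have hQt : t < Q := by have := le_max_right r t; linarith
  have hQr : r < Q := by have := le_max_left r t; linarith
  have hQ : 0 < Q := ht.trans hQt
  obtain ⟨p, hp, hpr⟩ : ∃ p : ℝ, 0 < p ∧ r < Q * (t / Q) ^ p := by
    have hc : ContinuousAt (fun p : ℝ => Q * (t / Q) ^ p) 0 := by
      refine continuousAt_const.mul (Real.continuousAt_const_rpow ?_)
      positivity
    have h1 : ∀ᶠ p in 𝓝 (0 : ℝ), r < Q * (t / Q) ^ p := by
      refine hc.eventually (lt_mem_nhds ?_)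
      simpa using hQr
    have h2 : ∀ᶠ p in 𝓝[>] (0 : ℝ), r < Q * (t / Q) ^ p := h1.filter_mono nhdsWithin_le_nhds
    obtain ⟨p, hp1, hp2⟩ := (h2.and self_mem_nhdsWithin).exists
    exact ⟨p, hp2, hp1⟩
  obtain ⟨k, hkid, hkn⟩ := radial hQ hp
  obtain ⟨g, hg1, hg2, -⟩ := ext_homeo hφ k hkid
  have hk : ∀ x, t ≤ ‖x‖ → r < ‖k x‖ := by
    intro x hx
    by_cases hxQ : ‖x‖ ≤ Q
    · rw [hkn x hxQ]
      refine hpr.trans_le ?_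
      gcongr
    · push Not at hxQ
      rw [hkid x hxQ.le]
      exact hQr.trans hxQ
  obtain ⟨η, hη, hηg⟩ : ∃ η > 0, ∀ w : ℂ, ‖w‖ < η → dist (g (s w)) (g (s 0)) < δ := by
    have hc : Continuous fun w => g (s w) := g.continuous.comp hs.continuous
    obtain ⟨η, hη, h⟩ := Metric.continuousAt_iff.1 (hc.continuousAt (x := 0)) δ hδ
    exact ⟨η, hη, fun w hw => h (by simpa using hw)⟩
  obtain ⟨q, hq, hqη⟩ : ∃ q : ℝ, 0 < q ∧ R * (R' / R) ^ q < η := by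
    have h1 : R' / R < 1 := by rw [div_lt_one hR]; linarith
    have h0 : Tendsto (fun q : ℝ => R * (R' / R) ^ q) atTop (𝓝 (R * 0)) :=
      (tendsto_rpow_atTop_of_base_lt_one _ (by have : 0 < R' / R := by positivity
                                               linarith) h1).const_mul R
    rw [mul_zero] at h0
    obtain ⟨q, h2, h3⟩ := ((h0.eventually (gt_mem_nhds hη)).and (eventually_gt_atTop 0)).exists
    exact ⟨q, h3, h2⟩
  obtain ⟨c', hc'id, hc'n⟩ := radial hR hq
  obtain ⟨c, hc1, -, hc3⟩ := ext_homeo hs c' hc'id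
  refine ⟨(g.symm.trans c).trans g, ?_, g (s 0), ?_⟩
  · intro x hx
    have h1 : g.symm (φ x) = φ (k.symm x) := by
      rw [g.symm_apply_eq, hg1, k.apply_symm_apply]
    have h2 : ‖k.symm x‖ < t := by
      by_contra h
      push Not at h
      have := hk _ h
      rw [k.apply_symm_apply] at this
      linarith
    have h3 : φ (k.symm x) ∈ (s '' closedBall 0 R)ᶜ := hts (by simpa using h2)
    simp only [Homeomorph.trans_apply]
    rw [h1, hc3 _ h3, hg1, k.apply_symm_apply]
  · intro y hy
    have h1 : g.symm y = y := by rw [g.symm_apply_eq, hg2 y hy]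
    have hys : y ∈ range s := by
      rw [hsr]
      rintro rfl
      exact hy (mem_range_self _)
    obtain ⟨z, rfl⟩ := hys
    have hz : ‖z‖ ≤ R' := by simpa using hAR hy
    simp only [Homeomorph.trans_apply]
    rw [h1, hc1]
    apply hηg
    rw [hc'n z (by linarith)]
    refine lt_of_le_of_lt ?_ hqη
    gcongr

lemma brown_step {φ s : ℂ → X} (hφ : IsOpenEmbedding φ) (hs : IsOpenEmbedding s)
    (hsr : range s = {φ 0}ᶜ) (n : ℕ) (P : (X ≃ₜ X) × ℝ) :
    ∃ P' : (X ≃ₜ X) × ℝ, P.2 + 1 ≤ P'.2 ∧ (∀ x, ‖x‖ ≤ P.2 → P'.1 (φ x) = P.1 (φ x)) ∧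
      ∃ a, ∀ y ∉ φ '' closedBall 0 P'.2, dist (P'.1 y) a < 1 / ((n : ℝ) + 1) := by
  obtain ⟨Θ, r⟩ := P
  have hε : 0 < 1 / ((n : ℝ) + 1) := by positivity
  have huc := CompactSpace.uniformContinuous_of_continuous Θ.continuous
  obtain ⟨δ, hδ, hΘ⟩ := Metric.uniformContinuous_iff.1 huc _ hε
  obtain ⟨θ, hθ1, a, hθa⟩ := shrink hφ hs hsr r hδ
  let W : Set X := (θ.trans Θ) ⁻¹' ball (Θ a) (1 / ((n : ℝ) + 1))
  have hW : IsOpen W := isOpen_ball.preimage (θ.trans Θ).continuous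
  have hWA : Wᶜ ⊆ range φ := by
    intro y hy
    by_contra h
    exact hy (hΘ (hθa y h))
  have hWc := compact_preim hφ hW.isClosed_compl hWA
  obtain ⟨r', hr'⟩ := hWc.isBounded.subset_closedBall 0
  refine ⟨(θ.trans Θ, max r' (r + 1)), le_max_right _ _, ?_, Θ a, ?_⟩
  · intro x hx
    simp only [Homeomorph.trans_apply]
    rw [hθ1 x hx]
  · intro y hy
    by_contra h
    have hyW : y ∈ Wᶜ := h
    obtain ⟨x, rfl⟩ := hWA hyW
    exact hy (mem_image_of_mem _ (closedBall_subset_closedBall (le_max_left _ _) (hr' hyW)))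

/-- Collared Schoenflies theorem, after Brown. -/
theorem brown {φ s : ℂ → X} (hφ : IsOpenEmbedding φ) (hs : IsOpenEmbedding s)
    (hsr : range s = {φ 0}ᶜ) :
    ∃ H : OnePoint ℂ ≃ₜ X, ∀ x : ℂ, ‖x‖ ≤ 1 → H x = φ x := by
  choose step hst1 hst2 hst3 using brown_step hφ hs hsr
  let T : ℕ → (X ≃ₜ X) × ℝ := fun n => Nat.rec (Homeomorph.refl X, 1) (fun n P => step n P) n
  have hT0 : T 0 = (Homeomorph.refl X, 1) := rfl
  have hTs : ∀ n, T (n + 1) = step n (T n) := fun n => rfl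
  have hr1 : ∀ n, (T n).2 + 1 ≤ (T (n + 1)).2 := fun n => by rw [hTs]; exact hst1 _ _
  have hrm : Monotone fun n => (T n).2 := monotone_nat_of_le_succ (fun n => by linarith [hr1 n])
  have hrn : ∀ n : ℕ, (n : ℝ) + 1 ≤ (T n).2 := by
    intro n
    induction n with
    | zero => simp [hT0]
    | succ n ih => push_cast; linarith [hr1 n]
  have hagree : ∀ n m, n ≤ m → ∀ x, ‖x‖ ≤ (T n).2 → (T m).1 (φ x) = (T n).1 (φ x) := by
    intro n m hnm
    induction m, hnm using Nat.le_induction with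
    | base => intro x _; rfl
    | succ m hnm ih =>
      intro x hx
      rw [hTs, hst2 m (T m) x (hx.trans (hrm hnm)), ih x hx]
  have hN : ∀ x : ℂ, ∃ n, ‖x‖ < (T n).2 := by
    intro x
    obtain ⟨n, hn⟩ := exists_nat_gt ‖x‖
    exact ⟨n, by linarith [hrn n]⟩
  choose N hN using hN
  let F : ℂ → X := fun x => (T (N x)).1 (φ x)
  have hF : ∀ m x, ‖x‖ ≤ (T m).2 → F x = (T m).1 (φ x) := by
    intro m x hx
    rcases le_total m (N x) with h | h
    · exact hagree _ _ h x hx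
    · exact (hagree _ _ h x (hN x).le).symm
  have hFinj : Function.Injective F := by
    intro x y hxy
    have h1 := hF (max (N x) (N y)) x ((hN x).le.trans (hrm (le_max_left _ _)))
    have h2 := hF (max (N x) (N y)) y ((hN y).le.trans (hrm (le_max_right _ _)))
    rw [h1, h2] at hxy
    exact hφ.injective ((T _).1.injective hxy)
  have hFcont : Continuous F := by
    rw [continuous_iff_continuousAt]
    intro x
    have h1 : ContinuousAt (fun x => (T (N x)).1 (φ x)) x := by
      have : ContinuousAt (fun y => (T (N x)).1 (φ y)) x :=
        ((T (N x)).1.continuous.comp hφ.continuous).continuousAt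
      refine this.congr ?_
      filter_upwards [(isOpen_lt continuous_norm continuous_const).mem_nhds (hN x)] with y hy
      exact (hF _ y (le_of_lt hy)).symm
    exact h1
  -- image of exterior
  have hext : ∀ n x, (T n).2 < ‖x‖ → (T n).1.symm (F x) ∉ φ '' closedBall 0 (T n).2 := by
    rintro n x hx ⟨z, hz, hzx⟩
    rw [mem_closedBall_zero_iff] at hz
    have h1 : F z = F x := by
      rw [hF n z hz, hzx, Homeomorph.apply_symm_apply]
    rw [hFinj h1] at hz
    linarith
  choose a ha using fun n => hst3 n (T n)
  have hball : ∀ n y, (T (n + 1)).1.symm y ∉ φ '' closedBall 0 (T (n + 1)).2 →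
      dist y (a n) < 1 / ((n : ℝ) + 1) := by
    intro n y hy
    have := ha n ((T (n + 1)).1.symm y) hy
    rw [← hTs, Homeomorph.apply_symm_apply] at this
    exact this
  have hFball : ∀ n x, (T (n + 1)).2 < ‖x‖ → dist (F x) (a n) < 1 / ((n : ℝ) + 1) :=
    fun n x hx => hball n _ (hext (n + 1) x hx)
  have hlarge : ∀ r : ℝ, ∀ᶠ x : ℂ in cocompact ℂ, r < ‖x‖ := fun r =>
    tendsto_norm_cocompact_atTop.eventually (eventually_gt_atTop r)
  have hsmall : ∀ ε > 0, ∃ n : ℕ, 1 / ((n : ℝ) + 1) < ε := fun ε hε => exists_nat_one_div_lt hε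
  have hcauchy : Cauchy (map F (cocompact ℂ)) := by
    rw [Metric.cauchy_iff]
    refine ⟨inferInstance, fun ε hε => ?_⟩
    obtain ⟨n, hn⟩ := hsmall (ε / 2) (by positivity)
    refine ⟨ball (a n) (ε / 2), ?_, ?_⟩
    · rw [mem_map]
      filter_upwards [hlarge (T (n + 1)).2] with x hx
      exact (hFball n x hx).trans hn
    · intro x hx y hy
      rw [mem_ball] at hx hy
      linarith [dist_triangle_right x y (a n)]
  obtain ⟨l, hl⟩ := CompleteSpace.complete hcauchy
  have hl' : Tendsto F (cocompact ℂ) (𝓝 l) := hl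
  have hFl : ∀ x, F x ≠ l := by
    intro x hx
    let m := N x
    have hopen : IsOpen (F '' ball 0 (T m).2) := by
      have : F '' ball 0 (T m).2 = (T m).1 '' (φ '' ball 0 (T m).2) := by
        rw [image_image]
        refine image_congr fun y hy => ?_
        exact hF m y (le_of_lt (by simpa using hy))
      rw [this]
      exact (T m).1.isOpenMap _ (hφ.isOpenMap _ isOpen_ball)
    have hmem : F '' ball 0 (T m).2 ∈ 𝓝 l := by
      rw [← hx]
      exact hopen.mem_nhds (mem_image_of_mem _ (by simpa using hN x))
    obtain ⟨y, ⟨z, hz, hzy⟩, hy⟩ := ((hl'.eventually hmem).and (hlarge (T m).2)).exists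
    rw [hFinj hzy, mem_ball_zero_iff] at hz
    exact lt_asymm hz hy
  have hFs : ∀ b, b ≠ l → ∃ x, F x = b := by
    intro b hb
    by_contra hno
    push Not at hno
    apply hb
    have : Tendsto F (cocompact ℂ) (𝓝 b) := by
      rw [Metric.tendsto_nhds]
      intro ε hε
      obtain ⟨n, hn⟩ := hsmall (ε / 2) (by positivity)
      filter_upwards [hlarge (T (n + 1)).2] with x hx
      have h1 := hFball n x hx
      have h2 := hball n b (by
        rintro ⟨z, hz, hzb⟩
        apply hno z
        rw [hF (n + 1) z (by simpa using hz), hzb, Homeomorph.apply_symm_apply])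
      linarith [dist_triangle_right (F x) b (a n)]
    exact tendsto_nhds_unique this hl'
  let Hf : OnePoint ℂ → X := fun z => OnePoint.rec l F z
  have hHc : Continuous Hf := by
    rw [OnePoint.continuous_iff]
    refine ⟨?_, hFcont⟩
    rw [coclosedCompact_eq_cocompact]
    exact hl'
  have hHb : Function.Bijective Hf := by
    constructor
    · intro x y
      induction x using OnePoint.rec with
      | infty =>
        induction y using OnePoint.rec with
        | infty => intro _; rfl
        | coe y => intro h; exact absurd h.symm (hFl y)
      | coe x =>
        induction y using OnePoint.rec with
        | infty => intro h; exact absurd h (hFl x)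
        | coe y => intro h; exact congrArg _ (hFinj h)
    · intro b
      by_cases hb : b = l
      · exact ⟨OnePoint.infty, hb.symm⟩
      · obtain ⟨x, hx⟩ := hFs b hb
        exact ⟨x, hx⟩
  refine ⟨Continuous.homeoOfEquivCompactToT2 (f := Equiv.ofBijective Hf hHb) hHc, ?_⟩
  intro x hx
  show F x = φ x
  rw [hF 0 x (by simpa [hT0] using hx), hT0]
  rfl

end Brown

/-- `A` is a topological closed disk, given by a parametrisation. -/
def DiskIn {X : Type*} [TopologicalSpace X] (A : Set X) : Prop :=
  ∃ φ : ℂ → X, ContinuousOn φ (closedBall 0 1) ∧ InjOn φ (closedBall 0 1) ∧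
    φ '' closedBall 0 1 = A

/-- A map of the subgraph induced on `S`. -/
structure MapOn {V X : Type*} [TopologicalSpace X] (G : SimpleGraph V) (S : Set V)
    (M : V → Set X) : Prop where
  disk : ∀ v ∈ S, DiskIn (M v)
  disj : ∀ v ∈ S, ∀ w ∈ S, v ≠ w → Disjoint (interior (M v)) (interior (M w))
  adj : ∀ v ∈ S, ∀ w ∈ S, v ≠ w → (G.Adj v w ↔ (M v ∩ M w).Nonempty)

lemma DiskIn.image {X Y : Type*} [TopologicalSpace X] [TopologicalSpace Y] {A : Set X}
    (h : DiskIn A) (e : X ≃ₜ Y) : DiskIn (e '' A) := by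
  obtain ⟨φ, h1, h2, rfl⟩ := h
  refine ⟨fun x => e (φ x), e.continuous.comp_continuousOn h1, ?_, ?_⟩
  · intro x hx y hy hxy
    exact h2 hx hy (e.injective hxy)
  · rw [image_image]

lemma MapOn.image {V X Y : Type*} [TopologicalSpace X] [TopologicalSpace Y]
    {G : SimpleGraph V} {S : Set V} {M : V → Set X} (h : MapOn G S M) (e : X ≃ₜ Y) :
    MapOn G S (fun v => e '' M v) := by
  refine ⟨fun v hv => (h.disk v hv).image e, fun v hv w hw hvw => ?_, fun v hv w hw hvw => ?_⟩
  · rw [← e.image_interior, ← e.image_interior]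
    exact (disjoint_image_iff e.injective).2 (h.disj v hv w hw hvw)
  · rw [h.adj v hv w hw hvw, ← image_inter e.injective, image_nonempty]

lemma MapOn.mono {V X : Type*} [TopologicalSpace X]
    {G : SimpleGraph V} {S T : Set V} {M : V → Set X} (h : MapOn G S M) (hT : T ⊆ S) :
    MapOn G T M :=
  ⟨fun v hv => h.disk v (hT hv), fun v hv w hw => h.disj v (hT hv) w (hT hw),
    fun v hv w hw => h.adj v (hT hv) w (hT hw)⟩

/-- identification of the Euclidean disk with the complex disk -/
def diskHomeo : ↥(closedBall (0 : ℂ) 1) ≃ₜ ↥Disk2 :=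
  Homeomorph.subtype Complex.orthonormalBasisOneI.repr.toHomeomorph (fun x => by
    simp)

lemma diskIn_iff {X : Type*} [TopologicalSpace X] [T2Space X] {A : Set X} :
    Nonempty (↥A ≃ₜ ↥Disk2) ↔ DiskIn A := by
  constructor
  · rintro ⟨e⟩
    let f : ↥(closedBall (0 : ℂ) 1) → X := fun x => (e.symm (diskHomeo x) : X)
    have hf : Continuous f := by fun_prop
    have hfi : Function.Injective f := fun x y hxy =>
      diskHomeo.injective (e.symm.injective (Subtype.ext hxy))
    refine ⟨fun x => f ⟨rt x, rt_mem x⟩, ?_, ?_, ?_⟩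
    · exact (hf.comp (rt_cont.subtype_mk _)).continuousOn
    · intro x hx y hy hxy
      have := congrArg Subtype.val (hfi hxy)
      simpa [rt_id hx, rt_id hy] using this
    · ext p
      constructor
      · rintro ⟨x, -, rfl⟩
        exact Subtype.coe_prop _
      · intro hp
        refine ⟨(diskHomeo.symm (e ⟨p, hp⟩) : ℂ), Subtype.coe_prop _, ?_⟩
        have : (⟨rt _, rt_mem _⟩ : ↥(closedBall (0 : ℂ) 1)) = diskHomeo.symm (e ⟨p, hp⟩) :=
          Subtype.ext (rt_id (Subtype.coe_prop _))
        simp only [this, f, Homeomorph.apply_symm_apply, Homeomorph.symm_apply_apply]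
  · rintro ⟨φ, hc, hi, rfl⟩
    have hcpt : CompactSpace ↥(closedBall (0 : ℂ) 1) :=
      isCompact_iff_compactSpace.1 (isCompact_closedBall _ _)
    let f : ↥(closedBall (0 : ℂ) 1) ≃ ↥(φ '' closedBall 0 1) := hi.bijOn_image.equiv φ
    have hf : Continuous f := (continuousOn_iff_continuous_domRestrict.1 hc).subtype_mk _
    exact ⟨(Continuous.homeoOfEquivCompactToT2 hf).symm.trans diskHomeo⟩

section facts
variable {φ : ℂ → ↥Sphere2} 

lemma closedBall_subset_closure {φ : ℂ → ↥Sphere2} (hc : ContinuousOn φ (closedBall 0 1)) :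
    φ '' closedBall 0 1 ⊆ closure (φ '' ball 0 1) := by
  rw [← closure_ball (0 : ℂ) one_ne_zero] at hc ⊢
  exact hc.image_closure

lemma DiskIn.isClosed {A : Set ↥Sphere2} (h : DiskIn A) : IsClosed A := by
  obtain ⟨φ, hc, hi, rfl⟩ := h
  exact ((isCompact_closedBall _ _).image_of_continuousOn hc).isClosed

lemma DiskIn.subset_closure {A : Set ↥Sphere2} (h : DiskIn A) : A ⊆ closure (interior A) := by
  obtain ⟨φ, hc, hi, rfl⟩ := h
  refine (closedBall_subset_closure hc).trans (closure_mono ?_)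
  exact interior_maximal (image_mono ball_subset_closedBall) (iod_sphere hc hi)

lemma DiskIn.nonempty {X : Type*} [TopologicalSpace X] {A : Set X} (h : DiskIn A) :
    A.Nonempty := by
  obtain ⟨φ, hc, hi, rfl⟩ := h
  exact ⟨φ 0, mem_image_of_mem _ (by simp)⟩

lemma disj_int {A B : Set ↥Sphere2} (hB : DiskIn B)
    (h : Disjoint (interior A) (interior B)) : Disjoint (interior A) B :=
  (h.closure_right isOpen_interior).mono_right hB.subset_closure

lemma inter_frontier {A B : Set ↥Sphere2} (hA : DiskIn A) (hB : DiskIn B)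
    (h : Disjoint (interior A) (interior B)) : frontier A ∩ frontier B = A ∩ B := by
  apply Subset.antisymm
  · exact inter_subset_inter hA.isClosed.frontier_subset hB.isClosed.frontier_subset
  · rintro p ⟨hpA, hpB⟩
    rw [hA.isClosed.frontier_eq, hB.isClosed.frontier_eq]
    exact ⟨⟨hpA, fun h' => (disj_int hB h).le_bot ⟨h', hpB⟩⟩,
      ⟨hpB, fun h' => (disj_int hA h.symm).le_bot ⟨h', hpA⟩⟩⟩

end facts

lemma isMapOf_iff {V : Type*} (G : SimpleGraph V) (M : V → Set ↥Sphere2) :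
    IsMapOf G M ↔ MapOn G univ M := by
  constructor
  · intro h
    have hd : ∀ v, DiskIn (M v) := fun v => diskIn_iff.1 (h.nation_disk v)
    have hi : ∀ v w, v ≠ w → Disjoint (interior (M v)) (interior (M w)) :=
      fun v w hvw => disjoint_iff_inter_eq_empty.2 (h.interiors_disjoint hvw)
    refine ⟨fun v _ => hd v, fun v _ w _ => hi v w, fun v _ w _ hvw => ?_⟩
    rw [h.adj_iff hvw, inter_frontier (hd v) (hd w) (hi v w hvw)]
  · intro h
    refine ⟨fun v => diskIn_iff.2 (h.disk v trivial), fun v w hvw =>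
      disjoint_iff_inter_eq_empty.1 (h.disj v trivial w trivial hvw), fun v w hvw => ?_⟩
    rw [h.adj v trivial w trivial hvw, inter_frontier (h.disk v trivial) (h.disk w trivial)
      (h.disj v trivial w trivial hvw)]

/-- Abstract gluing lemma. -/
lemma glue_abs {V X : Type*} [TopologicalSpace X] {G : SimpleGraph V} {S T : Set V}
    {M₁ M₂ : V → Set X} (h₁ : MapOn G S M₁) (h₂ : MapOn G T M₂) {v : V} (hvS : v ∈ S)
    (hvT : v ∈ T) (hST : S ∩ T ⊆ {v})
    (hno : ∀ a ∈ S, ∀ b ∈ T, a ≠ v → b ≠ v → ¬ G.Adj a b)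
    {Q₁ Q₂ P : Set X} (hQ : Q₁ ∪ Q₂ = univ) (hQ₁ : ∀ w ∈ S, w ≠ v → Disjoint (M₁ w) Q₁)
    (hQ₂ : ∀ w ∈ T, w ≠ v → Disjoint (M₂ w) Q₂) (hP : DiskIn P)
    (hP₁ : P ⊆ M₁ v ∪ Q₁) (hP₂ : P ⊆ M₂ v ∪ Q₂)
    (ha₁ : ∀ w ∈ S, G.Adj v w → (P ∩ M₁ w).Nonempty)
    (ha₂ : ∀ w ∈ T, G.Adj v w → (P ∩ M₂ w).Nonempty) :
    ∃ M : V → Set X, MapOn G (S ∪ T) M := by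
  classical
  let M : V → Set X := fun w => if w = v then P else if w ∈ S then M₁ w else M₂ w
  have hMv : M v = P := by simp [M]
  have hM1 : ∀ w ∈ S, w ≠ v → M w = M₁ w := fun w hw hwv => by simp [M, hw, hwv]
  have hM2 : ∀ w ∈ T, w ≠ v → M w = M₂ w := fun w hw hwv => by
    have : w ∉ S := fun h => hwv (hST ⟨h, hw⟩)
    simp [M, this, hwv]
  have side : ∀ (S : Set V) (M₁ : V → Set X) (Q₁ : Set X), MapOn G S M₁ → v ∈ S →
      (∀ w ∈ S, w ≠ v → Disjoint (M₁ w) Q₁) → P ⊆ M₁ v ∪ Q₁ →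
      (∀ w ∈ S, G.Adj v w → (P ∩ M₁ w).Nonempty) → ∀ w ∈ S, w ≠ v →
      Disjoint (interior P) (interior (M₁ w)) ∧ (G.Adj v w ↔ (P ∩ M₁ w).Nonempty) := by
    intro S M₁ Q₁ h₁ hvS hQ₁ hP₁ ha₁ w hw hwv
    have key : P ∩ M₁ w ⊆ M₁ v := by
      rintro p ⟨hp, hpw⟩
      rcases hP₁ hp with h | h
      · exact h
      · exact absurd ⟨hpw, h⟩ (fun h => (hQ₁ w hw hwv).le_bot h)
    constructor
    · rw [disjoint_iff_inter_eq_empty, ← interior_inter, ← subset_empty_iff]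
      have h3 : interior (P ∩ M₁ w) ⊆ interior (M₁ v) ∩ interior (M₁ w) :=
        subset_inter (interior_mono key) (interior_mono inter_subset_right)
      exact h3.trans (h₁.disj v hvS w hw hwv.symm).le_bot
    · refine ⟨ha₁ w hw, fun ⟨p, hp⟩ => (h₁.adj v hvS w hw hwv.symm).2 ⟨p, key hp, hp.2⟩⟩
  have side1 := side S M₁ Q₁ h₁ hvS hQ₁ hP₁ ha₁
  have side2 := side T M₂ Q₂ h₂ hvT hQ₂ hP₂ ha₂
  have hv : ∀ w ∈ S ∪ T, w ≠ v →
      Disjoint (interior (M v)) (interior (M w)) ∧ (G.Adj v w ↔ (M v ∩ M w).Nonempty) := by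
    rintro w (hw | hw) hwv
    · rw [hMv, hM1 w hw hwv]; exact side1 w hw hwv
    · rw [hMv, hM2 w hw hwv]; exact side2 w hw hwv
  have cross : ∀ a ∈ S, ∀ b ∈ T, a ≠ v → b ≠ v → Disjoint (M a) (M b) := by
    intro a ha b hb hav hbv
    rw [hM1 a ha hav, hM2 b hb hbv]
    rw [disjoint_left]
    intro p hpa hpb
    rcases (hQ ▸ mem_univ p : p ∈ Q₁ ∪ Q₂) with h | h
    · exact (hQ₁ a ha hav).le_bot ⟨hpa, h⟩
    · exact (hQ₂ b hb hbv).le_bot ⟨hpb, h⟩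
  have all : ∀ a ∈ S ∪ T, ∀ b ∈ S ∪ T, a ≠ b →
      Disjoint (interior (M a)) (interior (M b)) ∧ (G.Adj a b ↔ (M a ∩ M b).Nonempty) := by
    intro a ha b hb hab
    by_cases hav : a = v
    · subst hav; exact hv b hb hab.symm
    by_cases hbv : b = v
    · subst hbv
      have := hv a ha hab
      exact ⟨this.1.symm, by rw [G.adj_comm, inter_comm]; exact this.2⟩
    rcases ha with ha | ha <;> rcases hb with hb | hb
    · rw [hM1 a ha hav, hM1 b hb hbv]
      exact ⟨h₁.disj a ha b hb hab, h₁.adj a ha b hb hab⟩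
    · have h := cross a ha b hb hav hbv
      refine ⟨h.mono interior_subset interior_subset, ?_⟩
      rw [disjoint_iff_inter_eq_empty.1 h]
      simpa using hno a ha b hb hav hbv
    · have h := (cross b hb a ha hbv hav).symm
      refine ⟨h.mono interior_subset interior_subset, ?_⟩
      rw [disjoint_iff_inter_eq_empty.1 h]
      simpa using fun h => hno b hb a ha hbv hav h.symm
    · rw [hM2 a ha hav, hM2 b hb hbv]
      exact ⟨h₂.disj a ha b hb hab, h₂.adj a ha b hb hab⟩
  refine ⟨M, fun w hw => ?_, fun a ha b hb hab => (all a ha b hb hab).1,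
    fun a ha b hb hab => (all a ha b hb hab).2⟩
  by_cases hwv : w = v
  · rw [hwv, hMv]; exact hP
  rcases hw with hw | hw
  · rw [hM1 w hw hwv]; exact h₁.disk w hw
  · rw [hM2 w hw hwv]; exact h₂.disk w hw

/-- Shrinking one nation. -/
lemma shrink_nation {V X : Type*} [TopologicalSpace X] {G : SimpleGraph V} {S : Set V}
    {M : V → Set X} (h : MapOn G S M) {v : V} (hv : v ∈ S) {P : Set X} (hP : DiskIn P)
    (hPM : P ⊆ M v) (ha : ∀ w ∈ S, G.Adj v w → (P ∩ M w).Nonempty) {Q : Set X}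
    (hQ : Disjoint P Q) (hQw : ∀ w ∈ S, w ≠ v → Disjoint (M w) Q) :
    ∃ M' : V → Set X, MapOn G S M' ∧ ∀ w ∈ S, Disjoint (M' w) Q := by
  classical
  let M' : V → Set X := fun w => if w = v then P else M w
  have hMv : M' v = P := by simp [M']
  have hMw : ∀ w, w ≠ v → M' w = M w := fun w hw => by simp [M', hw]
  have hsub : ∀ w, M' w ⊆ M w := by
    intro w
    by_cases hwv : w = v
    · subst hwv; rw [hMv]; exact hPM
    · rw [hMw w hwv]
  refine ⟨M', ⟨fun w hw => ?_, fun a ha' b hb hab => ?_, fun a ha' b hb hab => ?_⟩, fun w hw => ?_⟩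
  · by_cases hwv : w = v
    · subst hwv; rwa [hMv]
    · rw [hMw w hwv]; exact h.disk w hw
  · exact (h.disj a ha' b hb hab).mono (interior_mono (hsub a)) (interior_mono (hsub b))
  · refine ⟨fun hadj => ?_, fun hne => (h.adj a ha' b hb hab).2
      (hne.mono (inter_subset_inter (hsub a) (hsub b)))⟩
    by_cases hav : a = v
    · subst hav
      rw [hMv, hMw b hab.symm]
      exact ha b hb hadj
    by_cases hbv : b = v
    · subst hbv
      rw [hMv, hMw a hab, inter_comm]
      exact ha a ha' hadj.symm
    rw [hMw a hav, hMw b hbv]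
    exact (h.adj a ha' b hb hab).1 hadj
  · by_cases hwv : w = v
    · subst hwv; rwa [hMv]
    · rw [hMw w hwv]; exact hQw w hw hwv

/-- Disjoint union. -/
lemma union_abs {V X : Type*} [TopologicalSpace X] {G : SimpleGraph V} {S T : Set V}
    {M₁ M₂ : V → Set X} (h₁ : MapOn G S M₁) (h₂ : MapOn G T M₂) (hST : S ∩ T = ∅)
    (hno : ∀ a ∈ S, ∀ b ∈ T, ¬ G.Adj a b)
    {Q₁ Q₂ : Set X} (hQ : Q₁ ∪ Q₂ = univ) (hQ₁ : ∀ w ∈ S, Disjoint (M₁ w) Q₁)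
    (hQ₂ : ∀ w ∈ T, Disjoint (M₂ w) Q₂) :
    ∃ M : V → Set X, MapOn G (S ∪ T) M := by
  classical
  let M : V → Set X := fun w => if w ∈ S then M₁ w else M₂ w
  have hM1 : ∀ w ∈ S, M w = M₁ w := fun w hw => by simp [M, hw]
  have hM2 : ∀ w ∈ T, M w = M₂ w := fun w hw => by
    have : w ∉ S := fun h => by
      have : w ∈ S ∩ T := ⟨h, hw⟩
      rw [hST] at this
      exact this
    simp [M, this]
  have cross : ∀ a ∈ S, ∀ b ∈ T, Disjoint (M a) (M b) := by
    intro a ha b hb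
    rw [hM1 a ha, hM2 b hb, disjoint_left]
    intro p hpa hpb
    rcases (hQ ▸ mem_univ p : p ∈ Q₁ ∪ Q₂) with h | h
    · exact (hQ₁ a ha).le_bot ⟨hpa, h⟩
    · exact (hQ₂ b hb).le_bot ⟨hpb, h⟩
  have all : ∀ a ∈ S ∪ T, ∀ b ∈ S ∪ T, a ≠ b →
      Disjoint (interior (M a)) (interior (M b)) ∧ (G.Adj a b ↔ (M a ∩ M b).Nonempty) := by
    intro a ha b hb hab
    rcases ha with ha | ha <;> rcases hb with hb | hb
    · rw [hM1 a ha, hM1 b hb]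
      exact ⟨h₁.disj a ha b hb hab, h₁.adj a ha b hb hab⟩
    · have h := cross a ha b hb
      refine ⟨h.mono interior_subset interior_subset, ?_⟩
      rw [disjoint_iff_inter_eq_empty.1 h]
      simpa using hno a ha b hb
    · have h := (cross b hb a ha).symm
      refine ⟨h.mono interior_subset interior_subset, ?_⟩
      rw [disjoint_iff_inter_eq_empty.1 h]
      simpa using fun h => hno b hb a ha h.symm
    · rw [hM2 a ha, hM2 b hb]
      exact ⟨h₂.disj a ha b hb hab, h₂.adj a ha b hb hab⟩
  refine ⟨M, fun w hw => ?_, fun a ha b hb hab => (all a ha b hb hab).1,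
    fun a ha b hb hab => (all a ha b hb hab).2⟩
  rcases hw with hw | hw
  · rw [hM1 w hw]; exact h₁.disk w hw
  · rw [hM2 w hw]; exact h₂.disk w hw

/-- Cutting an annulus open to a disk containing given finitely many points. -/
lemma cut {X : Type*} [TopologicalSpace X] {r : ℝ} (hr0 : 0 < r) (hr1 : r < 1) {α : ℂ → X}
    (hc : ContinuousOn α {x | r ≤ ‖x‖ ∧ ‖x‖ ≤ 1}) (hi : InjOn α {x | r ≤ ‖x‖ ∧ ‖x‖ ≤ 1})
    {F : Set ℂ} (hF : F.Finite) (hFs : F ⊆ {x | r ≤ ‖x‖ ∧ ‖x‖ ≤ 1}) :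
    ∃ P : Set X, DiskIn P ∧ P ⊆ α '' {x | r ≤ ‖x‖ ∧ ‖x‖ ≤ 1} ∧ α '' F ⊆ P := by
  obtain ⟨c, hc1, hcF⟩ : ∃ c : ℂ, ‖c‖ = 1 ∧ ∀ x ∈ F, c ≠ -(x / (‖x‖ : ℂ)) := by
    have hinf : (sphere (0 : ℂ) 1).Infinite := by
      refine (isPreconnected_sphere ?_ _ _).infinite_of_nontrivial ?_
      · rw [Complex.rank_real_complex]; norm_num
      · exact ⟨1, by simp, -1, by simp, by norm_num⟩
    obtain ⟨c, hc, hcF⟩ := hinf.exists_notMem_finite (hF.image fun x : ℂ => -(x / (‖x‖ : ℂ)))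
    refine ⟨c, by simpa using hc, fun x hx h => hcF ⟨x, hx, h.symm⟩⟩
  have hc0 : c ≠ 0 := by rintro rfl; simp at hc1
  have hne0 : ∀ x ∈ F, x ≠ 0 := by
    rintro x hx rfl
    have := (hFs hx).1
    simp at this
    linarith
  have harg : ∀ x ∈ F, |(x / c).arg| < Real.pi := by
    intro x hx
    rw [abs_lt]
    refine ⟨Complex.neg_pi_lt_arg _, lt_of_le_of_ne (Complex.arg_le_pi _) fun h => ?_⟩
    rw [Complex.arg_eq_pi_iff] at h
    apply hcF x hx
    have hx0 := hne0 x hx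
    have hnx : (‖x‖ : ℂ) ≠ 0 := by simpa using hx0
    have h1 : x / c = -(‖x‖ : ℂ) := by
      have h2 : x / c = ((x / c).re : ℂ) := Complex.ext (by simp) (by simp [h.2])
      have h3 : ‖x / c‖ = ‖x‖ := by simp [hc1]
      rw [h2, Complex.norm_real, Real.norm_eq_abs, abs_of_neg h.1] at h3
      rw [h2, ← h3]; simp
    rw [div_eq_iff hc0] at h1
    field_simp
    linear_combination h1
  obtain ⟨b, hb0, hbpi, hb⟩ : ∃ b : ℝ, 0 < b ∧ b < Real.pi ∧ ∀ x ∈ F, |(x / c).arg| ≤ b := by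
    have hfin : (insert 1 ((fun x : ℂ => |(x / c).arg|) '' F)).Finite := (hF.image _).insert _
    obtain ⟨b, hbm, hb⟩ := Set.exists_max_image _ id hfin ⟨1, mem_insert _ _⟩
    have h1 : (1 : ℝ) ≤ b := hb 1 (mem_insert _ _)
    refine ⟨b, by linarith, ?_, fun x hx => hb _ (mem_insert_of_mem _ ⟨x, hx, rfl⟩)⟩
    rcases hbm with rfl | ⟨x, hx, rfl⟩
    · linarith [Real.pi_gt_three]
    · exact harg x hx
  have hlog : Real.log r < 0 := Real.log_neg hr0 hr1
  let R : Set ℂ := Icc (Real.log r) 0 ×ℂ Icc (-b) b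
  have hRcl : IsClosed R := isClosed_Icc.reProdIm isClosed_Icc
  have hRconv : Convex ℝ R := by
    have h := ((convex_Icc (Real.log r) 0).linear_preimage Complex.reLm).inter
      ((convex_Icc (-b) b).linear_preimage Complex.imLm)
    exact h
  have hRint : (interior R).Nonempty := by
    rw [Complex.interior_reProdIm, interior_Icc, interior_Icc]
    refine ⟨((Real.log r / 2 : ℝ) : ℂ), ?_, ?_⟩
    · simp only [mem_preimage, Complex.ofReal_re, mem_Ioo]
      constructor <;> linarith
    · simp only [mem_preimage, Complex.ofReal_im, mem_Ioo]
      constructor <;> linarith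
  have hRb : Bornology.IsBounded R := (isBounded_Icc _ _).reProdIm (isBounded_Icc _ _)
  obtain ⟨h, -, hh, -⟩ :=
    exists_homeomorph_image_interior_closure_frontier_eq_unitBall hRconv hRint hRb
  rw [hRcl.closure_eq] at hh
  let β : ℂ → ℂ := fun z => c * Complex.exp z
  have hβm : MapsTo β R {x | r ≤ ‖x‖ ∧ ‖x‖ ≤ 1} := by
    rintro z ⟨hz, -⟩
    simp only [mem_preimage, mem_Icc] at hz
    simp only [mem_ofPred_eq, β, norm_mul, hc1, one_mul, Complex.norm_exp]
    exact ⟨(Real.log_le_iff_le_exp hr0).1 hz.1, Real.exp_le_one_iff.2 hz.2⟩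
  have hβi : InjOn β R := by
    rintro z ⟨-, hz⟩ w ⟨-, hw⟩ hzw
    simp only [mem_preimage, mem_Icc] at hz hw
    have := mul_left_cancel₀ hc0 hzw
    exact Complex.exp_inj_of_neg_pi_lt_of_le_pi (by linarith) (by linarith) (by linarith)
      (by linarith) this
  have hsm : MapsTo h.symm (closedBall 0 1) R := by
    intro x hx
    rw [← hh] at hx
    obtain ⟨z, hz, rfl⟩ := hx
    simpa using hz
  refine ⟨(fun x => α (β (h.symm x))) '' closedBall 0 1, ⟨_, ?_, ?_, rfl⟩, ?_, ?_⟩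
  · refine hc.comp ?_ (fun x hx => hβm (hsm hx))
    exact Continuous.continuousOn (by fun_prop)
  · intro x hx y hy hxy
    exact h.symm.injective (hβi (hsm hx) (hsm hy) (hi (hβm (hsm hx)) (hβm (hsm hy)) hxy))
  · rintro _ ⟨x, hx, rfl⟩
    exact ⟨_, hβm (hsm hx), rfl⟩
  · rintro _ ⟨x, hx, rfl⟩
    have hx0 := hne0 x hx
    have hxc : x / c ≠ 0 := div_ne_zero hx0 hc0
    have hmem : Complex.log (x / c) ∈ R := by
      have hn := hFs hx
      refine ⟨?_, ?_⟩
      · simp only [mem_preimage, Complex.log_re, norm_div, hc1, div_one, mem_Icc]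
        exact ⟨Real.log_le_log hr0 hn.1, Real.log_nonpos (norm_nonneg _) hn.2⟩
      · simp only [mem_preimage, Complex.log_im]
        exact abs_le.1 (hb x hx)
    refine ⟨h (Complex.log (x / c)), hh ▸ mem_image_of_mem _ hmem, ?_⟩
    simp only [Homeomorph.symm_apply_apply, β, Complex.exp_log hxc]
    rw [mul_div_cancel₀ _ hc0]

/-- the reparametrisation of the plane onto the disk -/
def kap (x : ℂ) : ℂ := ((4 * max ‖x‖ (1/2) - 1) / (4 * (max ‖x‖ (1/2)) ^ 2)) • x

lemma kap_cont : Continuous kap := by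
  have h1 : Continuous fun x : ℂ => (4 * max ‖x‖ (1/2) - 1) / (4 * (max ‖x‖ (1/2)) ^ 2) := by
    refine Continuous.div (by fun_prop) (by fun_prop) (fun x => ?_)
    have : (1/2 : ℝ) ≤ max ‖x‖ (1/2) := le_max_right _ _
    positivity
  exact h1.smul continuous_id

lemma kap_small {x : ℂ} (hx : ‖x‖ ≤ 1/2) : kap x = x := by
  rw [kap, max_eq_right hx]; norm_num

lemma kap_norm_large {x : ℂ} (hx : 1/2 ≤ ‖x‖) : ‖kap x‖ = 1 - 1 / (4 * ‖x‖) := by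
  rw [kap, max_eq_left hx, norm_smul, Real.norm_eq_abs, abs_of_nonneg]
  · have : ‖x‖ ≠ 0 := by linarith
    field_simp
  · apply div_nonneg <;> nlinarith

lemma kap_lt (x : ℂ) : ‖kap x‖ < 1 := by
  rcases le_total ‖x‖ (1/2) with h | h
  · rw [kap_small h]; linarith
  · rw [kap_norm_large h]
    have : 0 < ‖x‖ := by linarith
    have : 0 < 1 / (4 * ‖x‖) := by positivity
    linarith

lemma kap_half {x : ℂ} (h : 1/2 < ‖x‖) : 1/2 < ‖kap x‖ := by
  rw [kap_norm_large h.le]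
  have : 1 / (4 * ‖x‖) < 1/2 := by
    rw [div_lt_div_iff₀ (by linarith) (by norm_num)]; linarith
  linarith

lemma kap_inj : Function.Injective kap := by
  intro x y hxy
  have hn : ‖x‖ = ‖y‖ := by
    have h := congrArg norm hxy
    rcases le_or_gt ‖x‖ (1/2) with hx | hx <;> rcases le_or_gt ‖y‖ (1/2) with hy | hy
    · rwa [kap_small hx, kap_small hy] at h
    · have := kap_half hy
      rw [kap_small hx] at h
      linarith
    · have := kap_half hx
      rw [kap_small hy] at h
      linarith
    · rw [kap_norm_large hx.le, kap_norm_large hy.le] at h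
      have h1 : 1 / (4 * ‖x‖) = 1 / (4 * ‖y‖) := by linarith
      rw [one_div, one_div] at h1
      have h2 := inv_injective h1
      linarith
  unfold kap at hxy
  rw [hn] at hxy
  have hm : (1/2 : ℝ) ≤ max ‖y‖ (1/2) := le_max_right _ _
  have : (4 * max ‖y‖ (1/2) - 1) / (4 * (max ‖y‖ (1/2)) ^ 2) ≠ 0 :=
    (div_pos (by linarith) (by positivity)).ne'
  exact smul_right_injective ℂ this hxy

lemma open_emb {f : ℂ → ↥Sphere2} (hf : Continuous f) (hi : Function.Injective f) :
    IsOpenEmbedding f := by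
  refine .of_continuous_injective_isOpenMap hf hi ?_
  rw [isOpenMap_iff_nhds_le]
  intro x U hU
  obtain ⟨r, hr, hrU⟩ := Metric.mem_nhds_iff.1 (mem_map.1 hU)
  have hr' : (r : ℂ) ≠ 0 := by exact_mod_cast hr.ne'
  have h1 : IsOpen ((fun z : ℂ => f (x + r * z)) '' ball 0 1) := by
    refine iod_sphere (Continuous.continuousOn (by fun_prop)) ?_
    intro z _ w _ hzw
    exact mul_left_cancel₀ hr' (add_left_cancel (hi hzw))
  refine mem_of_superset (h1.mem_nhds ⟨0, by simp, by simp⟩) ?_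
  rintro _ ⟨z, hz, rfl⟩
  apply hrU
  rw [mem_ball_zero_iff] at hz
  simp only [mem_ball, dist_self_add_left, norm_mul, Complex.norm_real, Real.norm_eq_abs,
    abs_of_pos hr]
  nlinarith

/-- Normal form of a map at a vertex. -/
lemma normal_form {V : Type*} {G : SimpleGraph V} {S : Set V} {M : V → Set ↥Sphere2}
    (h : MapOn G S M) {v : V} (hv : v ∈ S) :
    ∃ N : V → Set (OnePoint ℂ), MapOn G S N ∧ ∃ φ : ℂ → OnePoint ℂ,
      ContinuousOn φ (closedBall 0 1) ∧ InjOn φ (closedBall 0 1) ∧ φ '' closedBall 0 1 = N v ∧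
      (∀ x : ℂ, ‖x‖ ≤ 1/2 → φ x = x) ∧
      ∀ w ∈ S, w ≠ v → Disjoint (N w) (φ '' ball 0 1) := by
  obtain ⟨φ, hc, hi, hφ⟩ := h.disk v hv
  have hk : ∀ x, kap x ∈ closedBall (0 : ℂ) 1 := fun x => by
    rw [mem_closedBall_zero_iff]; exact (kap_lt x).le
  have hemb : IsOpenEmbedding fun x => φ (kap x) := by
    refine open_emb ?_ ?_
    · exact hc.comp_continuous kap_cont hk
    · intro x y hxy
      exact kap_inj (hi (hk x) (hk y) hxy)
  obtain ⟨s, hs, hsr⟩ := chart (φ (kap 0))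
  obtain ⟨H, hH⟩ := brown hemb hs hsr
  refine ⟨fun w => H.symm '' M w, h.image H.symm, fun x => H.symm (φ x),
    H.symm.continuous.comp_continuousOn hc, ?_, ?_, ?_, ?_⟩
  · intro x hx y hy hxy
    exact hi hx hy (H.symm.injective hxy)
  · show _ = H.symm '' M v
    rw [← hφ, image_image]
  · intro x hx
    rw [H.symm_apply_eq, hH x (by linarith), kap_small hx]
  · intro w hw hwv
    rw [← image_image (fun p => H.symm p) φ, disjoint_image_iff H.symm.injective]
    have h1 : Disjoint (interior (M v)) (M w) := disj_int (h.disk w hw) (h.disj v hv w hw hwv.symm)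
    refine h1.symm.mono_right ?_
    rw [← hφ]
    exact interior_maximal (image_mono ball_subset_closedBall) (iod_sphere hc hi)

/-- the inversion `x ↦ 1 / (16 x)` -/
def invF (z : OnePoint ℂ) : OnePoint ℂ :=
  z.elim ((0 : ℂ) : OnePoint ℂ)
    (fun x : ℂ => if x = 0 then OnePoint.infty else (((16 * x)⁻¹ : ℂ) : OnePoint ℂ))

lemma invF_infty : invF OnePoint.infty = ((0 : ℂ) : OnePoint ℂ) := rfl
lemma invF_zero : invF ((0 : ℂ) : OnePoint ℂ) = OnePoint.infty := by
  show (if (0 : ℂ) = 0 then OnePoint.infty else _) = _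
  simp
lemma invF_coe {x : ℂ} (hx : x ≠ 0) : invF (x : OnePoint ℂ) = (((16 * x)⁻¹ : ℂ) : OnePoint ℂ) := by
  show (if x = 0 then OnePoint.infty else _) = _
  simp [hx]

lemma invF_invF (z : OnePoint ℂ) : invF (invF z) = z := by
  induction z using OnePoint.rec with
  | infty => rw [invF_infty, invF_zero]
  | coe x =>
    by_cases hx : x = 0
    · rw [hx, invF_zero, invF_infty]
    · rw [invF_coe hx, invF_coe (by simpa using hx)]
      congr 1
      field_simp

lemma invF_cont : Continuous invF := by
  rw [OnePoint.continuous_iff]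
  constructor
  · rw [coclosedCompact_eq_cocompact, invF_infty]
    have h1 : Tendsto (fun x : ℂ => (((16 * x)⁻¹ : ℂ) : OnePoint ℂ)) (cocompact ℂ)
        (𝓝 ((0 : ℂ) : OnePoint ℂ)) := by
      refine (OnePoint.continuous_coe.tendsto 0).comp ?_
      have h2 : Tendsto (fun x : ℂ => 16⁻¹ * x⁻¹) (cocompact ℂ) (𝓝 (16⁻¹ * 0)) :=
        (tendsto_inv₀_cobounded.mono_left (by rw [cobounded_eq_cocompact])).const_mul _
      simpa [mul_inv, mul_comm] using h2
    refine h1.congr' ?_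
    have : ({0}ᶜ : Set ℂ) ∈ cocompact ℂ := isCompact_singleton.compl_mem_cocompact
    filter_upwards [this] with x hx
    exact (invF_coe hx).symm
  · rw [continuous_iff_continuousAt]
    intro x
    by_cases hx : x = 0
    · subst hx
      rw [continuousAt_iff_punctured_nhds, invF_zero]
      have h1 : Tendsto (fun x : ℂ => (((16 * x)⁻¹ : ℂ) : OnePoint ℂ)) (𝓝[≠] 0)
          (𝓝 OnePoint.infty) := by
        refine OnePoint.tendsto_coe_infty.comp ?_
        rw [coclosedCompact_eq_cocompact, ← cobounded_eq_cocompact]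
        refine tendsto_inv₀_nhdsNE_zero.comp ?_
        refine tendsto_nhdsWithin_iff.2 ⟨?_, ?_⟩
        · have h2 : Continuous fun x : ℂ => 16 * x := by fun_prop
          have h3 := h2.tendsto 0
          rw [mul_zero] at h3
          exact h3.mono_left nhdsWithin_le_nhds
        · filter_upwards [self_mem_nhdsWithin] with x hx
          simpa using hx
      refine h1.congr' ?_
      filter_upwards [self_mem_nhdsWithin] with x hx
      exact (invF_coe hx).symm
    · have h1 : ContinuousAt (fun x : ℂ => (((16 * x)⁻¹ : ℂ) : OnePoint ℂ)) x := by
        refine OnePoint.continuous_coe.continuousAt.comp ?_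
        exact ContinuousAt.inv₀ (by fun_prop) (by simpa using hx)
      refine h1.congr ?_
      filter_upwards [isOpen_ne.mem_nhds hx] with y hy
      exact (invF_coe hy).symm

/-- the inversion as a homeomorphism -/
def invH : OnePoint ℂ ≃ₜ OnePoint ℂ where
  toFun := invF
  invFun := invF
  left_inv := invF_invF
  right_inv := invF_invF
  continuous_toFun := invF_cont
  continuous_invFun := invF_cont

lemma sphere_homeo : Nonempty (OnePoint ℂ ≃ₜ ↥Sphere2) := by
  obtain ⟨p⟩ : Nonempty ↥Sphere2 :=
    (NormedSpace.sphere_nonempty (x := (0 : EuclideanSpace ℝ (Fin 3))) (r := 1)).2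
      zero_le_one |>.to_subtype
  obtain ⟨s, hs, -⟩ := chart p
  obtain ⟨s', hs', hr⟩ := chart (s 0)
  obtain ⟨H, -⟩ := brown hs hs' hr
  exact ⟨H⟩

/-- the closed disk of radius 1/4 in the Riemann sphere -/
def QQ : Set (OnePoint ℂ) := (fun x : ℂ => (x : OnePoint ℂ)) '' closedBall 0 (1/4)

lemma mem_QQ {x : ℂ} (hx : ‖x‖ ≤ 1/4) : (x : OnePoint ℂ) ∈ QQ :=
  mem_image_of_mem _ (by simpa using hx)

lemma inv_mem_QQ {z : OnePoint ℂ} (hz : z ∉ QQ) : invF z ∈ QQ := by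
  induction z using OnePoint.rec with
  | infty => rw [invF_infty]; exact mem_QQ (by simp)
  | coe x =>
    have h1 : 1/4 < ‖x‖ := by
      by_contra h
      exact hz (mem_QQ (not_lt.1 h))
    have hx : x ≠ 0 := by rintro rfl; norm_num at h1
    rw [invF_coe hx]
    apply mem_QQ
    rw [norm_inv, norm_mul, inv_le_comm₀ (by simpa using hx) (by norm_num)]
    simp
    linarith

lemma mem_invH_image {z : OnePoint ℂ} {A : Set (OnePoint ℂ)} : z ∈ invH '' A ↔ invF z ∈ A := by
  constructor
  · rintro ⟨y, hy, rfl⟩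
    show invF (invF y) ∈ A
    rwa [invF_invF]
  · intro h
    exact ⟨invF z, h, invF_invF z⟩

lemma QQ_union : QQ ∪ invH '' QQ = univ := by
  rw [eq_univ_iff_forall]
  intro z
  by_cases hz : z ∈ QQ
  · exact Or.inl hz
  · exact Or.inr (mem_invH_image.2 (inv_mem_QQ hz))

lemma nf_QQ {φ : ℂ → OnePoint ℂ} (hi : InjOn φ (closedBall 0 1))
    (hid : ∀ x : ℂ, ‖x‖ ≤ 1/2 → φ x = x) {x : ℂ} (hx : ‖x‖ ≤ 1) (h : φ x ∈ QQ) : ‖x‖ ≤ 1/4 := by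
  obtain ⟨q, hq, hqx⟩ := h
  rw [mem_closedBall_zero_iff] at hq
  have h1 : φ q = φ x := by rw [hid q (by linarith)]; exact hqx
  have h2 := hi (by rw [mem_closedBall_zero_iff]; linarith) (by simpa using hx) h1
  rwa [← h2]

lemma nf_inv {φ : ℂ → OnePoint ℂ} (hi : InjOn φ (closedBall 0 1))
    (hid : ∀ x : ℂ, ‖x‖ ≤ 1/2 → φ x = x) {x : ℂ} (hx : ‖x‖ ≤ 1) (hx' : 1/4 ≤ ‖x‖) : invF (φ x) ∈ QQ := by
  by_cases h : φ x ∈ QQ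
  · have h1 := nf_QQ hi hid hx h
    have h2 : ‖x‖ = 1/4 := le_antisymm h1 hx'
    have hx0 : x ≠ 0 := by rintro rfl; norm_num at h2
    rw [hid x (by linarith), invF_coe hx0]
    apply mem_QQ
    rw [norm_inv, norm_mul, h2]
    norm_num
  · exact inv_mem_QQ h

lemma QQ_sub {φ : ℂ → OnePoint ℂ} (hid : ∀ x : ℂ, ‖x‖ ≤ 1/2 → φ x = x) : QQ ⊆ φ '' ball 0 1 := by
  rintro _ ⟨q, hq, rfl⟩
  rw [mem_closedBall_zero_iff] at hq
  exact ⟨q, by rw [mem_ball_zero_iff]; linarith, hid q (by linarith)⟩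

lemma jnorm (x : ℂ) : ‖(16 * x)⁻¹‖ = (16 * ‖x‖)⁻¹ := by simp

theorem glue {V : Type*} [Finite V] {G : SimpleGraph V} {S T : Set V}
    {M₁ M₂ : V → Set ↥Sphere2} (h₁ : MapOn G S M₁) (h₂ : MapOn G T M₂) {v : V} (hvS : v ∈ S)
    (hvT : v ∈ T) (hST : S ∩ T ⊆ {v})
    (hno : ∀ a ∈ S, ∀ b ∈ T, a ≠ v → b ≠ v → ¬ G.Adj a b) :
    ∃ M : V → Set ↥Sphere2, MapOn G (S ∪ T) M := by
  obtain ⟨H⟩ := sphere_homeo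
  obtain ⟨N₁, hN₁, φ₁, hc₁, hi₁, him₁, hid₁, hd₁⟩ := normal_form h₁ hvS
  obtain ⟨N₂, hN₂, φ₂, hc₂, hi₂, him₂, hid₂, hd₂⟩ := normal_form h₂ hvT
  suffices ∃ M : V → Set (OnePoint ℂ), MapOn G (S ∪ T) M by
    obtain ⟨M, hM⟩ := this
    exact ⟨_, hM.image H⟩
  classical
  let A : Set ℂ := {x | 1/16 ≤ ‖x‖ ∧ ‖x‖ ≤ 1}
  let A₁ : Set ℂ := {x | 1/4 ≤ ‖x‖ ∧ ‖x‖ ≤ 1}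
  let A₂ : Set ℂ := {x | 1/16 ≤ ‖x‖ ∧ ‖x‖ ≤ 1/4}
  have hA : A = A₁ ∪ A₂ := by
    ext x
    simp only [A, A₁, A₂, mem_union, mem_ofPred_eq]
    constructor
    · rintro ⟨h1, h2⟩
      rcases le_total (1/4) ‖x‖ with h | h
      · exact Or.inl ⟨h, h2⟩
      · exact Or.inr ⟨h1, h⟩
    · rintro (⟨h1, h2⟩ | ⟨h1, h2⟩) <;> constructor <;> linarith
  have hA₁c : IsClosed A₁ :=
    (isClosed_le continuous_const continuous_norm).inter
      (isClosed_le continuous_norm continuous_const)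
  have hA₂c : IsClosed A₂ :=
    (isClosed_le continuous_const continuous_norm).inter
      (isClosed_le continuous_norm continuous_const)
  have hA₂0 : ∀ x ∈ A₂, x ≠ 0 := by
    rintro x hx rfl
    have := hx.1
    norm_num at this
  have hj : ∀ x ∈ A₂, 1/4 ≤ ‖(16 * x)⁻¹‖ ∧ ‖(16 * x)⁻¹‖ ≤ 1 := by
    intro x hx
    have hpos : 0 < ‖x‖ := norm_pos_iff.2 (hA₂0 x hx)
    rw [jnorm]
    constructor
    · rw [le_inv_comm₀ (by norm_num) (by positivity)]; linarith [hx.2]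
    · exact inv_le_one_of_one_le₀ (by linarith [hx.1])
  have hjj : ∀ x : ℂ, (16 * (16 * x)⁻¹)⁻¹ = x := by
    intro x
    by_cases hx : x = 0
    · simp [hx]
    · field_simp
  let g : ℂ → OnePoint ℂ := fun x => invF (φ₂ (16 * x)⁻¹)
  let α : ℂ → OnePoint ℂ := fun x => if 1/4 ≤ ‖x‖ then φ₁ x else g x
  have hα₁ : ∀ x ∈ A₁, α x = φ₁ x := fun x hx => if_pos hx.1
  have hα₂ : ∀ x ∈ A₂, α x = g x := by
    intro x hx
    by_cases h : 1/4 ≤ ‖x‖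
    · have hx4 : ‖x‖ = 1/4 := le_antisymm hx.2 h
      have hx0 := hA₂0 x hx
      have hj4 : ‖(16 * x)⁻¹‖ = 1/4 := by rw [jnorm, hx4]; norm_num
      simp only [α, if_pos h, g]
      rw [hid₁ x (by linarith), hid₂ _ (by linarith), invF_coe (by simpa using hx0), hjj]
    · exact if_neg h
  have hgQ : ∀ x ∈ A₂, g x ∈ QQ := fun x hx => nf_inv hi₂ hid₂ (hj x hx).2 (hj x hx).1
  have hgc : ContinuousOn g A₂ := by
    refine invF_cont.comp_continuousOn ?_
    refine hc₂.comp ?_ ?_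
    · intro x hx
      have := hA₂0 x hx
      exact (ContinuousAt.inv₀ (by fun_prop) (by simpa using this)).continuousWithinAt
    · intro x hx
      rw [mem_closedBall_zero_iff]
      exact (hj x hx).2
  have hαc : ContinuousOn α A := by
    rw [hA]
    refine ContinuousOn.union_of_isClosed ?_ ?_ hA₁c hA₂c
    · refine (hc₁.mono ?_).congr hα₁
      intro x hx
      rw [mem_closedBall_zero_iff]
      exact hx.2
    · exact hgc.congr hα₂
  have hcross : ∀ x ∈ A₁, ∀ y ∈ A₂, φ₁ x = g y → x = y := by
    intro x hx y hy hxy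
    have h1 : φ₁ x ∈ QQ := hxy ▸ hgQ y hy
    have h2 := nf_QQ hi₁ hid₁ hx.2 h1
    have hx4 : ‖x‖ = 1/4 := le_antisymm h2 hx.1
    have hxA : x ∈ A₂ := ⟨by linarith, h2⟩
    have h3 : g x = g y := by rw [← hxy, ← hα₁ x hx, hα₂ x hxA]
    have h4 : φ₂ (16 * x)⁻¹ = φ₂ (16 * y)⁻¹ := invH.injective h3
    have h5 := hi₂ (by rw [mem_closedBall_zero_iff]; exact (hj x hxA).2)
      (by rw [mem_closedBall_zero_iff]; exact (hj y hy).2) h4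
    rw [← hjj x, h5, hjj]
  have hαi : InjOn α A := by
    rw [hA]
    rintro x (hx | hx) y (hy | hy) hxy
    · rw [hα₁ x hx, hα₁ y hy] at hxy
      exact hi₁ (by rw [mem_closedBall_zero_iff]; exact hx.2)
        (by rw [mem_closedBall_zero_iff]; exact hy.2) hxy
    · rw [hα₁ x hx, hα₂ y hy] at hxy
      exact hcross x hx y hy hxy
    · rw [hα₂ x hx, hα₁ y hy] at hxy
      exact (hcross y hy x hx hxy.symm).symm
    · rw [hα₂ x hx, hα₂ y hy] at hxy
      have h4 : φ₂ (16 * x)⁻¹ = φ₂ (16 * y)⁻¹ := invH.injective hxy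
      have h5 := hi₂ (by rw [mem_closedBall_zero_iff]; exact (hj x hx).2)
        (by rw [mem_closedBall_zero_iff]; exact (hj y hy).2) h4
      rw [← hjj x, h5, hjj]
  have hcon₁ : ∀ w, ∃ x : ℂ, w ∈ S → G.Adj v w → x ∈ A ∧ α x ∈ N₁ w := by
    intro w
    by_cases hw : w ∈ S ∧ G.Adj v w
    · obtain ⟨p, hpv, hpw⟩ := (hN₁.adj v hvS w hw.1 hw.2.ne).1 hw.2
      rw [← him₁] at hpv
      obtain ⟨e, he, rfl⟩ := hpv
      rw [mem_closedBall_zero_iff] at he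
      have he1 : 1 ≤ ‖e‖ := by
        by_contra hlt
        exact (hd₁ w hw.1 hw.2.ne').le_bot
          ⟨hpw, mem_image_of_mem _ (by rw [mem_ball_zero_iff]; exact not_le.1 hlt)⟩
      have heA : e ∈ A₁ := ⟨by linarith, he⟩
      exact ⟨e, fun _ _ => ⟨hA ▸ Or.inl heA, by rwa [hα₁ e heA]⟩⟩
    · exact ⟨0, fun h1 h2 => absurd ⟨h1, h2⟩ hw⟩
  have hcon₂ : ∀ w, ∃ x : ℂ, w ∈ T → G.Adj v w → x ∈ A ∧ α x ∈ invH '' N₂ w := by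
    intro w
    by_cases hw : w ∈ T ∧ G.Adj v w
    · obtain ⟨p, hpv, hpw⟩ := (hN₂.adj v hvT w hw.1 hw.2.ne).1 hw.2
      rw [← him₂] at hpv
      obtain ⟨e, he, rfl⟩ := hpv
      rw [mem_closedBall_zero_iff] at he
      have he1 : 1 ≤ ‖e‖ := by
        by_contra hlt
        exact (hd₂ w hw.1 hw.2.ne').le_bot
          ⟨hpw, mem_image_of_mem _ (by rw [mem_ball_zero_iff]; exact not_le.1 hlt)⟩
      have hen : ‖e‖ = 1 := le_antisymm he he1
      have heA : (16 * e)⁻¹ ∈ A₂ := by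
        show _ ≤ ‖(16 * e)⁻¹‖ ∧ ‖(16 * e)⁻¹‖ ≤ _
        rw [jnorm, hen]
        norm_num
      refine ⟨(16 * e)⁻¹, fun _ _ => ⟨hA ▸ Or.inr heA, ?_⟩⟩
      rw [hα₂ _ heA]
      simp only [g, hjj]
      exact mem_image_of_mem invH hpw
    · exact ⟨0, fun h1 h2 => absurd ⟨h1, h2⟩ hw⟩
  choose e₁ he₁ using hcon₁
  choose e₂ he₂ using hcon₂
  obtain ⟨P, hP, hPα, hFP⟩ := cut (r := 1/16) (by norm_num) (by norm_num) hαc hαi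
    (F := (range e₁ ∪ range e₂) ∩ A)
    (((finite_range e₁).union (finite_range e₂)).inter_of_left A) inter_subset_right
  refine glue_abs (M₁ := N₁) (M₂ := fun w => invH '' N₂ w) hN₁ (hN₂.image invH) hvS hvT hST hno
    QQ_union (P := P) ?_ ?_ hP ?_ ?_ ?_ ?_
  · exact fun w hw hwv => (hd₁ w hw hwv).mono_right (QQ_sub hid₁)
  · intro w hw hwv
    rw [disjoint_image_iff invH.injective]
    exact (hd₂ w hw hwv).mono_right (QQ_sub hid₂)
  · intro p hp
    obtain ⟨x, hx, rfl⟩ := hPα hp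
    rcases (hA ▸ hx : x ∈ A₁ ∪ A₂) with h | h
    · left
      rw [hα₁ x h, ← him₁]
      exact mem_image_of_mem _ (by rw [mem_closedBall_zero_iff]; exact h.2)
    · right
      rw [hα₂ x h]
      exact hgQ x h
  · intro p hp
    obtain ⟨x, hx, rfl⟩ := hPα hp
    rcases (hA ▸ hx : x ∈ A₁ ∪ A₂) with h | h
    · right
      rw [hα₁ x h, mem_invH_image]
      exact nf_inv hi₁ hid₁ h.2 h.1
    · left
      rw [hα₂ x h, ← him₂]
      exact mem_image_of_mem invH (mem_image_of_mem _
        (by rw [mem_closedBall_zero_iff]; exact (hj x h).2))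
  · intro w hw hvw
    obtain ⟨hx, hxw⟩ := he₁ w hw hvw
    exact ⟨_, hFP (mem_image_of_mem α ⟨Or.inl (mem_range_self w), hx⟩), hxw⟩
  · intro w hw hvw
    obtain ⟨hx, hxw⟩ := he₂ w hw hvw
    exact ⟨_, hFP (mem_image_of_mem α ⟨Or.inr (mem_range_self w), hx⟩), hxw⟩

/-- Every map of a nonempty graph can be modified to have a hole. -/
lemma hole {V : Type*} [Finite V] {G : SimpleGraph V} {S : Set V}
    {M : V → Set ↥Sphere2} (h : MapOn G S M) {v : V} (hv : v ∈ S) :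
    ∃ N : V → Set (OnePoint ℂ), MapOn G S N ∧ ∀ w ∈ S, Disjoint (N w) QQ := by
  obtain ⟨N, hN, φ, hc, hi, him, hid, hd⟩ := normal_form h hv
  have hsub : {x : ℂ | 1/2 ≤ ‖x‖ ∧ ‖x‖ ≤ 1} ⊆ closedBall 0 1 := by
    intro x hx
    rw [mem_closedBall_zero_iff]
    exact hx.2
  have hcon : ∀ w, ∃ x : ℂ, w ∈ S → G.Adj v w → x ∈ {x : ℂ | 1/2 ≤ ‖x‖ ∧ ‖x‖ ≤ 1} ∧ φ x ∈ N w := by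
    intro w
    by_cases hw : w ∈ S ∧ G.Adj v w
    · obtain ⟨p, hpv, hpw⟩ := (hN.adj v hv w hw.1 hw.2.ne).1 hw.2
      rw [← him] at hpv
      obtain ⟨e, he, rfl⟩ := hpv
      rw [mem_closedBall_zero_iff] at he
      have he1 : 1 ≤ ‖e‖ := by
        by_contra hlt
        exact (hd w hw.1 hw.2.ne').le_bot
          ⟨hpw, mem_image_of_mem _ (by rw [mem_ball_zero_iff]; exact not_le.1 hlt)⟩
      exact ⟨e, fun _ _ => ⟨⟨by linarith, he⟩, hpw⟩⟩
    · exact ⟨0, fun h1 h2 => absurd ⟨h1, h2⟩ hw⟩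
  choose e he using hcon
  obtain ⟨P, hP, hPα, hFP⟩ := cut (r := 1/2) (by norm_num) (by norm_num) (hc.mono hsub)
    (hi.mono hsub) (F := range e ∩ {x : ℂ | 1/2 ≤ ‖x‖ ∧ ‖x‖ ≤ 1})
    ((finite_range e).inter_of_left _) inter_subset_right
  refine shrink_nation hN hv hP ?_ ?_ ?_ ?_
  · rw [← him]
    exact hPα.trans (image_mono hsub)
  · intro w hw hvw
    obtain ⟨hx, hxw⟩ := he w hw hvw
    exact ⟨_, hFP (mem_image_of_mem φ ⟨mem_range_self w, hx⟩), hxw⟩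
  · rw [disjoint_left]
    intro p hp hpQ
    obtain ⟨x, hx, rfl⟩ := hPα hp
    have h1 := nf_QQ hi hid hx.2 hpQ
    linarith [hx.1]
  · exact fun w hw hwv => (hd w hw hwv).mono_right (QQ_sub hid)

theorem disjoint_union {V : Type*} [Finite V] {G : SimpleGraph V} {S T : Set V}
    {M₁ M₂ : V → Set ↥Sphere2} (h₁ : MapOn G S M₁) (h₂ : MapOn G T M₂) {s t : V} (hs : s ∈ S)
    (ht : t ∈ T) (hST : S ∩ T = ∅) (hno : ∀ a ∈ S, ∀ b ∈ T, ¬ G.Adj a b) :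
    ∃ M : V → Set ↥Sphere2, MapOn G (S ∪ T) M := by
  obtain ⟨H⟩ := sphere_homeo
  obtain ⟨N₁, hN₁, hd₁⟩ := hole h₁ hs
  obtain ⟨N₂, hN₂, hd₂⟩ := hole h₂ ht
  obtain ⟨M, hM⟩ := union_abs (M₁ := N₁) (M₂ := fun w => invH '' N₂ w) hN₁ (hN₂.image invH) hST hno
    QQ_union hd₁ (fun w hw => (disjoint_image_iff invH.injective).2 (hd₂ w hw))
  exact ⟨_, hM.image H⟩

lemma preconn_of_cover {W X : Type*} [Finite W] [TopologicalSpace X] (G : SimpleGraph W)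
    (C : W → Set X) (hcl : ∀ w, IsClosed (C w)) (hne : ∀ w, (C w).Nonempty)
    (hpre : IsPreconnected (⋃ w, C w))
    (hadj : ∀ a b, a ≠ b → (C a ∩ C b).Nonempty → G.Adj a b) : G.Preconnected := by
  intro a b
  by_contra hab
  have h := isPreconnected_closed_iff.1 hpre (⋃ w ∈ {w | G.Reachable a w}, C w)
    (⋃ w ∈ {w | ¬ G.Reachable a w}, C w)
    ((toFinite _).isClosed_biUnion fun w _ => hcl w)
    ((toFinite _).isClosed_biUnion fun w _ => hcl w) ?_ ?_ ?_
  · obtain ⟨p, -, hp1, hp2⟩ := h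
    simp only [mem_iUnion] at hp1 hp2
    obtain ⟨w, hw, hpw⟩ := hp1
    obtain ⟨w', hw', hpw'⟩ := hp2
    have hww' : w ≠ w' := by rintro rfl; exact hw' hw
    have h1 := hadj w w' hww' ⟨p, hpw, hpw'⟩
    have h2 : G.Reachable a w := hw
    exact hw' (h2.trans h1.reachable)
  · intro p hp
    obtain ⟨w, hw⟩ := mem_iUnion.1 hp
    by_cases h : G.Reachable a w
    · exact Or.inl (mem_biUnion (x := w) h hw)
    · exact Or.inr (mem_biUnion (x := w) h hw)
  · obtain ⟨p, hp⟩ := hne a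
    exact ⟨p, mem_iUnion_of_mem a hp, mem_biUnion (x := a) (SimpleGraph.Reachable.refl a) hp⟩
  · obtain ⟨p, hp⟩ := hne b
    exact ⟨p, mem_iUnion_of_mem b hp, mem_biUnion (x := b) hab hp⟩

theorem holeFree_biconnected {V : Type*} [Finite V] (G : SimpleGraph V)
    (h : IsHoleFreeMapGraph G) : IsBiconnectedG G := by
  obtain ⟨M, hM, hfree⟩ := h
  rw [isMapOf_iff] at hM
  have hfree' : (⋃ v, M v) = univ := hfree
  have hcl : ∀ v, IsClosed (M v) := fun v => (hM.disk v trivial).isClosed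
  have hne : ∀ v, (M v).Nonempty := fun v => (hM.disk v trivial).nonempty
  have hadj : ∀ a b, a ≠ b → (M a ∩ M b).Nonempty → G.Adj a b :=
    fun a b hab h => (hM.adj a trivial b trivial hab).2 h
  constructor
  · rw [SimpleGraph.connected_iff]
    constructor
    · refine preconn_of_cover G M hcl hne ?_ hadj
      rw [hfree']
      have : IsPreconnected Sphere2 := by
        refine isPreconnected_sphere ?_ _ _
        rw [← Module.finrank_eq_rank, finrank_euclideanSpace_fin]
        norm_num
      exact isPreconnected_iff_preconnectedSpace.1 this |>.isPreconnected_univ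
    · obtain ⟨p⟩ : Nonempty ↥Sphere2 :=
        (NormedSpace.sphere_nonempty (x := (0 : EuclideanSpace ℝ (Fin 3))) (r := 1)).2
          zero_le_one |>.to_subtype
      have hp : p ∈ ⋃ v, M v := by rw [hfree']; trivial
      obtain ⟨v, -⟩ := mem_iUnion.1 hp
      exact ⟨v⟩
  · intro v
    refine preconn_of_cover _ (fun w : {w | w ≠ v} => M w) (fun w => hcl w) (fun w => hne w) ?_ ?_
    · have heq : (⋃ w : {w | w ≠ v}, M w) = closure (M v)ᶜ := by
        apply Subset.antisymm
        · refine iUnion_subset fun w => ?_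
          refine (hM.disk w trivial).subset_closure.trans (closure_mono ?_)
          exact (disj_int (hM.disk v trivial)
            (hM.disj w trivial v trivial w.2)).subset_compl_right
        · refine closure_minimal ?_ (isClosed_iUnion_of_finite fun w => hcl w)
          intro p hp
          have hp' : p ∈ ⋃ v, M v := by rw [hfree']; trivial
          obtain ⟨w, hw⟩ := mem_iUnion.1 hp'
          have hwv : w ≠ v := by rintro rfl; exact hp hw
          exact mem_iUnion.2 ⟨⟨w, hwv⟩, hw⟩
      rw [heq]
      obtain ⟨φ, hc, hi, hφ⟩ := hM.disk v trivial
      rw [← hφ]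
      exact (nonsep_sphere hc hi).closure
    · intro a b hab h
      exact hadj a b (fun h => hab (Subtype.ext h)) h

lemma bic_mono {W : Type*} {G H : SimpleGraph W} (h : G ≤ H) (hG : IsBiconnectedG G) :
    IsBiconnectedG H :=
  ⟨hG.1.mono h, fun v => (hG.2 v).mono (SimpleGraph.comap_monotone _ h)⟩

lemma block_adj {V : Type*} {G : SimpleGraph V} {B : G.Subgraph} (hB : IsBlock G B) {a b : V}
    (ha : a ∈ B.verts) (hb : b ∈ B.verts) (hab : G.Adj a b) : B.Adj a b := by
  have hle : B ≤ (⊤ : G.Subgraph).induce B.verts := SimpleGraph.Subgraph.le_induce_top_verts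
  have hbic : IsBiconnectedG ((⊤ : G.Subgraph).induce B.verts).coe := by
    refine bic_mono (G := B.coe) ?_ hB.1
    intro x y hxy
    exact hle.2 hxy
  have h := hB.2 _ hle hbic
  rw [← h]
  exact ⟨ha, hb, hab⟩

lemma map_of_block {V : Type*} {G : SimpleGraph V} (h : IsMapGraph G) {B : G.Subgraph}
    (hB : IsBlock G B) : IsMapGraph B.coe := by
  obtain ⟨M, hM⟩ := h
  rw [isMapOf_iff] at hM
  refine ⟨fun a => M a, ?_⟩
  rw [isMapOf_iff]
  refine ⟨fun a _ => hM.disk a trivial, fun a _ b _ hab => hM.disj a trivial b trivial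
    (fun h => hab (Subtype.ext h)), fun a _ b _ hab => ?_⟩
  rw [← hM.adj a trivial b trivial (fun h => hab (Subtype.ext h))]
  exact ⟨fun h => B.adj_sub h, fun h => block_adj hB a.2 b.2 h⟩

lemma map_of_bic {V : Type*} [Finite V] {G : SimpleGraph V}
    (h : ∀ B : G.Subgraph, IsBlock G B → IsMapGraph B.coe) {S : Set V}
    (hS : IsBiconnectedG (G.induce S)) : ∃ M : V → Set ↥Sphere2, MapOn G S M := by
  classical
  rw [SimpleGraph.induce_eq_coe_induce_top] at hS
  obtain ⟨B, hle, hmax⟩ := (toFinite {B : G.Subgraph | IsBiconnectedG B.coe}).exists_le_maximal hS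
  have hB : IsBlock G B := ⟨hmax.1, fun B' hBB' hB' => le_antisymm (hmax.2 hB' hBB') hBB'⟩
  obtain ⟨M, hM⟩ := h B hB
  rw [isMapOf_iff] at hM
  have hsub : S ⊆ B.verts := hle.1
  let M' : V → Set ↥Sphere2 := fun v => if hv : v ∈ B.verts then M ⟨v, hv⟩ else ∅
  have hM' : ∀ v (hv : v ∈ B.verts), M' v = M ⟨v, hv⟩ := fun v hv => by simp [M', hv]
  refine ⟨M', MapOn.mono (S := B.verts) ⟨fun v hv => ?_, fun v hv w hw hvw => ?_,
    fun v hv w hw hvw => ?_⟩ hsub⟩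
  · rw [hM' v hv]; exact hM.disk _ trivial
  · rw [hM' v hv, hM' w hw]
    exact hM.disj _ trivial _ trivial (fun h => hvw (congrArg Subtype.val h))
  · rw [hM' v hv, hM' w hw, ← hM.adj _ trivial _ trivial (fun h => hvw (congrArg Subtype.val h))]
    exact ⟨fun h => block_adj hB hv hw h, fun h => B.adj_sub h⟩

lemma split {V : Type*} {G : SimpleGraph V} {S : Set V} (h : ¬ (G.induce S).Preconnected) :
    ∃ S₁ S₂ : Set V, S₁ ∪ S₂ = S ∧ S₁ ∩ S₂ = ∅ ∧ S₁.Nonempty ∧ S₂.Nonempty ∧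
      ∀ a ∈ S₁, ∀ b ∈ S₂, ¬ G.Adj a b := by
  unfold SimpleGraph.Preconnected at h
  push Not at h
  obtain ⟨a, b, hab⟩ := h
  let S₁ : Set V := {w | ∃ hw : w ∈ S, (G.induce S).Reachable a ⟨w, hw⟩}
  have hS₁ : S₁ ⊆ S := fun w hw => hw.1
  refine ⟨S₁, S \ S₁, union_sdiff_cancel hS₁, inter_sdiff_self _ _, ⟨a, a.2, ?_⟩,
    ⟨b, b.2, fun hb => hab hb.2⟩, ?_⟩
  · exact SimpleGraph.Reachable.refl a
  · rintro x ⟨hx, hrx⟩ y ⟨hy, hyn⟩ hxy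
    have h1 : (G.induce S).Adj ⟨x, hx⟩ ⟨y, hy⟩ := hxy
    exact hyn ⟨hy, hrx.trans h1.reachable⟩

theorem map_all {V : Type*} [Finite V] {G : SimpleGraph V}
    (h : ∀ B : G.Subgraph, IsBlock G B → IsMapGraph B.coe) (S : Set V) :
    ∃ M : V → Set ↥Sphere2, MapOn G S M := by
  induction S using WellFoundedLT.induction with
  | ind S ih =>
  rcases S.eq_empty_or_nonempty with rfl | hSne
  · exact ⟨fun _ => ∅, ⟨by simp, by simp, by simp⟩⟩
  by_cases hconn : (G.induce S).Preconnected
  swap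
  · obtain ⟨S₁, S₂, hu, h_meet, ⟨s, hs⟩, ⟨t, ht⟩, hno⟩ := split hconn
    have hlt₁ : S₁ < S := by
      rw [← hu]
      refine ssubset_iff_subset_ne.2 ⟨subset_union_left, fun heq => ?_⟩
      have : t ∈ S₁ ∩ S₂ := ⟨heq ▸ Or.inr ht, ht⟩
      rw [h_meet] at this
      exact this
    have hlt₂ : S₂ < S := by
      rw [← hu]
      refine ssubset_iff_subset_ne.2 ⟨subset_union_right, fun heq => ?_⟩
      have : s ∈ S₁ ∩ S₂ := ⟨hs, heq ▸ Or.inl hs⟩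
      rw [h_meet] at this
      exact this
    obtain ⟨M₁, hM₁⟩ := ih S₁ hlt₁
    obtain ⟨M₂, hM₂⟩ := ih S₂ hlt₂
    rw [← hu]
    exact disjoint_union hM₁ hM₂ hs ht h_meet hno
  by_cases hcut : ∀ v ∈ S, (G.induce (S \ {v})).Preconnected
  · refine map_of_bic h ⟨?_, ?_⟩
    · rw [SimpleGraph.connected_iff]
      exact ⟨hconn, hSne.to_subtype⟩
    · intro v
      let f : G.induce (S \ {(v : V)}) →g (G.induce S).induce {w | w ≠ v} :=
        { toFun := fun w => ⟨⟨w, w.2.1⟩, fun heq => w.2.2 (congrArg Subtype.val heq)⟩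
          map_rel' := fun {a b} hab => hab }
      refine (hcut v v.2).map f ?_
      rintro ⟨⟨w, hw⟩, hwv⟩
      exact ⟨⟨w, hw, fun heq => hwv (Subtype.ext heq)⟩, rfl⟩
  · push Not at hcut
    obtain ⟨v, hv, hvn⟩ := hcut
    obtain ⟨S₁, S₂, hu, h_meet, ⟨s, hs⟩, ⟨t, ht⟩, hno⟩ := split hvn
    have hv₁ : ∀ x ∈ S₁, x ∈ S ∧ x ≠ v := fun x hx => (hu ▸ Or.inl hx : x ∈ S \ {v})
    have hv₂ : ∀ x ∈ S₂, x ∈ S ∧ x ≠ v := fun x hx => (hu ▸ Or.inr hx : x ∈ S \ {v})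
    have hdis : ∀ x, x ∈ S₁ → x ∈ S₂ → False := by
      intro x h1 h2
      have : x ∈ S₁ ∩ S₂ := ⟨h1, h2⟩
      rw [h_meet] at this
      exact this
    have hlt₁ : insert v S₁ < S := by
      refine ssubset_iff_subset_ne.2 ⟨insert_subset hv fun x hx => (hv₁ x hx).1, fun heq => ?_⟩
      rcases (heq ▸ (hv₂ t ht).1 : t ∈ insert v S₁) with h | h
      · exact (hv₂ t ht).2 h
      · exact hdis t h ht
    have hlt₂ : insert v S₂ < S := by
      refine ssubset_iff_subset_ne.2 ⟨insert_subset hv fun x hx => (hv₂ x hx).1, fun heq => ?_⟩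
      rcases (heq ▸ (hv₁ s hs).1 : s ∈ insert v S₂) with h | h
      · exact (hv₁ s hs).2 h
      · exact hdis s hs h
    obtain ⟨M₁, hM₁⟩ := ih _ hlt₁
    obtain ⟨M₂, hM₂⟩ := ih _ hlt₂
    have hS : insert v S₁ ∪ insert v S₂ = S := by
      ext x
      constructor
      · rintro ((rfl | hx) | (rfl | hx))
        · exact hv
        · exact (hv₁ x hx).1
        · exact hv
        · exact (hv₂ x hx).1
      · intro hx
        by_cases hxv : x = v
        · exact Or.inl (Or.inl hxv)
        · have : x ∈ S₁ ∪ S₂ := by rw [hu]; exact ⟨hx, hxv⟩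
          rcases this with h | h
          · exact Or.inl (Or.inr h)
          · exact Or.inr (Or.inr h)
    rw [← hS]
    refine glue hM₁ hM₂ (mem_insert v S₁) (mem_insert v S₂) ?_ ?_
    · rintro x ⟨hx | hx, hy | hy⟩
      · exact hx
      · exact hx
      · exact hy
      · exact (hdis x hx hy).elim
    · rintro a (rfl | ha) b (rfl | hb) hav hbv
      · exact absurd rfl hav
      · exact absurd rfl hav
      · exact absurd rfl hbv
      · exact hno a ha b hb

end aux

/-- A graph admits a map iff each of its biconnected components admits a map;
moreover a graph admitting a hole-free map is biconnected. -/
theorem mapGraph_iff_blocks_and_holeFree_biconnected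
    {V : Type} [Fintype V] (G : SimpleGraph V) :
    (IsMapGraph G ↔ ∀ B : G.Subgraph, IsBlock G B → IsMapGraph B.coe) ∧
    (IsHoleFreeMapGraph G → IsBiconnectedG G) := by
  refine ⟨⟨fun h B hB => map_of_block h hB, fun h => ?_⟩, holeFree_biconnected G⟩
  obtain ⟨M, hM⟩ := map_all h univ
  exact ⟨M, (isMapOf_iff G M).2 hM⟩

end
end

section
/- Let G=(V,E) be a graph and let G*=(V ∪ C, E ∪ D) be obtained from G by adding, for every subset S of V that forms a clique in G, a new vertex v_S ∈ C with edges (v_S, u) ∈ D for each u ∈ S. Then G is a map graph if and only if there exists a subset B of D such that the graph G_B formed by the edges of B is planar and, for every edge (u,v) of E, there is a path between u and v in G* composed of two edges of B. -/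
open Set

noncomputable section



/-- The graph `G_B` formed by the edges of `B ⊆ D`, where `D` joins each clique-vertex `v_S`
to the vertices of the clique `S`. -/
def cliqueEdgesGraph {V : Type} (G : SimpleGraph V)
    (B : Set (V × {S : Finset V // G.IsClique (S : Set V)})) :
    SimpleGraph (V ⊕ {S : Finset V // G.IsClique (S : Set V)}) :=
  SimpleGraph.fromRel (fun a b =>
    match a, b with
    | Sum.inl u, Sum.inr S => (u, S) ∈ B
    | _, _ => False)


/-- A continuous logarithm can be transported along a nonvanishing homotopy. -/
theorem exists_log_of_homotopy {X : Type*} [TopologicalSpace X]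
    (H : unitInterval × X → ℂ) (hH : Continuous H) (h0 : ∀ p, H p ≠ 0)
    (l : X → ℂ) (hl : Continuous l) (hl0 : ∀ x, Complex.exp (l x) = H (0, x)) :
    ∃ l' : X → ℂ, Continuous l' ∧ ∀ x, Complex.exp (l' x) = H (1, x) := by
  let H' : C(unitInterval × X, {z : ℂ // z ≠ 0}) :=
    ⟨fun p => ⟨H p, h0 p⟩, hH.subtype_mk _⟩
  let f : C(X, ℂ) := ⟨l, hl⟩
  have e : ∀ a, H' (0, a) = (⟨_, (f a).exp_ne_zero⟩ : {z : ℂ // z ≠ 0}) := by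
    intro a
    apply Subtype.ext
    exact (hl0 a).symm
  refine ⟨fun x => Complex.isCoveringMap_exp.liftHomotopy H' f e (1, x), by fun_prop, fun x => ?_⟩
  have := congrFun (Complex.isCoveringMap_exp.liftHomotopy_lifts H' f e) (1, x)
  exact congrArg Subtype.val this

/-- An odd nonvanishing map on a connected sphere has no continuous logarithm. -/
theorem no_log_of_odd {E : Type*} [NormedAddCommGroup E] [NormedSpace ℝ E]
    (hE : 1 < Module.rank ℝ E)
    (g : Metric.sphere (0 : E) 1 → ℂ) (hodd : ∀ w, g (-w) = - g w)
    (l : Metric.sphere (0 : E) 1 → ℂ) (hl : Continuous l) (hlg : ∀ w, Complex.exp (l w) = g w) :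
    False := by
  have hconn : IsConnected (Metric.sphere (0 : E) 1) := isConnected_sphere hE 0 zero_le_one
  have : ConnectedSpace (Metric.sphere (0 : E) 1) := Subtype.connectedSpace hconn
  -- integer valued function
  have h1 : ∀ w, ∃ n : ℤ, l (-w) = l w + Real.pi * Complex.I + n * (2 * Real.pi * Complex.I) := by
    intro w
    apply Complex.exp_eq_exp_iff_exists_int.mp
    rw [Complex.exp_add, Complex.exp_pi_mul_I, hlg, hlg, hodd]
    ring
  choose n hn using h1
  have hpi : (Real.pi : ℂ) ≠ 0 := by exact_mod_cast Real.pi_ne_zero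
  have hncont : Continuous n := by
    have h2 : Continuous (fun w => (n w : ℂ)) := by
      have : (fun w => (n w : ℂ)) =
          fun w => (l (-w) - l w - Real.pi * Complex.I) / (2 * Real.pi * Complex.I) := by
        funext w
        rw [hn w]
        field_simp
        ring
      rw [this]
      fun_prop
    have h3 : Continuous (fun w => (n w : ℝ)) := by
      have := Complex.continuous_re.comp h2
      simpa [Function.comp_def] using this
    exact Int.isClosedEmbedding_coe_real.isInducing.continuous_iff.mpr h3
  obtain ⟨w⟩ : Nonempty (Metric.sphere (0 : E) 1) := inferInstance
  have h4 : n (-w) = n w := PreconnectedSpace.constant inferInstance hncont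
  have h5 := hn w
  have h6 := hn (-w)
  rw [neg_neg, h5, h4] at h6
  have h7 : ((2 * n w + 1 : ℤ) : ℂ) * (2 * Real.pi * Complex.I) = 0 := by
    push_cast
    linear_combination -h6
  have h8 : ((2 * n w + 1 : ℤ) : ℂ) = 0 := by
    rcases mul_eq_zero.mp h7 with h | h
    · exact h
    · simp [hpi] at h
  have h9 : (2 * n w + 1 : ℤ) = 0 := by exact_mod_cast h8
  omega

/-- Invariance of domain in dimension two (at the centre of a unit ball). -/
theorem invariance_of_domain_aux {E : Type*} [NormedAddCommGroup E] [NormedSpace ℝ E]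
    [FiniteDimensional ℝ E]
    (hE : 1 < Module.rank ℝ E) (f : E → ℂ)
    (hf : ContinuousOn f (Metric.closedBall 0 1)) (hinj : InjOn f (Metric.closedBall 0 1)) :
    f '' Metric.closedBall 0 1 ∈ nhds (f 0) := by
  by_contra hcon
  have hconn : IsConnected (Metric.sphere (0 : E) 1) := isConnected_sphere hE 0 zero_le_one
  have hcomp : IsCompact (Metric.sphere (0 : E) 1) := isCompact_sphere 0 1
  have hs : ∀ w : Metric.sphere (0 : E) 1, ‖(w : E)‖ = 1 := fun w => by simp
  have hb : ∀ (t : unitInterval) (w : Metric.sphere (0 : E) 1),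
      (t : ℝ) • (w : E) ∈ Metric.closedBall (0 : E) 1 := by
    intro t w
    simp [norm_smul, abs_of_nonneg t.2.1, t.2.2]
  have hb1 : ∀ w : Metric.sphere (0 : E) 1, (w : E) ∈ Metric.closedBall (0 : E) 1 := by
    intro w
    simp
  have hfs : Continuous fun w : Metric.sphere (0 : E) 1 => f w :=
    hf.comp_continuous continuous_subtype_val hb1
  -- distance to the sphere
  obtain ⟨m, hm, hmw⟩ : ∃ m > 0, ∀ w : Metric.sphere (0 : E) 1, m ≤ ‖f w - f 0‖ := by
    obtain ⟨w0, hw0, hmin⟩ := hcomp.exists_isMinOn hconn.nonempty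
      (f := fun w => ‖f w - f 0‖)
      ((hf.mono Metric.sphere_subset_closedBall).sub continuousOn_const).norm
    refine ⟨‖f w0 - f 0‖, ?_, fun w => hmin w.2⟩
    rw [gt_iff_lt, norm_pos_iff, sub_ne_zero]
    intro h
    have := hinj (Metric.sphere_subset_closedBall hw0) (by simp) h
    simp [this] at hw0
  obtain ⟨q, hq, hqm⟩ : ∃ q, q ∉ f '' Metric.closedBall 0 1 ∧ ‖q - f 0‖ < m := by
    by_contra hno
    push Not at hno
    apply hcon
    refine Filter.mem_of_superset (Metric.ball_mem_nhds (f 0) hm) ?_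
    intro q hq
    by_contra hq'
    have := hno q hq'
    rw [mem_ball_iff_norm] at hq
    linarith
  have hc1 : Continuous fun p : unitInterval × Metric.sphere (0 : E) 1 =>
      f ((p.1 : ℝ) • (p.2 : E)) :=
    hf.comp_continuous (by fun_prop) (fun p => hb p.1 p.2)
  -- step 1
  obtain ⟨l1, hl1, hl1'⟩ := exists_log_of_homotopy
    (X := Metric.sphere (0 : E) 1)
    (fun p => f ((p.1 : ℝ) • (p.2 : E)) - q)
    (hc1.sub continuous_const)
    (fun p h => hq ⟨_, hb p.1 p.2, sub_eq_zero.mp h⟩)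
    (fun _ => Complex.log (f 0 - q)) continuous_const
    (fun w => by
      have : f 0 - q ≠ 0 := fun h => hq ⟨0, by simp, sub_eq_zero.mp h⟩
      simp [Complex.exp_log this])
  -- step 2
  obtain ⟨l2, hl2, hl2'⟩ := exists_log_of_homotopy
    (X := Metric.sphere (0 : E) 1)
    (fun p => f (p.2 : E) - (q + ((p.1 : ℝ) : ℂ) * (f 0 - q)))
    ((hfs.comp continuous_snd).sub (by fun_prop))
    (fun p h => by
      have h1 : f (p.2 : E) - f 0 = ((1 - (p.1 : ℝ) : ℝ) : ℂ) * (q - f 0) := by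
        push_cast
        linear_combination h
      have h2 := hmw p.2
      rw [h1, norm_mul, Complex.norm_real, Real.norm_of_nonneg (by linarith [p.1.2.2])] at h2
      have h3 := p.1.2.1
      have h4 : 0 ≤ ‖q - f 0‖ := norm_nonneg _
      nlinarith)
    l1 hl1 (fun w => by simpa using hl1' w)
  -- step 3
  have hb' : ∀ (t : unitInterval) (w : Metric.sphere (0 : E) 1),
      -((t : ℝ) • (w : E)) ∈ Metric.closedBall (0 : E) 1 := by
    intro t w
    simpa using hb t w
  have hc2 : Continuous fun p : unitInterval × Metric.sphere (0 : E) 1 =>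
      f (-((p.1 : ℝ) • (p.2 : E))) :=
    hf.comp_continuous (by fun_prop) (fun p => hb' p.1 p.2)
  obtain ⟨l3, hl3, hl3'⟩ := exists_log_of_homotopy
    (X := Metric.sphere (0 : E) 1)
    (fun p => f (p.2 : E) - f (-((p.1 : ℝ) • (p.2 : E))))
    ((hfs.comp continuous_snd).sub hc2)
    (fun p h => by
      have h1 := hinj (hb1 p.2) (hb' p.1 p.2) (sub_eq_zero.mp h)
      have h2 : (1 + (p.1 : ℝ)) • (p.2 : E) = 0 := by
        rw [add_smul, one_smul]
        nth_rewrite 1 [h1]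
        simp
      have h3 := hs p.2
      rcases smul_eq_zero.mp h2 with h | h
      · linarith [p.1.2.1]
      · rw [h] at h3
        simp at h3)
    l2 hl2 (fun w => by simpa using hl2' w)
  exact no_log_of_odd hE (fun w => f (w : E) - f (-(w : E))) (fun w => by simp) l3 hl3
    (fun w => by simpa using hl3' w)

abbrev Pl := EuclideanSpace ℝ (Fin 2)

theorem rank_Pl : 1 < Module.rank ℝ Pl := by
  rw [← Module.finrank_eq_rank]
  simp

/-- Invariance of domain for maps from planar balls to the plane. -/
theorem invariance_of_domain (f : Pl → Pl) (c : Pl) (r : ℝ) (hr : 0 < r)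
    (hf : ContinuousOn f (Metric.closedBall c r)) (hinj : InjOn f (Metric.closedBall c r)) :
    f '' Metric.closedBall c r ∈ nhds (f c) := by
  let L : ℂ ≃ₗᵢ[ℝ] Pl := Complex.orthonormalBasisOneI.repr
  let T : Pl → Pl := fun x => c + r • x
  have hT : MapsTo T (Metric.closedBall 0 1) (Metric.closedBall c r) := by
    intro x hx
    simp only [mem_closedBall_zero_iff] at hx
    simp only [T, mem_closedBall_iff_norm, add_sub_cancel_left, norm_smul, Real.norm_of_nonneg hr.le]
    nlinarith
  have hTc : Continuous T := by fun_prop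
  have hTi : Function.Injective T := by
    intro x y h
    have : r • x = r • y := by simpa [T] using h
    exact smul_right_injective _ hr.ne' this
  have key := invariance_of_domain_aux rank_Pl (fun x => L.symm (f (T x)))
    (L.symm.continuous.comp_continuousOn (hf.comp hTc.continuousOn hT))
    (fun x hx y hy h => hTi (hinj (hT hx) (hT hy) (L.symm.injective h)))
  have h2 : L.symm ⁻¹' ((fun x => L.symm (f (T x))) '' Metric.closedBall 0 1) ∈ nhds (f c) := by
    apply L.symm.continuous.continuousAt.preimage_mem_nhds
    simpa [T] using key
  refine Filter.mem_of_superset h2 ?_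
  rintro y ⟨x, hx, hxy⟩
  exact ⟨T x, hT hx, L.symm.injective hxy⟩
/-- Pushing a point by a small vector. -/
theorem exists_push (x w : Pl) (R : ℝ) (hR : 0 < R) (hw : 2 * ‖w‖ ≤ R) :
    ∃ g : Pl ≃ₜ Pl, ∀ z, g z = z + max 0 (1 - ‖z - x‖ / R) • w := by
  have hlip : ∀ a b : Pl, ‖(max 0 (1 - ‖a - x‖ / R) - max 0 (1 - ‖b - x‖ / R)) • w‖
      ≤ (1 / 2) * ‖a - b‖ := by
    intro a b
    rw [norm_smul, Real.norm_eq_abs]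
    have h1 : |max 0 (1 - ‖a - x‖ / R) - max 0 (1 - ‖b - x‖ / R)| ≤ ‖a - b‖ / R := by
      have h2 : |max 0 (1 - ‖a - x‖ / R) - max 0 (1 - ‖b - x‖ / R)|
          ≤ |(1 - ‖a - x‖ / R) - (1 - ‖b - x‖ / R)| := by
        rw [max_comm 0, max_comm 0]
        exact abs_max_sub_max_le_abs _ _ _
      refine h2.trans ?_
      have h3 : (1 - ‖a - x‖ / R) - (1 - ‖b - x‖ / R) = (‖b - x‖ - ‖a - x‖) / R := by ring
      rw [h3, abs_div, abs_of_pos hR]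
      gcongr
      have h4 := abs_norm_sub_norm_le (b - x) (a - x)
      have h5 : b - x - (a - x) = -(a - b) := by abel
      rwa [h5, norm_neg] at h4
    calc _ ≤ ‖a - b‖ / R * ‖w‖ := by gcongr
      _ = ‖a - b‖ * (‖w‖ / R) := by ring
      _ ≤ ‖a - b‖ * (1 / 2) := by
        apply mul_le_mul_of_nonneg_left _ (norm_nonneg _)
        rw [div_le_iff₀ hR]
        linarith
      _ = _ := by ring
  let f : Pl → Pl := fun z => z + max 0 (1 - ‖z - x‖ / R) • w
  have hA : ApproximatesLinearOn f ((ContinuousLinearEquiv.refl ℝ Pl : Pl ≃L[ℝ] Pl) : Pl →L[ℝ] Pl)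
      univ (1 / 2 : NNReal) := by
    intro a _ b _
    have h : f a - f b - ((ContinuousLinearEquiv.refl ℝ Pl : Pl ≃L[ℝ] Pl) : Pl →L[ℝ] Pl) (a - b)
        = (max 0 (1 - ‖a - x‖ / R) - max 0 (1 - ‖b - x‖ / R)) • w := by
      simp only [f, ContinuousLinearEquiv.coe_coe, ContinuousLinearEquiv.refl_apply, sub_smul]
      abel
    rw [h]
    simpa using hlip a b
  refine ⟨hA.toHomeomorph f (Or.inr ?_), fun z => rfl⟩
  have h1 : ‖(((ContinuousLinearEquiv.refl ℝ Pl : Pl ≃L[ℝ] Pl).symm : Pl ≃L[ℝ] Pl) : Pl →L[ℝ] Pl)‖₊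
      = 1 := by
    have : (((ContinuousLinearEquiv.refl ℝ Pl : Pl ≃L[ℝ] Pl).symm : Pl ≃L[ℝ] Pl) : Pl →L[ℝ] Pl)
      = ContinuousLinearMap.id ℝ Pl := rfl
    rw [this]
    apply NNReal.eq
    simp
  rw [h1, inv_one]
  exact NNReal.half_lt_self one_ne_zero

/-- Homogeneity: points of a connected set can be moved by homeomorphisms supported nearby. -/
theorem exists_homeo_move (W C : Set Pl) (hW : IsOpen W) (hC : IsPreconnected C) (hCW : C ⊆ W)
    (x y : Pl) (hx : x ∈ C) (hy : y ∈ C) :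
    ∃ h : Pl ≃ₜ Pl, (∀ z, z ∉ W → h z = z) ∧ h x = y := by
  let A : Set Pl := {y | y ∈ W ∧ ∃ h : Pl ≃ₜ Pl, (∀ z, z ∉ W → h z = z) ∧ h x = y}
  have hmove : ∀ y ∈ A, ∀ R > 0, Metric.ball y R ⊆ W → ∀ y', 2 * ‖y' - y‖ ≤ R → y' ∈ A := by
    rintro y ⟨hyW, h, hh, hxy⟩ R hR hball y' hy'
    obtain ⟨g, hg⟩ := exists_push y (y' - y) R hR hy'
    refine ⟨hball ?_, h.trans g, ?_, ?_⟩
    · rw [mem_ball_iff_norm]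
      have : 0 ≤ ‖y' - y‖ := norm_nonneg _
      by_cases h0 : ‖y' - y‖ = 0
      · linarith
      · have : 0 < ‖y' - y‖ := lt_of_le_of_ne this (Ne.symm h0)
        linarith
    · intro z hz
      rw [Homeomorph.trans_apply, hh z hz, hg]
      have h1 : R ≤ ‖z - y‖ := by
        by_contra hlt
        exact hz (hball (mem_ball_iff_norm.mpr (not_le.mp hlt)))
      have h2 : 1 - ‖z - y‖ / R ≤ 0 := by
        rw [sub_nonpos, one_le_div hR]
        exact h1
      rw [max_eq_left h2]
      simp
    · rw [Homeomorph.trans_apply, hxy, hg]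
      simp
  have hxA : x ∈ A := ⟨hCW hx, Homeomorph.refl _, fun _ _ => rfl, rfl⟩
  have hAo : IsOpen A := by
    rw [Metric.isOpen_iff]
    intro y hy
    obtain ⟨R, hR, hball⟩ := Metric.isOpen_iff.mp hW y hy.1
    refine ⟨R / 2, by positivity, fun y' hy' => hmove y hy R hR hball y' ?_⟩
    rw [mem_ball_iff_norm] at hy'
    linarith
  have hsub : C ⊆ A := by
    apply hC.subset_of_closure_inter_subset hAo ⟨x, hx, hxA⟩
    rintro y ⟨hy, hyC⟩
    obtain ⟨R, hR, hball⟩ := Metric.isOpen_iff.mp hW y (hCW hyC)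
    obtain ⟨y', hy', hd⟩ := Metric.mem_closure_iff.mp hy (R / 4) (by positivity)
    refine hmove y' hy' (R / 2) (by positivity) ?_ y ?_
    · refine (Metric.ball_subset_ball' ?_).trans hball
      rw [dist_comm]
      linarith
    · rw [dist_eq_norm] at hd
      linarith
  exact (hsub hy).2

/-- The finger lemma: a compact set can be deformed along a path so that it touches a closed set
in exactly one point. -/
theorem finger (K D U : Set Pl) (hK : IsCompact K) (hD : IsClosed D) (hU : IsOpen U)
    (hKD : Disjoint K D) (γ : unitInterval → Pl) (hγ : Continuous γ)
    (hγ0 : γ 0 ∈ K) (hγ1 : γ 1 ∈ D) (hγU : ∀ t, γ t ∈ U) :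
    ∃ g : Pl ≃ₜ Pl, (∀ z, z ∉ U → g z = z) ∧ ∃ d, g '' K ∩ D = {d} := by
  have hDne : D.Nonempty := ⟨_, hγ1⟩
  obtain ⟨δ, hδ, hδU⟩ := (isCompact_range hγ).exists_thickening_subset_open hU
    (range_subset_iff.mpr hγU)
  obtain ⟨d0, hd0, hd0'⟩ := hKD.exists_thickenings hK hD
  have hKfar : ∀ k ∈ K, d0 ≤ Metric.infDist k D := by
    intro k hk
    by_contra hlt
    refine disjoint_left.mp hd0' (Metric.self_subset_thickening hd0 _ hk) ?_
    exact Metric.mem_thickening_iff_infDist_lt hDne |>.mpr (not_le.mp hlt)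
  obtain ⟨t1, ht1D, ht1min⟩ := (hD.preimage hγ).isCompact.exists_isLeast ⟨1, hγ1⟩
  have ht1pos : 0 < t1 := by
    rcases eq_or_lt_of_le (unitInterval.nonneg' (t := t1)) with h | h
    · exfalso
      rw [← h] at ht1D
      exact disjoint_left.mp hKD hγ0 ht1D
    · exact h
  let s : ℝ := min d0 (δ / 4)
  have hs : 0 < s := lt_min hd0 (by positivity)
  obtain ⟨t, ht, hts⟩ : ∃ t < t1, dist (γ t) (γ t1) < s := by
    have : (nhdsWithin t1 (Iio t1)).NeBot := nhdsLT_neBot_of_exists_lt ⟨0, ht1pos⟩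
    have h1 : ∀ᶠ t in nhdsWithin t1 (Iio t1), dist (γ t) (γ t1) < s :=
      (hγ.tendsto t1).mono_left nhdsWithin_le_nhds (Metric.ball_mem_nhds _ hs)
    have h2 : ∀ᶠ t in nhdsWithin t1 (Iio t1), t < t1 := self_mem_nhdsWithin
    exact (h2.and h1).exists
  let R' := Metric.thickening (δ / 2) (range γ)
  obtain ⟨h, hh, hh0⟩ := exists_homeo_move (R' \ D) (γ '' Icc 0 t)
    (Metric.isOpen_thickening.sdiff hD)
    (isPreconnected_Icc.image _ hγ.continuousOn)
    (by
      rintro _ ⟨a, ha, rfl⟩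
      refine ⟨Metric.self_subset_thickening (by positivity) _ (mem_range_self a), fun had => ?_⟩
      exact absurd (ht1min had) (not_le.mpr (ha.2.trans_lt ht)))
    (γ 0) (γ t) ⟨0, ⟨le_rfl, unitInterval.nonneg'⟩, rfl⟩ ⟨t, ⟨unitInterval.nonneg', le_rfl⟩, rfl⟩
  have hK1 : IsCompact (h '' K) := hK.image h.continuous
  obtain ⟨y0, hy0, hmin⟩ := hK1.exists_isMinOn ⟨_, mem_image_of_mem _ hγ0⟩
    (f := fun z => Metric.infDist z D) (Metric.continuous_infDist_pt D).continuousOn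
  obtain ⟨d, hd, hyd⟩ := hD.exists_infDist_eq_dist hDne y0
  have hK1D : ∀ z ∈ h '' K, z ∉ D := by
    rintro _ ⟨k, hk, rfl⟩ hkD
    have h1 : h (h k) = h k := hh _ (fun hm => hm.2 hkD)
    have h2 : h k = k := h.injective h1
    rw [h2] at hkD
    exact disjoint_left.mp hKD hk hkD
  set ρ := Metric.infDist y0 D with hρ
  have hρs : ρ < s := by
    have h1 : ρ ≤ Metric.infDist (γ t) D := hmin ⟨γ 0, hγ0, hh0⟩
    have h2 : Metric.infDist (γ t) D ≤ dist (γ t) (γ t1) := Metric.infDist_le_dist_of_mem ht1D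
    linarith
  have hρ0 : 0 < ρ := (hD.notMem_iff_infDist_pos hDne).mp (hK1D _ hy0)
  have hy0R : y0 ∈ R' := by
    obtain ⟨k, hk, hky⟩ := hy0
    by_contra hn
    have h1 : h y0 = y0 := hh _ (fun hm => hn hm.1)
    have h2 : k = y0 := h.injective (hky.trans h1.symm)
    have h3 := hKfar k hk
    rw [h2, ← hρ] at h3
    have h4 : s ≤ d0 := min_le_left _ _
    linarith
  have hnd : ‖d - y0‖ = ρ := by rw [← dist_eq_norm, dist_comm, hyd]
  obtain ⟨g, hg⟩ := exists_push y0 (d - y0) (2 * ρ) (by positivity) (by rw [hnd])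
  have hgy0 : g y0 = d := by
    rw [hg]
    simp
  refine ⟨h.trans g, ?_, d, ?_⟩
  · intro z hz
    have hzR : z ∉ R' := fun hzR => hz (hδU (Metric.thickening_mono (by linarith) _ hzR))
    rw [Homeomorph.trans_apply, hh z (fun hm => hzR hm.1), hg]
    have h1 : 2 * ρ ≤ ‖z - y0‖ := by
      by_contra hlt
      rw [not_le, ← dist_eq_norm] at hlt
      apply hz
      apply hδU
      obtain ⟨a, ha, hya⟩ := Metric.mem_thickening_iff.mp hy0R
      refine Metric.mem_thickening_iff.mpr ⟨a, ha, ?_⟩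
      have h4 : s ≤ δ / 4 := min_le_right _ _
      linarith [dist_triangle z y0 a]
    have h2 : 1 - ‖z - y0‖ / (2 * ρ) ≤ 0 := by
      rw [sub_nonpos, one_le_div (by positivity)]
      exact h1
    rw [max_eq_left h2]
    simp
  · ext z
    simp only [mem_inter_iff, mem_singleton_iff]
    constructor
    · rintro ⟨⟨k, hk, rfl⟩, hz⟩
      rw [Homeomorph.trans_apply] at hz ⊢
      set k' := h k with hk'
      have hkK : k' ∈ h '' K := ⟨k, hk, rfl⟩
      by_cases hky : k' = y0
      · rw [hky, hgy0]
      · exfalso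
        have h1 : ρ ≤ Metric.infDist k' D := hmin hkK
        have h2 : Metric.infDist k' D ≤ dist k' (g k') := Metric.infDist_le_dist_of_mem hz
        rw [hg, dist_self_add_right, norm_smul, hnd,
          Real.norm_of_nonneg (le_max_left _ _)] at h2
        have h3 : max 0 (1 - ‖k' - y0‖ / (2 * ρ)) < 1 := by
          apply max_lt one_pos
          have : 0 < ‖k' - y0‖ / (2 * ρ) := by
            have : 0 < ‖k' - y0‖ := norm_pos_iff.mpr (sub_ne_zero.mpr hky)
            positivity
          linarith
        nlinarith
    · rintro rfl
      obtain ⟨k, hk, hky⟩ := hy0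
      refine ⟨⟨k, hk, ?_⟩, hd⟩
      rw [Homeomorph.trans_apply, hky, hgy0]

/-- Several fingers at once. -/
theorem multi_finger {ι : Type*} [DecidableEq ι] (K : Set Pl) (hK : IsCompact K)
    (D U : ι → Set Pl) (F : Finset ι)
    (hD : ∀ i ∈ F, IsClosed (D i)) (hU : ∀ i ∈ F, IsOpen (U i))
    (hKD : ∀ i ∈ F, Disjoint K (D i))
    (hγ : ∀ i ∈ F, ∃ γ : unitInterval → Pl, Continuous γ ∧ γ 0 ∈ K ∧ γ 1 ∈ D i ∧ ∀ t, γ t ∈ U i)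
    (hUU : ∀ i ∈ F, ∀ j ∈ F, i ≠ j → Disjoint (U i) (U j))
    (hUD : ∀ i ∈ F, ∀ j ∈ F, i ≠ j → Disjoint (U i) (D j)) :
    ∃ H : Pl ≃ₜ Pl, (∀ z, (∀ i ∈ F, z ∉ U i) → H z = z) ∧ ∀ i ∈ F, ∃ d, H '' K ∩ D i = {d} := by
  induction F using Finset.induction_on with
  | empty => exact ⟨Homeomorph.refl _, fun _ _ => rfl, by simp⟩
  | insert i F hi ih =>
    obtain ⟨H, hH, hHd⟩ := ih
      (fun j hj => hD j (Finset.mem_insert_of_mem hj))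
      (fun j hj => hU j (Finset.mem_insert_of_mem hj))
      (fun j hj => hKD j (Finset.mem_insert_of_mem hj))
      (fun j hj => hγ j (Finset.mem_insert_of_mem hj))
      (fun j hj k hk => hUU j (Finset.mem_insert_of_mem hj) k (Finset.mem_insert_of_mem hk))
      (fun j hj k hk => hUD j (Finset.mem_insert_of_mem hj) k (Finset.mem_insert_of_mem hk))
    have hiF : i ∈ insert i F := Finset.mem_insert_self i F
    have hne : ∀ j ∈ F, j ≠ i := fun j hj h => hi (h ▸ hj)
    obtain ⟨γ, hγc, hγ0, hγ1, hγU⟩ := hγ i hiF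
    have hK1D : Disjoint (H '' K) (D i) := by
      rw [disjoint_left]
      rintro _ ⟨k, hk, rfl⟩ hkD
      have h1 : H (H k) = H k := by
        apply hH
        intro j hj hjU
        exact disjoint_left.mp
          (hUD j (Finset.mem_insert_of_mem hj) i hiF (hne j hj)) hjU hkD
      have h2 : H k = k := H.injective h1
      rw [h2] at hkD
      exact disjoint_left.mp (hKD i hiF) hk hkD
    have hγ0' : γ 0 ∈ H '' K := by
      refine ⟨γ 0, hγ0, hH _ ?_⟩
      intro j hj hjU
      exact disjoint_left.mp (hUU j (Finset.mem_insert_of_mem hj) i hiF (hne j hj)) hjU (hγU 0)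
    obtain ⟨G, hG, d, hGd⟩ := finger (H '' K) (D i) (U i) (hK.image H.continuous) (hD i hiF)
      (hU i hiF) hK1D γ hγc hγ0' hγ1 hγU
    have himg : (H.trans G) '' K = G '' (H '' K) := by
      rw [image_image]
      rfl
    refine ⟨H.trans G, ?_, ?_⟩
    · intro z hz
      rw [Homeomorph.trans_apply, hH z (fun j hj => hz j (Finset.mem_insert_of_mem hj)),
        hG z (hz i hiF)]
    · intro j hj
      rw [himg]
      rcases Finset.mem_insert.mp hj with rfl | hjF
      · exact ⟨d, hGd⟩
      · obtain ⟨e, he⟩ := hHd j hjF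
        refine ⟨e, ?_⟩
        rw [← he]
        have hfix : ∀ z ∈ D j, G z = z := fun z hz => hG z fun hzU =>
          disjoint_left.mp (hUD i hiF j hj (hne j hjF).symm) hzU hz
        ext z
        constructor
        · rintro ⟨⟨y, hy, rfl⟩, hz⟩
          have h1 : G y = y := G.injective (hfix _ hz)
          rw [h1] at hz ⊢
          exact ⟨hy, hz⟩
        · rintro ⟨hy, hz⟩
          exact ⟨⟨z, hy, hfix z hz⟩, hz⟩

/-- Collapsing one round disk to a point. -/
theorem exists_collapse (p : Pl) (r : ℝ) (hr : 0 < r) :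
    ∃ φ : Pl → Pl, Continuous φ ∧
      (∀ x y, φ x = φ y ↔ x = y ∨ (x ∈ Metric.closedBall p r ∧ y ∈ Metric.closedBall p r)) ∧
      (∀ x, 2 * r ≤ dist x p → φ x = x) ∧ (∀ x, dist (φ x) p ≤ dist x p) := by
  let k : ℝ → ℝ := fun s => min 1 (2 * max 0 (s - r) / max s r)
  have hm : ∀ s, 0 < max s r := fun s => lt_max_of_lt_right hr
  have hkc : Continuous k := by
    apply continuous_const.min
    exact Continuous.div (by fun_prop) (by fun_prop) (fun s => (hm s).ne')
  have hk0 : ∀ s, s ≤ r → k s = 0 := by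
    intro s hs
    simp [k, max_eq_left (sub_nonpos.mpr hs)]
  have hk1 : ∀ s, 2 * r ≤ s → k s = 1 := by
    intro s hs
    apply min_eq_left
    rw [max_eq_right (by linarith : 0 ≤ s - r), max_eq_left (by linarith : r ≤ s),
      le_div_iff₀ (by linarith)]
    linarith
  have hknn : ∀ s, 0 ≤ k s := by
    intro s
    have := hm s
    have h2 : 0 ≤ max 0 (s - r) := le_max_left _ _
    exact le_min zero_le_one (by positivity)
  have hkle : ∀ s, k s ≤ 1 := fun s => min_le_left _ _
  have hkpos : ∀ s, r < s → 0 < k s := by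
    intro s hs
    have h1 : 0 < max 0 (s - r) := lt_max_of_lt_right (by linarith)
    have := hm s
    exact lt_min one_pos (by positivity)
  have hks : ∀ s, r < s → k s * s = min s (2 * (s - r)) := by
    intro s hs
    have hs0 : 0 < s := by linarith
    simp only [k]
    rw [max_eq_right (by linarith : 0 ≤ s - r), max_eq_left hs.le, min_mul_of_nonneg _ _ hs0.le,
      one_mul, div_mul_cancel₀ _ hs0.ne']
  have hkinj : ∀ s t, r < s → r < t → k s * s = k t * t → s = t := by
    intro s t hs ht h
    rw [hks s hs, hks t ht] at h
    rcases min_cases s (2 * (s - r)) with h1 | h1 <;>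
      rcases min_cases t (2 * (t - r)) with h2 | h2 <;> linarith
  refine ⟨fun x => p + k ‖x - p‖ • (x - p), by fun_prop, ?_, ?_, ?_⟩
  · intro x y
    simp only [mem_closedBall_iff_norm]
    constructor
    · intro h
      have h' : k ‖x - p‖ • (x - p) = k ‖y - p‖ • (y - p) := by simpa using h
      have hn : k ‖x - p‖ * ‖x - p‖ = k ‖y - p‖ * ‖y - p‖ := by
        have := congrArg norm h'
        rwa [norm_smul, norm_smul, Real.norm_of_nonneg (hknn _),
          Real.norm_of_nonneg (hknn _)] at this
      have hpos : ∀ s, r < s → 0 < k s * s := fun s hs => mul_pos (hkpos s hs) (by linarith)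
      by_cases hx : ‖x - p‖ ≤ r
      · by_cases hy : ‖y - p‖ ≤ r
        · exact Or.inr ⟨hx, hy⟩
        · have := hpos _ (not_le.mp hy)
          rw [← hn, hk0 _ hx] at this
          simp at this
      · by_cases hy : ‖y - p‖ ≤ r
        · have := hpos _ (not_le.mp hx)
          rw [hn, hk0 _ hy] at this
          simp at this
        · left
          have heq := hkinj _ _ (not_le.mp hx) (not_le.mp hy) hn
          rw [heq] at h'
          have := smul_right_injective _ (hkpos _ (not_le.mp hy)).ne' h'
          simpa using this
    · rintro (rfl | ⟨hx, hy⟩)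
      · rfl
      · rw [hk0 _ hx, hk0 _ hy]
        simp
  · intro x hx
    rw [dist_eq_norm] at hx
    simp [hk1 _ hx]
  · intro x
    rw [dist_eq_norm, dist_eq_norm, add_sub_cancel_left, norm_smul, Real.norm_of_nonneg (hknn _)]
    have := hkle ‖x - p‖
    have h2 := norm_nonneg (x - p)
    nlinarith

/-- Collapsing finitely many disjoint round disks. -/
theorem multi_collapse {ι : Type*} [DecidableEq ι] (p : ι → Pl) (r : ℝ) (hr : 0 < r) (F : Finset ι)
    (hsep : ∀ i ∈ F, ∀ j ∈ F, i ≠ j → 3 * r < dist (p i) (p j)) :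
    ∃ Φ : Pl → Pl, Continuous Φ ∧
      ∀ x y, Φ x = Φ y ↔ x = y ∨
        ∃ i ∈ F, x ∈ Metric.closedBall (p i) r ∧ y ∈ Metric.closedBall (p i) r := by
  induction F using Finset.induction_on with
  | empty => exact ⟨id, continuous_id, by simp⟩
  | insert i F hi ih =>
    obtain ⟨Φ, hΦ, hΦ'⟩ := ih
      (fun j hj k hk => hsep j (Finset.mem_insert_of_mem hj) k (Finset.mem_insert_of_mem hk))
    obtain ⟨φ, hφ, hinj, hfix, hle⟩ := exists_collapse (p i) r hr
    refine ⟨Φ ∘ φ, hΦ.comp hφ, fun x y => ?_⟩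
    have hpre : ∀ j ∈ F, ∀ x, φ x ∈ Metric.closedBall (p j) r ↔ x ∈ Metric.closedBall (p j) r := by
      intro j hj x
      have hne : i ≠ j := fun h => hi (h ▸ hj)
      have hs := hsep i (Finset.mem_insert_self _ _) j (Finset.mem_insert_of_mem hj) hne
      have hfar : ∀ z, z ∈ Metric.closedBall (p j) r → 2 * r ≤ dist z (p i) := by
        intro z hz
        rw [Metric.mem_closedBall] at hz
        have := dist_triangle_left (p i) (p j) z
        linarith
      constructor
      · intro hx
        have h1 := hfar _ hx
        have h2 := hfix x (h1.trans (hle x))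
        rwa [h2] at hx
      · intro hx
        rwa [hfix x (hfar x hx)]
    rw [Function.comp_apply, Function.comp_apply, hΦ', hinj]
    constructor
    · rintro ((h | h) | ⟨j, hj, h1, h2⟩)
      · exact Or.inl h
      · exact Or.inr ⟨i, Finset.mem_insert_self _ _, h⟩
      · exact Or.inr ⟨j, Finset.mem_insert_of_mem hj, (hpre j hj x).mp h1, (hpre j hj y).mp h2⟩
    · rintro (h | ⟨j, hj, h1, h2⟩)
      · exact Or.inl (Or.inl h)
      · rcases Finset.mem_insert.mp hj with rfl | hjF
        · exact Or.inl (Or.inr ⟨h1, h2⟩)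
        · exact Or.inr ⟨j, hjF, (hpre j hjF x).mpr h1, (hpre j hjF y).mpr h2⟩
/-- Turning a family of injected disks on the sphere with finite pairwise intersections into a
map. -/
theorem isMapGraph_of_disks {V : Type} (G : SimpleGraph V) (F : V → ↥Disk2 → Pl)
    (hF : ∀ v, Continuous (F v)) (hFi : ∀ v, Function.Injective (F v))
    (hfin : ∀ u v, u ≠ v → (range (F u) ∩ range (F v)).Finite)
    (hadj : ∀ u v, u ≠ v → (G.Adj u v ↔ (range (F u) ∩ range (F v)).Nonempty)) :
    IsMapGraph G := by
  have hfact : Fact (Module.finrank ℝ (EuclideanSpace ℝ (Fin 3)) = 2 + 1) := ⟨by simp⟩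
  have hrank3 : 1 < Module.rank ℝ (EuclideanSpace ℝ (Fin 3)) := by
    rw [← Module.finrank_eq_rank]
    simp
  have hconn : IsConnected (Sphere2) := isConnected_sphere hrank3 0 zero_le_one
  have hcs : ConnectedSpace ↥Sphere2 := Subtype.connectedSpace hconn
  obtain ⟨q⟩ : Nonempty ↥Sphere2 := inferInstance
  have hnt : Nontrivial ↥Sphere2 := by
    refine ⟨q, -q, ?_⟩
    exact ne_neg_of_mem_unit_sphere ℝ q
  let ι : Pl → ↥Sphere2 := (stereographic' 2 q).symm
  have hι : Continuous ι := by
    have := (stereographic' 2 q).continuousOn_symm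
    rw [stereographic'_target] at this
    exact continuousOn_univ.mp this
  have hιi : Function.Injective ι := by
    have := (stereographic' 2 q).symm.injOn
    rw [OpenPartialHomeomorph.symm_source, stereographic'_target] at this
    exact injOn_univ.mp this
  let f : V → ↥Disk2 → ↥Sphere2 := fun v => ι ∘ F v
  have hf : ∀ v, Continuous (f v) := fun v => hι.comp (hF v)
  have hfi : ∀ v, Function.Injective (f v) := fun v => hιi.comp (hFi v)
  have hdc : CompactSpace ↥Disk2 := isCompact_iff_compactSpace.mp (isCompact_closedBall _ _)
  have hemb : ∀ v, Topology.IsClosedEmbedding (f v) := fun v =>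
    (hf v).isClosedEmbedding (hfi v)
  have hinter : ∀ u v, range (f u) ∩ range (f v) = ι '' (range (F u) ∩ range (F v)) := by
    intro u v
    rw [image_inter hιi, ← range_comp, ← range_comp]
  have hfin' : ∀ u v, u ≠ v → (range (f u) ∩ range (f v)).Finite := by
    intro u v huv
    rw [hinter]
    exact (hfin u v huv).image _
  have hdconn : IsPreconnected (univ : Set ↥Disk2) := by
    have : ConnectedSpace ↥Disk2 := Subtype.connectedSpace
      ⟨⟨0, by simp⟩, (convex_closedBall _ _).isPreconnected⟩
    exact isPreconnected_univ
  have hrconn : ∀ v, IsPreconnected (range (f v)) := by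
    intro v
    rw [← image_univ]
    exact hdconn.image _ (hf v).continuousOn
  have hrnt : ∀ v, (range (f v)).Nontrivial := by
    intro v
    let a : ↥Disk2 := ⟨0, by simp⟩
    let b : ↥Disk2 := ⟨EuclideanSpace.single 0 1, by simp⟩
    refine ⟨f v a, mem_range_self _, f v b, mem_range_self _, fun h => ?_⟩
    have h1 := congrArg Subtype.val (hfi v h)
    have h2 := congrArg norm h1
    simp [a, b] at h2
  -- a common point is never interior
  have hnot : ∀ u v, u ≠ v → ∀ x, x ∈ range (f u) → x ∉ interior (range (f v)) := by
    intro u v huv x hxu hxv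
    have hacc : AccPt x (Filter.principal (range (f u))) :=
      (hrconn u).preperfect_of_nontrivial (hrnt u) x hxu
    have h2 : AccPt x (Filter.principal (interior (range (f v)) ∩ range (f u))) :=
      hacc.nhds_inter (isOpen_interior.mem_nhds hxv)
    have h3 : (interior (range (f v)) ∩ range (f u)).Finite :=
      (hfin' u v huv).subset (fun y hy => ⟨hy.2, interior_subset hy.1⟩)
    have h4 : (interior (range (f v)) ∩ range (f u)).Infinite := by
      intro hfin0
      have h7 := accPt_iff_nhds.mp h2 ((interior (range (f v)) ∩ range (f u)) \ {x})ᶜ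
        ((hfin0.subset sdiff_subset).isClosed.isOpen_compl.mem_nhds (by simp))
      obtain ⟨y, ⟨hy1, hy2⟩, hyx⟩ := h7
      exact hy1 ⟨hy2, hyx⟩
    exact h4 h3
  refine ⟨fun v => range (f v), ?_, ?_, ?_⟩
  · intro v
    exact ⟨(hemb v).isEmbedding.toHomeomorph.symm⟩
  · intro v w hvw
    rw [eq_empty_iff_forall_notMem]
    rintro x ⟨h1, h2⟩
    exact hnot v w hvw x (interior_subset h1) h2
  · intro v w hvw
    rw [hadj v w hvw]
    constructor
    · rintro ⟨x, hx⟩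
      have hx' : ι x ∈ range (f v) ∩ range (f w) := by
        rw [hinter]
        exact mem_image_of_mem _ hx
      refine ⟨ι x, ?_, ?_⟩
      · exact ⟨subset_closure hx'.1, hnot w v hvw.symm _ hx'.2⟩
      · exact ⟨subset_closure hx'.2, hnot v w hvw _ hx'.1⟩
    · rintro ⟨x, h1, h2⟩
      have hx : x ∈ range (f v) ∩ range (f w) :=
        ⟨(hemb v).isClosed_range.frontier_subset h1, (hemb w).isClosed_range.frontier_subset h2⟩
      rw [hinter] at hx
      obtain ⟨y, hy, -⟩ := hx
      exact ⟨y, hy⟩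

/-- Adjacency in `cliqueEdgesGraph`. -/
theorem cliqueEdgesGraph_adj {V : Type} (G : SimpleGraph V)
    (B : Set (V × {S : Finset V // G.IsClique (S : Set V)})) (u : V)
    (S : {S : Finset V // G.IsClique (S : Set V)}) :
    (cliqueEdgesGraph G B).Adj (Sum.inl u) (Sum.inr S) ↔ (u, S) ∈ B := by
  simp [cliqueEdgesGraph, SimpleGraph.fromRel_adj]

theorem eventually_exists_radius {P : ℝ → Prop} (h : ∀ᶠ r in nhdsWithin (0 : ℝ) (Ioi 0), P r) :
    ∃ r > 0, P r := by
  have h2 : ∀ᶠ r in nhdsWithin (0 : ℝ) (Ioi 0), 0 < r := self_mem_nhdsWithin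
  obtain ⟨r, h3, h4⟩ := (h2.and h).exists
  exact ⟨r, h3, h4⟩

theorem eventually_of_small {P : ℝ → Prop} (δ : ℝ) (hδ : 0 < δ) (h : ∀ r, 0 < r → r < δ → P r) :
    ∀ᶠ r in nhdsWithin (0 : ℝ) (Ioi 0), P r := by
  filter_upwards [Ioo_mem_nhdsGT hδ] with r hr using h r hr.1 hr.2

set_option maxHeartbeats 1000000 in
/-- The planar graph `G_B` yields a map. -/
theorem isMapGraph_of_planar {V : Type} [Fintype V] (G : SimpleGraph V)
    (B : Set (V × {S : Finset V // G.IsClique (S : Set V)}))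
    (hBmem : ∀ p ∈ B, p.1 ∈ p.2.val)
    (hpl : GraphPlanar (cliqueEdgesGraph G B))
    (hB : ∀ ⦃u v : V⦄, G.Adj u v → ∃ S, (u, S) ∈ B ∧ (v, S) ∈ B) : IsMapGraph G := by
  classical
  obtain ⟨vtx, arc, hemb⟩ := hpl
  let C := {S : Finset V // G.IsClique (S : Set V)}
  have hCfin : Finite C := inferInstance
  have hadj : ∀ e : B, (cliqueEdgesGraph G B).Adj (Sum.inl e.1.1) (Sum.inr e.1.2) :=
    fun e => (cliqueEdgesGraph_adj G B _ _).mpr e.2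
  have harc : ∀ e : B, IsCompact (arc (Sum.inl e.1.1) (Sum.inr e.1.2)) := by
    intro e
    obtain ⟨p, -, hp⟩ := hemb.arc_path (hadj e)
    rw [← hp]
    exact isCompact_range p.continuous
  -- the radius
  obtain ⟨r, hr, hr1, hr2⟩ : ∃ r > 0, (∀ a b : V ⊕ C, a ≠ b → 3 * r < dist (vtx a) (vtx b)) ∧
      (∀ (e : B) (a : V ⊕ C), a ≠ Sum.inl e.1.1 → a ≠ Sum.inr e.1.2 →
        Disjoint (arc (Sum.inl e.1.1) (Sum.inr e.1.2)) (Metric.closedBall (vtx a) r)) := by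
    apply eventually_exists_radius
    apply Filter.Eventually.and
    · rw [Filter.eventually_all]
      intro a
      rw [Filter.eventually_all]
      intro b
      by_cases hab : a = b
      · simp [hab]
      · have hd : 0 < dist (vtx a) (vtx b) := dist_pos.mpr (hemb.vtx_inj.ne hab)
        refine eventually_of_small (dist (vtx a) (vtx b) / 3) (by positivity) ?_
        intro r _ hr _
        linarith
    · rw [Filter.eventually_all]
      intro e
      rw [Filter.eventually_all]
      intro a
      by_cases ha : a ≠ Sum.inl e.1.1 ∧ a ≠ Sum.inr e.1.2
      · have hn : vtx a ∉ arc (Sum.inl e.1.1) (Sum.inr e.1.2) := by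
          intro hmem
          rcases hemb.arc_vtx (hadj e) a hmem with h | h
          · exact ha.1 h
          · exact ha.2 h
        obtain ⟨δ, hδ, hδ'⟩ := Metric.isOpen_iff.mp (harc e).isClosed.isOpen_compl (vtx a) hn
        refine eventually_of_small δ hδ ?_
        intro r _ hr _ _
        rw [disjoint_left]
        intro x hx hxb
        exact hδ' (Metric.closedBall_subset_ball hr hxb) hx
      · refine Filter.Eventually.of_forall fun r h1 h2 => absurd ⟨h1, h2⟩ ha
  -- truncated arcs
  have hγ : ∀ e : B, ∃ γ : unitInterval → Pl, Continuous γ ∧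
      γ 0 ∈ Metric.closedBall (vtx (Sum.inl e.1.1)) r ∧
      γ 1 ∈ Metric.closedBall (vtx (Sum.inr e.1.2)) r ∧
      ∀ t, γ t ∈ arc (Sum.inl e.1.1) (Sum.inr e.1.2) ∧
        γ t ≠ vtx (Sum.inl e.1.1) ∧ γ t ≠ vtx (Sum.inr e.1.2) := by
    intro e
    obtain ⟨p, hpi, hp⟩ := hemb.arc_path (hadj e)
    obtain ⟨δ, hδ, hδ1, hδ2, hδ3⟩ : ∃ δ > 0, δ < 1 / 2 ∧
        p.extend δ ∈ Metric.closedBall (vtx (Sum.inl e.1.1)) r ∧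
        p.extend (1 - δ) ∈ Metric.closedBall (vtx (Sum.inr e.1.2)) r := by
      apply eventually_exists_radius
      refine (eventually_of_small (1 / 2) (by norm_num) fun r _ h => h).and
        (Filter.Eventually.and ?_ ?_)
      · have h1 : Filter.Tendsto (fun δ : ℝ => p.extend δ) (nhds 0) (nhds (p.extend 0)) :=
          p.continuous_extend.tendsto 0
        rw [Path.extend_zero] at h1
        exact nhdsWithin_le_nhds (h1 (Metric.closedBall_mem_nhds _ hr))
      · have h1 : Filter.Tendsto (fun δ : ℝ => p.extend (1 - δ)) (nhds 0)
            (nhds (p.extend (1 - 0))) :=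
          (p.continuous_extend.comp (continuous_const.sub continuous_id)).tendsto 0
        rw [sub_zero, Path.extend_one] at h1
        exact nhdsWithin_le_nhds (h1 (Metric.closedBall_mem_nhds _ hr))
    refine ⟨fun t => p.extend (δ + (1 - 2 * δ) * t), p.continuous_extend.comp (by fun_prop),
      by simpa using hδ2, ?_, ?_⟩
    · have : δ + (1 - 2 * δ) * ((1 : unitInterval) : ℝ) = 1 - δ := by
        simp
        ring
      simp only [this]
      exact hδ3
    · intro t
      have ht0 := t.2.1
      have ht1 := t.2.2
      have h0 : 0 < δ + (1 - 2 * δ) * (t : ℝ) := by nlinarith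
      have h1 : δ + (1 - 2 * δ) * (t : ℝ) < 1 := by nlinarith
      have hmem : δ + (1 - 2 * δ) * (t : ℝ) ∈ unitInterval := ⟨h0.le, h1.le⟩
      simp only [Path.extend_apply p hmem]
      refine ⟨hp ▸ mem_range_self _, ?_, ?_⟩
      · intro h
        have h2 := hpi (h.trans p.source.symm)
        have h3 := congrArg Subtype.val h2
        simp at h3
        linarith
      · intro h
        have h2 := hpi (h.trans p.target.symm)
        have h3 := congrArg Subtype.val h2
        simp at h3
        linarith
  choose γ hγc hγ0 hγ1 hγarc using hγ
  have hΓ : ∀ e, IsCompact (range (γ e)) := fun e => isCompact_range (hγc e)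
  obtain ⟨ε, hε, hε1, hε2⟩ : ∃ ε > 0,
      (∀ e e' : B, e ≠ e' → Disjoint (Metric.thickening ε (range (γ e)))
        (Metric.thickening ε (range (γ e')))) ∧
      (∀ (e : B) (a : V ⊕ C), a ≠ Sum.inl e.1.1 → a ≠ Sum.inr e.1.2 →
        Disjoint (Metric.thickening ε (range (γ e))) (Metric.closedBall (vtx a) r)) := by
    apply eventually_exists_radius
    apply Filter.Eventually.and
    · rw [Filter.eventually_all]
      intro e
      rw [Filter.eventually_all]
      intro e'
      by_cases hee : e = e'
      · simp [hee]
      · have hdis : Disjoint (range (γ e)) (range (γ e')) := by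
          rw [disjoint_left]
          rintro _ ⟨t, rfl⟩ ⟨t', htt⟩
          have hne : s((Sum.inl e.1.1 : V ⊕ C), Sum.inr e.1.2) ≠ s(Sum.inl e'.1.1, Sum.inr e'.1.2) := by
            intro h
            rw [Sym2.eq_iff] at h
            rcases h with ⟨h1, h2⟩ | ⟨h1, h2⟩
            · exact hee (Subtype.ext (Prod.ext (Sum.inl.inj h1) (Sum.inr.inj h2)))
            · cases h1
          have hm := hemb.arc_meet (hadj e) (hadj e') hne
            ⟨(hγarc e t).1, htt ▸ (hγarc e' t').1⟩
          rcases hm.1 with h | h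
          · exact (hγarc e t).2.1 h
          · exact (hγarc e t).2.2 h
        obtain ⟨δ, hδ, hδ'⟩ := hdis.exists_thickenings (hΓ e) (hΓ e').isClosed
        refine eventually_of_small δ hδ fun ε _ hε _ => ?_
        exact hδ'.mono (Metric.thickening_mono hε.le _) (Metric.thickening_mono hε.le _)
    · rw [Filter.eventually_all]
      intro e
      rw [Filter.eventually_all]
      intro a
      by_cases ha : a ≠ Sum.inl e.1.1 ∧ a ≠ Sum.inr e.1.2
      · have hdis : Disjoint (range (γ e)) (Metric.closedBall (vtx a) r) :=
          (hr2 e a ha.1 ha.2).mono_left (range_subset_iff.mpr fun t => (hγarc e t).1)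
        obtain ⟨δ, hδ, hδ'⟩ := hdis.exists_thickenings (hΓ e) Metric.isClosed_closedBall
        refine eventually_of_small δ hδ fun ε _ hε _ _ => ?_
        exact hδ'.mono (Metric.thickening_mono hε.le _) (Metric.self_subset_thickening hδ _)
      · exact Filter.Eventually.of_forall fun r h1 h2 => absurd ⟨h1, h2⟩ ha
  let U : V → C → Set Pl := fun v S =>
    if h : (v, S) ∈ B then Metric.thickening ε (range (γ ⟨(v, S), h⟩)) else ∅
  have hUB : ∀ v S (h : (v, S) ∈ B), U v S = Metric.thickening ε (range (γ ⟨(v, S), h⟩)) :=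
    fun v S h => dif_pos h
  have hUmem : ∀ v S x, x ∈ U v S → (v, S) ∈ B := by
    intro v S x hx
    by_contra hn
    simp [U, hn] at hx
  have hUU : ∀ v S v' S', (v, S) ≠ (v', S') → Disjoint (U v S) (U v' S') := by
    intro v S v' S' hne
    rw [disjoint_left]
    intro x hx hx'
    have h := hUmem _ _ _ hx
    have h' := hUmem _ _ _ hx'
    rw [hUB _ _ h] at hx
    rw [hUB _ _ h'] at hx'
    exact disjoint_left.mp (hε1 ⟨_, h⟩ ⟨_, h'⟩ (fun he => hne (congrArg Subtype.val he))) hx hx'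
  have hUball : ∀ v S (a : V ⊕ C), a ≠ Sum.inl v → a ≠ Sum.inr S →
      Disjoint (U v S) (Metric.closedBall (vtx a) r) := by
    intro v S a h1 h2
    rw [disjoint_left]
    intro x hx hx'
    have h := hUmem _ _ _ hx
    rw [hUB _ _ h] at hx
    exact disjoint_left.mp (hε2 ⟨_, h⟩ a h1 h2) hx hx'
  have hballs : ∀ a b : V ⊕ C, a ≠ b →
      Disjoint (Metric.closedBall (vtx a) r) (Metric.closedBall (vtx b) r) := by
    intro a b hab
    apply Metric.closedBall_disjoint_closedBall
    linarith [hr1 a b hab]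
  have hFin : Fintype C := Fintype.ofFinite C
  let K : V → Set Pl := fun v => Metric.closedBall (vtx (Sum.inl v)) r
  let D : C → Set Pl := fun S => Metric.closedBall (vtx (Sum.inr S)) r
  have hpath : ∀ v S, (v, S) ∈ B → ∃ g : unitInterval → Pl,
      Continuous g ∧ g 0 ∈ K v ∧ g 1 ∈ D S ∧ ∀ t, g t ∈ U v S := by
    intro v S hS
    refine ⟨γ ⟨(v, S), hS⟩, hγc ⟨(v, S), hS⟩, hγ0 ⟨(v, S), hS⟩, hγ1 ⟨(v, S), hS⟩, fun t => ?_⟩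
    rw [hUB v S hS]
    exact Metric.self_subset_thickening hε _ (mem_range_self t)
  have hH : ∀ v, ∃ H : Pl ≃ₜ Pl, (∀ z, (∀ S, z ∉ U v S) → H z = z) ∧
      ∀ S, (v, S) ∈ B → ∃ d, H '' K v ∩ D S = {d} := by
    intro v
    obtain ⟨H, h1, h2⟩ := multi_finger (K v) (isCompact_closedBall _ _) D (U v)
      (Finset.univ.filter fun S => (v, S) ∈ B)
      (fun S _ => Metric.isClosed_closedBall)
      (fun S hS => by
        rw [hUB v S (Finset.mem_filter.mp hS).2]
        exact Metric.isOpen_thickening)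
      (fun S _ => hballs _ _ (by simp))
      (fun S hS => hpath v S (Finset.mem_filter.mp hS).2)
      (fun S _ T _ hST => hUU _ _ _ _ (by simpa using hST))
      (fun S _ T _ hST => hUball _ _ _ (by simp) (by simpa using hST.symm))
    refine ⟨H, fun z hz => h1 z fun S _ => hz S, fun S hS => h2 S (by simpa using hS)⟩
  choose H hHfix hHd using hH
  have hHsub : ∀ v x, x ∈ H v '' K v → x ∈ K v ∨ ∃ S, x ∈ U v S := by
    rintro v _ ⟨k, hk, rfl⟩
    by_cases hx : ∃ S, H v k ∈ U v S
    · exact Or.inr hx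
    · left
      have h1 : H v (H v k) = H v k := hHfix v _ (fun S hS => hx ⟨S, hS⟩)
      rw [(H v).injective h1]
      exact hk
  have hHdisj : ∀ u v, u ≠ v → ∀ x, x ∈ H u '' K u → x ∉ H v '' K v := by
    intro u v huv x hu hv
    rcases hHsub u x hu with h1 | ⟨S, h1⟩ <;> rcases hHsub v x hv with h2 | ⟨T, h2⟩
    · exact disjoint_left.mp (hballs (Sum.inl u) (Sum.inl v) (by simpa using huv)) h1 h2
    · exact disjoint_left.mp (hUball v T (Sum.inl u) (by simpa using huv) (by simp)) h2 h1
    · exact disjoint_left.mp (hUball u S (Sum.inl v) (by simpa using huv.symm) (by simp)) h1 h2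
    · exact disjoint_left.mp (hUU u S v T (by simp [huv])) h1 h2
  have hHD : ∀ v S x, x ∈ H v '' K v → x ∈ D S → (v, S) ∈ B := by
    intro v S x hx hD
    rcases hHsub v x hx with h1 | ⟨T, h1⟩
    · exact absurd hD (disjoint_left.mp (hballs (Sum.inl v) (Sum.inr S) (by simp)) h1)
    · by_cases hST : S = T
      · rw [hST]
        exact hUmem _ _ _ h1
      · exact absurd hD (disjoint_left.mp (hUball v T (Sum.inr S) (by simp) (by simpa using hST)) h1)
  obtain ⟨Φ, hΦ, hΦ'⟩ := multi_collapse (fun S : C => vtx (Sum.inr S)) r hr Finset.univ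
    (fun S _ T _ hST => hr1 _ _ (by simpa using hST))
  have hΦinj : ∀ v, InjOn Φ (H v '' K v) := by
    intro v x hx y hy hxy
    rcases (hΦ' x y).mp hxy with h | ⟨S, -, h1, h2⟩
    · exact h
    · obtain ⟨d, hd⟩ := hHd v S (hHD v S x hx h1)
      have hx' : x ∈ H v '' K v ∩ D S := ⟨hx, h1⟩
      have hy' : y ∈ H v '' K v ∩ D S := ⟨hy, h2⟩
      rw [hd] at hx' hy'
      exact hx'.trans hy'.symm
  let A : V → ↥Disk2 → Pl := fun v x => vtx (Sum.inl v) + r • (x : Pl)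
  have hArange : ∀ v, range (A v) = K v := by
    intro v
    ext y
    constructor
    · rintro ⟨x, rfl⟩
      have hx : ‖(x : Pl)‖ ≤ 1 := mem_closedBall_zero_iff.mp x.2
      simp only [A, K, mem_closedBall_iff_norm, add_sub_cancel_left, norm_smul,
        Real.norm_of_nonneg hr.le]
      nlinarith
    · intro hy
      rw [mem_closedBall_iff_norm] at hy
      refine ⟨⟨r⁻¹ • (y - vtx (Sum.inl v)), ?_⟩, ?_⟩
      · rw [mem_closedBall_zero_iff, norm_smul, norm_inv, Real.norm_of_nonneg hr.le,
          inv_mul_le_iff₀ hr]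
        linarith
      · simp [A, smul_smul, mul_inv_cancel₀ hr.ne']
  have hFr : ∀ v, range (fun x => Φ (H v (A v x))) = Φ '' (H v '' K v) := by
    intro v
    rw [← hArange, ← range_comp, ← range_comp]
    rfl
  have hinter : ∀ u v, u ≠ v → ∀ z, z ∈ Φ '' (H u '' K u) → z ∈ Φ '' (H v '' K v) →
      ∃ S, (u, S) ∈ B ∧ (v, S) ∈ B ∧ z = Φ (vtx (Sum.inr S)) := by
    rintro u v huv z ⟨x, hx, rfl⟩ ⟨y, hy, hxy⟩
    rcases (hΦ' y x).mp hxy with h | ⟨S, -, h1, h2⟩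
    · exact absurd (h ▸ hy) (hHdisj u v huv x hx)
    · refine ⟨S, hHD u S x hx h2, hHD v S y hy h1, ?_⟩
      rw [hΦ']
      exact Or.inr ⟨S, Finset.mem_univ _, h2, by simp [hr.le]⟩
  apply isMapGraph_of_disks G (fun v x => Φ (H v (A v x)))
  · intro v
    exact hΦ.comp ((H v).continuous.comp (by fun_prop))
  · intro v x y hxy
    have h1 : ∀ x, H v (A v x) ∈ H v '' K v := fun x =>
      mem_image_of_mem _ (hArange v ▸ mem_range_self x)
    have h2 := (H v).injective (hΦinj v (h1 x) (h1 y) hxy)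
    have h3 : r • (x : Pl) = r • (y : Pl) := by simpa [A] using h2
    exact Subtype.ext (smul_right_injective _ hr.ne' h3)
  · intro u v huv
    rw [hFr, hFr]
    refine (Set.finite_range fun S : C => Φ (vtx (Sum.inr S))).subset ?_
    rintro z ⟨hz1, hz2⟩
    obtain ⟨S, -, -, hS⟩ := hinter u v huv z hz1 hz2
    exact ⟨S, hS.symm⟩
  · intro u v huv
    rw [hFr, hFr]
    constructor
    · intro h
      obtain ⟨S, hu, hv⟩ := hB h
      have hp : ∀ w, (w, S) ∈ B → Φ (vtx (Sum.inr S)) ∈ Φ '' (H w '' K w) := by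
        intro w hw
        obtain ⟨d, hd⟩ := hHd w S hw
        have hd' : d ∈ H w '' K w ∩ D S := by rw [hd]; rfl
        refine ⟨d, hd'.1, ?_⟩
        rw [hΦ']
        exact Or.inr ⟨S, Finset.mem_univ _, hd'.2, by simp [hr.le]⟩
      exact ⟨_, hp u hu, hp v hv⟩
    · rintro ⟨z, hz1, hz2⟩
      obtain ⟨S, hu, hv, -⟩ := hinter u v huv z hz1 hz2
      exact S.2 (hBmem _ hu) (hBmem _ hv) huv

/-- Parametrisation of a nation by the closed disk. -/
theorem exists_param (M : Set ↥Sphere2) (hM : Nonempty (↥M ≃ₜ ↥Disk2)) :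
    ∃ F : Pl → ↥Sphere2, ContinuousOn F (Metric.closedBall 0 1) ∧
      InjOn F (Metric.closedBall 0 1) ∧ F '' Metric.closedBall 0 1 = M := by
  classical
  obtain ⟨h⟩ := hM
  let z : ↥Disk2 := ⟨0, by simp⟩
  let F : Pl → ↥Sphere2 := fun y =>
    if hy : y ∈ Metric.closedBall (0 : Pl) 1 then (h.symm ⟨y, hy⟩ : ↥Sphere2)
    else (h.symm z : ↥Sphere2)
  have hF : ∀ y (hy : y ∈ Metric.closedBall (0 : Pl) 1), F y = (h.symm ⟨y, hy⟩ : ↥Sphere2) :=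
    fun y hy => dif_pos hy
  refine ⟨F, ?_, ?_, ?_⟩
  · rw [continuousOn_iff_continuous_domRestrict]
    have : (Metric.closedBall (0 : Pl) 1).domRestrict F = fun y => (h.symm y : ↥Sphere2) := by
      funext y
      exact hF y.1 y.2
    rw [this]
    exact continuous_subtype_val.comp h.symm.continuous
  · intro x hx y hy hxy
    rw [hF x hx, hF y hy] at hxy
    exact congrArg Subtype.val (h.symm.injective (Subtype.ext hxy))
  · ext p
    constructor
    · rintro ⟨y, hy, rfl⟩
      rw [hF y hy]
      exact (h.symm ⟨y, hy⟩).2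
    · intro hp
      refine ⟨(h ⟨p, hp⟩ : Pl), (h ⟨p, hp⟩).2, ?_⟩
      rw [hF _ (h ⟨p, hp⟩).2]
      simp

theorem mem_interior_param (F : Pl → ↥Sphere2) (hF : ContinuousOn F (Metric.closedBall 0 1))
    (hFi : InjOn F (Metric.closedBall 0 1)) (x : Pl) (hx : ‖x‖ < 1) :
    F x ∈ interior (F '' Metric.closedBall 0 1) := by
  have hfact : Fact (Module.finrank ℝ (EuclideanSpace ℝ (Fin 3)) = 2 + 1) := ⟨by simp⟩
  let q : ↥Sphere2 := -(F x)
  have hq : F x ≠ q := ne_neg_of_mem_unit_sphere ℝ (F x)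
  let φ := stereographic' 2 q
  have hsrc : φ.source = {q}ᶜ := stereographic'_source q
  have hnb : Metric.closedBall (0 : Pl) 1 ∈ nhds x :=
    Filter.mem_of_superset (Metric.isOpen_ball.mem_nhds (mem_ball_zero_iff.mpr hx))
      Metric.ball_subset_closedBall
  have hFx : ContinuousAt F x := hF.continuousAt hnb
  have h1 : F ⁻¹' {q}ᶜ ∩ Metric.closedBall (0 : Pl) 1 ∈ nhds x :=
    Filter.inter_mem (hFx.preimage_mem_nhds (isOpen_compl_singleton.mem_nhds hq)) hnb
  obtain ⟨ρ, hρ, hsub⟩ := Metric.nhds_basis_closedBall.mem_iff.mp h1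
  have hmaps : MapsTo F (Metric.closedBall x ρ) φ.source := by
    intro y hy
    rw [hsrc]
    exact (hsub hy).1
  have key := invariance_of_domain (fun y => φ (F y)) x ρ hρ
    (φ.continuousOn.comp (hF.mono fun y hy => (hsub hy).2) hmaps)
    (fun y hy z hz h => hFi (hsub hy).2 (hsub hz).2 (φ.injOn (hmaps hy) (hmaps hz) h))
  have hxs : F x ∈ φ.source := hmaps (Metric.mem_closedBall_self hρ.le)
  rw [mem_interior_iff_mem_nhds]
  have h2 : φ ⁻¹' ((fun y => φ (F y)) '' Metric.closedBall x ρ) ∈ nhds (F x) :=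
    (φ.continuousAt hxs).preimage_mem_nhds key
  filter_upwards [h2, φ.open_source.mem_nhds hxs] with z hz hzs
  obtain ⟨y, hy, hyz⟩ := hz
  exact ⟨y, (hsub hy).2, φ.injOn (hmaps hy) hzs hyz⟩

/-- Building a plane embedding of the clique edges graph from arcs. -/
theorem planar_of_arcs {V : Type} (G : SimpleGraph V)
    (B : Set (V × {S : Finset V // G.IsClique (S : Set V)}))
    (vtx : V ⊕ {S : Finset V // G.IsClique (S : Set V)} → Pl) (hvtx : Function.Injective vtx)
    (β : V → {S : Finset V // G.IsClique (S : Set V)} → unitInterval → Pl)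
    (hβc : ∀ u S, (u, S) ∈ B → Continuous (β u S))
    (hβi : ∀ u S, (u, S) ∈ B → Function.Injective (β u S))
    (hβ0 : ∀ u S, (u, S) ∈ B → β u S 0 = vtx (Sum.inl u))
    (hβ1 : ∀ u S, (u, S) ∈ B → β u S 1 = vtx (Sum.inr S))
    (hv : ∀ u S, (u, S) ∈ B → ∀ w t, vtx w = β u S t → w = Sum.inl u ∨ w = Sum.inr S)
    (hm : ∀ u S u' S', (u, S) ∈ B → (u', S') ∈ B → (u, S) ≠ (u', S') → ∀ t t',
      β u S t = β u' S' t' → (β u S t = vtx (Sum.inl u) ∨ β u S t = vtx (Sum.inr S)) ∧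
        (β u S t = vtx (Sum.inl u') ∨ β u S t = vtx (Sum.inr S'))) :
    GraphPlanar (cliqueEdgesGraph G B) := by
  let arc : V ⊕ {S : Finset V // G.IsClique (S : Set V)} →
      V ⊕ {S : Finset V // G.IsClique (S : Set V)} → Set Pl := fun a b =>
    match a, b with
    | Sum.inl u, Sum.inr S => range (β u S)
    | Sum.inr S, Sum.inl u => range (β u S)
    | _, _ => ∅
  -- every edge has the standard form
  have hform : ∀ a b, (cliqueEdgesGraph G B).Adj a b → ∃ u S, (u, S) ∈ B ∧
      arc a b = range (β u S) ∧
      ((a = Sum.inl u ∧ b = Sum.inr S) ∨ (a = Sum.inr S ∧ b = Sum.inl u)) := by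
    rintro (u | S) (v | T) h
    · simp [cliqueEdgesGraph, SimpleGraph.fromRel_adj] at h
    · exact ⟨u, T, (cliqueEdgesGraph_adj G B u T).mp h, rfl, Or.inl ⟨rfl, rfl⟩⟩
    · exact ⟨v, S, (cliqueEdgesGraph_adj G B v S).mp h.symm, rfl, Or.inr ⟨rfl, rfl⟩⟩
    · simp [cliqueEdgesGraph, SimpleGraph.fromRel_adj] at h
  refine ⟨vtx, arc, hvtx, ?_, ?_, ?_, ?_⟩
  · rintro (u | S) (v | T) <;> rfl
  · intro a b h
    obtain ⟨u, S, hB, harc, ⟨rfl, rfl⟩ | ⟨rfl, rfl⟩⟩ := hform a b h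
    · let p : Path (vtx (Sum.inl u)) (vtx (Sum.inr S)) :=
        ⟨⟨β u S, hβc u S hB⟩, hβ0 u S hB, hβ1 u S hB⟩
      exact ⟨p, hβi u S hB, harc.symm⟩
    · let p : Path (vtx (Sum.inl u)) (vtx (Sum.inr S)) :=
        ⟨⟨β u S, hβc u S hB⟩, hβ0 u S hB, hβ1 u S hB⟩
      refine ⟨p.symm, ?_, ?_⟩
      · intro x y hxy
        exact unitInterval.symm_bijective.injective (hβi u S hB hxy)
      · rw [Path.symm_range]
        exact harc.symm
  · intro a b h w hw
    obtain ⟨u, S, hB, harc, hab⟩ := hform a b h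
    rw [harc] at hw
    obtain ⟨t, ht⟩ := hw
    have := hv u S hB w t ht.symm
    rcases hab with ⟨rfl, rfl⟩ | ⟨rfl, rfl⟩
    · exact this
    · exact this.symm
  · intro a b a' b' h h' hne x hx
    obtain ⟨u, S, hB, harc, hab⟩ := hform a b h
    obtain ⟨u', S', hB', harc', hab'⟩ := hform a' b' h'
    rw [harc, harc'] at hx
    obtain ⟨⟨t, ht⟩, ⟨t', ht'⟩⟩ := hx
    have hne' : (u, S) ≠ (u', S') := by
      rintro he
      obtain ⟨rfl, rfl⟩ := Prod.mk.inj he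
      apply hne
      rcases hab with ⟨rfl, rfl⟩ | ⟨rfl, rfl⟩ <;> rcases hab' with ⟨rfl, rfl⟩ | ⟨rfl, rfl⟩ <;>
        simp [Sym2.eq_swap]
    have key := hm u S u' S' hB hB' hne' t t' (ht.trans ht'.symm)
    rw [ht] at key
    constructor
    · rcases hab with ⟨rfl, rfl⟩ | ⟨rfl, rfl⟩
      · exact key.1
      · exact key.1.symm
    · rcases hab' with ⟨rfl, rfl⟩ | ⟨rfl, rfl⟩
      · exact key.2
      · exact key.2.symm

set_option maxHeartbeats 1000000 in
/-- A map yields a planar graph `G_B`. -/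
theorem planar_of_isMapGraph {V : Type} [Fintype V] (G : SimpleGraph V) (hG : IsMapGraph G) :
    ∃ B : Set (V × {S : Finset V // G.IsClique (S : Set V)}),
        (∀ p ∈ B, p.1 ∈ p.2.val) ∧
        GraphPlanar (cliqueEdgesGraph G B) ∧
        (∀ ⦃u v : V⦄, G.Adj u v → ∃ S, (u, S) ∈ B ∧ (v, S) ∈ B) := by
  classical
  rcases isEmpty_or_nonempty V with hV | ⟨⟨v0⟩⟩
  · refine ⟨∅, by simp, ?_, fun u => hV.elim u⟩
    refine planar_of_arcs G ∅ (fun _ => 0) ?_ (fun _ _ _ => 0) (by simp) (by simp) (by simp)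
      (by simp) (by simp) (by simp)
    rintro (u | S) (v | T) _
    · exact hV.elim u
    · exact hV.elim u
    · exact hV.elim v
    · congr 1
      exact Subsingleton.elim _ _
  obtain ⟨M, hM⟩ := hG
  have hfact : Fact (Module.finrank ℝ (EuclideanSpace ℝ (Fin 3)) = 2 + 1) := ⟨by simp⟩
  let C := {S : Finset V // G.IsClique (S : Set V)}
  have hCfin : Finite C := inferInstance
  choose F hFc hFi hFM using fun v => exists_param (M v) (hM.nation_disk v)
  have hmem : ∀ v x, ‖x‖ ≤ 1 → F v x ∈ M v := by
    intro v x hx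
    rw [← hFM v]
    exact mem_image_of_mem _ (mem_closedBall_zero_iff.mpr hx)
  have hinj : ∀ v x y, ‖x‖ ≤ 1 → ‖y‖ ≤ 1 → F v x = F v y → x = y := fun v x y hx hy h =>
    hFi v (mem_closedBall_zero_iff.mpr hx) (mem_closedBall_zero_iff.mpr hy) h
  have hI : ∀ v x, ‖x‖ < 1 → F v x ∈ interior (M v) := by
    intro v x hx
    have := mem_interior_param (F v) (hFc v) (hFi v) x hx
    rwa [hFM v] at this
  have hMcl : ∀ v, IsClosed (M v) := by
    intro v
    rw [← hFM v]
    exact ((isCompact_closedBall _ _).image_of_continuousOn (hFc v)).isClosed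
  have hfr : ∀ v p, p ∈ frontier (M v) → ∃ s : Pl, ‖s‖ = 1 ∧ F v s = p := by
    intro v p hp
    have h1 : p ∈ M v := (hMcl v).frontier_subset hp
    rw [← hFM v] at h1
    obtain ⟨s, hs, rfl⟩ := h1
    rw [mem_closedBall_zero_iff] at hs
    refine ⟨s, le_antisymm hs ?_, rfl⟩
    by_contra hlt
    exact hp.2 (hI v s (not_le.mp hlt))
  have hcl : ∀ u v, u ≠ v → ∀ x, x ∈ M u → x ∉ interior (M v) := by
    intro u v huv x hxu hxv
    rw [← hFM u] at hxu
    have hcb : closure (Metric.ball (0 : Pl) 1) = Metric.closedBall 0 1 :=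
      closure_ball 0 one_ne_zero
    have h1 : x ∈ closure (F u '' Metric.ball 0 1) := by
      have h2 := ContinuousOn.image_closure (f := F u) (s := Metric.ball (0 : Pl) 1)
        (by rw [hcb]; exact hFc u)
      rw [hcb] at h2
      exact h2 hxu
    obtain ⟨y, hyv, ⟨z, hz, rfl⟩⟩ := mem_closure_iff.mp h1 _ isOpen_interior hxv
    have h3 : F u z ∈ interior (M u) ∩ interior (M v) :=
      ⟨hI u z (mem_ball_zero_iff.mp hz), hyv⟩
    rw [hM.interiors_disjoint huv] at h3
    exact h3
  have hfi : ∀ u p, p ∈ frontier (M u) → ∀ v, p ∉ interior (M v) := by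
    intro u p hp v
    by_cases huv : u = v
    · rw [← huv]
      exact hp.2
    · exact hcl u v huv p ((hMcl u).frontier_subset hp)
  have hns : Nonempty ↥Sphere2 := ⟨F v0 0⟩
  -- the cliques realised by points
  let T : C → Prop := fun S => S.1.Nonempty ∧ ∃ p : ↥Sphere2, ∀ v, v ∈ S.1 ↔ p ∈ frontier (M v)
  have hp0 : ∀ S : C, ∃ p : ↥Sphere2, T S → ∀ v, v ∈ S.1 ↔ p ∈ frontier (M v) := by
    intro S
    by_cases hS : T S
    · obtain ⟨p, hp⟩ := hS.2
      exact ⟨p, fun _ => hp⟩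
    · exact ⟨F v0 0, fun h => absurd h hS⟩
  choose p hp using hp0
  have hpint : ∀ S, T S → ∀ v, p S ∉ interior (M v) := by
    intro S hS
    obtain ⟨w, hw⟩ := hS.1
    exact hfi w _ ((hp S hS w).mp hw)
  have hpinj : ∀ S S', T S → T S' → p S = p S' → S = S' := by
    intro S S' hS hS' h
    apply Subtype.ext
    ext v
    rw [hp S hS, hp S' hS', h]
  let B : Set (V × C) := {x | T x.2 ∧ x.1 ∈ x.2.1}
  have hs0 : ∀ u S, ∃ s : Pl, (u, S) ∈ B → ‖s‖ = 1 ∧ F u s = p S := by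
    intro u S
    by_cases h : (u, S) ∈ B
    · obtain ⟨s, hs⟩ := hfr u (p S) ((hp S h.1 u).mp h.2)
      exact ⟨s, fun _ => hs⟩
    · exact ⟨0, fun h' => absurd h' h⟩
  choose s hs using hs0
  -- auxiliary points
  let Y : Set Pl := Metric.sphere (0 : Pl) (1 / 2) \ range (fun S => (1 / 2 : ℝ) • s v0 S)
  have hYinf : Y.Infinite := by
    apply Set.Infinite.sdiff _ (finite_range _)
    apply (isPreconnected_sphere rank_Pl 0 (1 / 2)).infinite_of_nontrivial
    refine ⟨EuclideanSpace.single 0 (1 / 2), by simp, -EuclideanSpace.single 0 (1 / 2), by simp, ?_⟩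
    intro h
    have h2 := congrArg (fun x : Pl => x 0) h
    simp at h2
    norm_num at h2
  have hYi : Infinite Y := hYinf.to_subtype
  obtain ⟨n, ⟨eqv⟩⟩ := Finite.exists_equiv_fin (Option C)
  let y : Option C → Y := fun o => Infinite.natEmbedding Y (eqv o)
  have hyinj : Function.Injective y := by
    intro a b h
    exact eqv.injective (Fin.ext ((Infinite.natEmbedding Y).injective h))
  have hyn : ∀ o, ‖(y o : Pl)‖ = 1 / 2 := fun o => mem_sphere_zero_iff_norm.mp (y o).2.1
  let z : Option C → ↥Sphere2 := fun o => F v0 (y o)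
  have hzint : ∀ o, z o ∈ interior (M v0) := fun o => hI v0 _ (by rw [hyn]; norm_num)
  have hzinj : ∀ o o', z o = z o' → o = o' := by
    intro o o' h
    apply hyinj
    apply Subtype.ext
    exact hinj v0 _ _ (by rw [hyn]; norm_num) (by rw [hyn]; norm_num) h
  have hcz : ∀ v o, F v 0 ≠ z o := by
    intro v o h
    by_cases hv : v = v0
    · subst hv
      have h1 := hinj v _ _ (by simp) (by rw [hyn]; norm_num) h
      have h2 := hyn o
      rw [← h1] at h2
      norm_num at h2
    · refine hcl v v0 hv (F v 0) (hmem v 0 (by simp)) ?_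
      rw [h]
      exact hzint o
  have hpz : ∀ S o, T S → p S ≠ z o := by
    intro S o hS h
    apply hpint S hS v0
    rw [h]
    exact hzint o
  have hcp : ∀ v S, T S → F v 0 ≠ p S := by
    intro v S hS h
    apply hpint S hS v
    rw [← h]
    exact hI v 0 (by simp)
  have hcc : ∀ u v, F u 0 = F v 0 → u = v := by
    intro u v h
    by_contra huv
    refine hcl u v huv (F u 0) (hmem u 0 (by simp)) ?_
    rw [h]
    exact hI v 0 (by simp)
  let P : V ⊕ C → ↥Sphere2 := Sum.elim (fun v => F v 0) (fun S => if T S then p S else z (some S))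
  have hPl : ∀ v, P (Sum.inl v) = F v 0 := fun v => rfl
  have hPT : ∀ S, T S → P (Sum.inr S) = p S := fun S hS => if_pos hS
  have hPn : ∀ S, ¬ T S → P (Sum.inr S) = z (some S) := fun S hS => if_neg hS
  have hPinj : Function.Injective P := by
    rintro (u | S) (v | S') h
    · rw [hcc u v h]
    · exfalso
      by_cases hS : T S'
      · rw [hPT _ hS] at h
        exact hcp u S' hS h
      · rw [hPn _ hS] at h
        exact hcz u _ h
    · exfalso
      by_cases hS : T S
      · rw [hPT _ hS] at h
        exact hcp v S hS h.symm
      · rw [hPn _ hS] at h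
        exact hcz v _ h.symm
    · by_cases hS : T S <;> by_cases hS' : T S'
      · rw [hPT _ hS, hPT _ hS'] at h
        rw [hpinj S S' hS hS' h]
      · rw [hPT _ hS, hPn _ hS'] at h
        exact absurd h (hpz _ _ hS)
      · rw [hPn _ hS, hPT _ hS'] at h
        exact absurd h.symm (hpz _ _ hS')
      · rw [hPn _ hS, hPn _ hS'] at h
        rw [Option.some.inj (hzinj _ _ h)]
  let q : ↥Sphere2 := z none
  have hPq : ∀ a, P a ≠ q := by
    rintro (u | S) h
    · exact hcz u _ h
    · by_cases hS : T S
      · rw [hPT _ hS] at h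
        exact hpz S _ hS h
      · rw [hPn _ hS] at h
        have := hzinj _ _ h
        simp at this
  let b : V → C → unitInterval → ↥Sphere2 := fun u S t => F u ((t : ℝ) • s u S)
  have hn : ∀ u S, (u, S) ∈ B → ∀ t : unitInterval, ‖(t : ℝ) • s u S‖ = t := by
    intro u S h t
    rw [norm_smul, (hs u S h).1, mul_one, Real.norm_of_nonneg t.2.1]
  have hn1 : ∀ u S, (u, S) ∈ B → ∀ t : unitInterval, ‖(t : ℝ) • s u S‖ ≤ 1 := by
    intro u S h t
    rw [hn u S h t]
    exact t.2.2
  have hb0 : ∀ u S, b u S 0 = F u 0 := by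
    intro u S
    simp [b]
  have hb1 : ∀ u S, (u, S) ∈ B → b u S 1 = p S := by
    intro u S h
    simp [b, (hs u S h).2]
  have hbM : ∀ u S, (u, S) ∈ B → ∀ t, b u S t ∈ M u := fun u S h t => hmem u _ (hn1 u S h t)
  have hbI : ∀ u S, (u, S) ∈ B → ∀ t, t ≠ 1 → b u S t ∈ interior (M u) := by
    intro u S h t ht
    apply hI
    rw [hn u S h t]
    exact lt_of_le_of_ne t.2.2 (fun h => ht (Subtype.ext h))
  have hbz : ∀ u S, (u, S) ∈ B → ∀ t o, b u S t ≠ z o := by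
    intro u S h t o he
    by_cases hu : u = v0
    · subst hu
      have h1 := hinj u _ _ (hn1 u S h t) (by rw [hyn]; norm_num) he
      have h2 := hn u S h t
      rw [h1, hyn] at h2
      apply (y o).2.2
      refine ⟨S, ?_⟩
      rw [← h1, ← h2]
    · refine hcl u v0 hu _ (hbM u S h t) ?_
      rw [he]
      exact hzint o
  have hbinj : ∀ u S, (u, S) ∈ B → Function.Injective (b u S) := by
    intro u S h t t' he
    have h1 := hinj u _ _ (hn1 u S h t) (hn1 u S h t') he
    have h2 := hn u S h t
    rw [h1, hn u S h t'] at h2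
    exact Subtype.ext h2.symm
  have hbc : ∀ u S, (u, S) ∈ B → Continuous (b u S) := by
    intro u S h
    exact (hFc u).comp_continuous (by fun_prop) fun t =>
      mem_closedBall_zero_iff.mpr (hn1 u S h t)
  let φ := stereographic' 2 q
  have hsrc : ∀ x, x ≠ q → x ∈ φ.source := by
    intro x hx
    rw [show φ.source = {q}ᶜ from stereographic'_source q]
    exact hx
  have hφi : ∀ x x', x ≠ q → x' ≠ q → φ x = φ x' → x = x' := fun x x' hx hx' h =>
    φ.injOn (hsrc x hx) (hsrc x' hx') h
  refine ⟨B, fun x hx => hx.2, ?_, ?_⟩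
  · apply planar_of_arcs G B (fun a => φ (P a))
      (fun a a' h => hPinj (hφi _ _ (hPq a) (hPq a') h)) (fun u S t => φ (b u S t))
    · intro u S h
      exact φ.continuousOn.comp_continuous (hbc u S h) fun t => hsrc _ (hbz u S h t none)
    · intro u S h t t' he
      exact hbinj u S h (hφi _ _ (hbz u S h t none) (hbz u S h t' none) he)
    · intro u S h
      rw [hb0, hPl]
    · intro u S h
      rw [hb1 u S h, hPT S h.1]
    · intro u S h w t he
      have he' := hφi _ _ (hPq w) (hbz u S h t none) he
      rcases w with v | S'
      · left
        rw [hPl] at he'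
        by_contra hne
        have huv : u ≠ v := fun huv => hne (by rw [huv])
        refine hcl u v huv _ (hbM u S h t) ?_
        rw [← he']
        exact hI v 0 (by simp)
      · right
        by_cases hS' : T S'
        · rw [hPT _ hS'] at he'
          have ht : t = 1 := by
            by_contra ht
            apply hpint S' hS' u
            rw [he']
            exact hbI u S h t ht
          rw [ht, hb1 u S h] at he'
          rw [hpinj _ _ hS' h.1 he']
        · rw [hPn _ hS'] at he'
          exact absurd he'.symm (hbz u S h t _)
    · intro u S u' S' h h' hne t t' he
      have he' := hφi _ _ (hbz u S h t none) (hbz u' S' h' t' none) he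
      by_cases hu : u = u'
      · subst hu
        have h1 := hinj u _ _ (hn1 u S h t) (hn1 u S' h' t') he'
        have h2 := hn u S h t
        rw [h1, hn u S' h' t'] at h2
        have h3 : t = t' := Subtype.ext h2.symm
        subst h3
        by_cases ht : t = 0
        · subst ht
          refine ⟨Or.inl ?_, Or.inl ?_⟩ <;> rw [hb0, hPl]
        · exfalso
          have ht' : (t : ℝ) ≠ 0 := fun h0 => ht (Subtype.ext h0)
          have h4 := smul_right_injective _ ht' h1
          have h5 : p S = p S' := by rw [← (hs u S h).2, ← (hs u S' h').2, h4]
          exact hne (by rw [hpinj S S' h.1 h'.1 h5])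
      · have ht : t = 1 := by
          by_contra ht
          refine hcl u' u (Ne.symm hu) _ (hbM u' S' h' t') ?_
          rw [← he']
          exact hbI u S h t ht
        have ht' : t' = 1 := by
          by_contra ht'
          refine hcl u u' hu _ (hbM u S h t) ?_
          rw [he']
          exact hbI u' S' h' t' ht'
        subst ht
        subst ht'
        rw [he]
        refine ⟨Or.inr ?_, Or.inr ?_⟩
        · rw [← he', hb1 u S h, hPT S h.1]
        · rw [hb1 u' S' h', hPT S' h'.1]
  · intro u v huv
    obtain ⟨x, hxu, hxv⟩ := (hM.adj_iff huv.ne).mp huv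
    let S0 : Finset V := Finset.univ.filter fun w => x ∈ frontier (M w)
    have hS0 : ∀ w, w ∈ S0 ↔ x ∈ frontier (M w) := by simp [S0]
    let S : C := ⟨S0, by
      intro a ha c hc hac
      exact (hM.adj_iff hac).mpr ⟨x, (hS0 a).mp ha, (hS0 c).mp hc⟩⟩
    have hT : T S := ⟨⟨u, (hS0 u).mpr hxu⟩, x, hS0⟩
    exact ⟨S, ⟨hT, (hS0 u).mpr hxu⟩, ⟨hT, (hS0 v).mpr hxv⟩⟩

/-- `G` is a map graph iff there is a subset `B` of the edges joining the
clique-vertices `v_S` of `G*` to the vertices of `S` such that the graph `G_B` formed by the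
edges of `B` is planar and every edge `(u,v)` of `G` is realized by a two-edge path of `B`
through some common clique-vertex. -/
theorem mapGraph_iff_exists_planar_B
    {V : Type} [Fintype V] (G : SimpleGraph V) :
    IsMapGraph G ↔
      ∃ B : Set (V × {S : Finset V // G.IsClique (S : Set V)}),
        (∀ p ∈ B, p.1 ∈ p.2.val) ∧
        GraphPlanar (cliqueEdgesGraph G B) ∧
        (∀ ⦃u v : V⦄, G.Adj u v → ∃ S, (u, S) ∈ B ∧ (v, S) ∈ B) := by
  exact ⟨planar_of_isMapGraph G, fun ⟨B, h1, h2, h3⟩ => isMapGraph_of_planar G B h1 h2 h3⟩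

end
end
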